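/- arXiv:2405.02440 — 4 statements merged into one kernel-verified Lean document; each statement's English description precedes it below -/
import Mathlib

section
/- For every n ≥ 1 there exists ε_n > 0, depending only on n, with the following property. Let K, L ⊆ ℝⁿ be convex bodies, each with centroid at the origin and with Binet–Legendre ellipsoid equal to the closed Euclidean unit ball Bⁿ. Suppose 0 < ε ≤ ε_n and there exist an invertible affine map S : ℝⁿ → ℝⁿ and z ∈ ℝⁿ with K ⊆ S(L) ⊆ (1 + ε)·K + z. Then there exists a linear orthogonal map T ∈ O(n) such that (1 + d_n·ε)^{-1}·K ⊆ T(L) ⊆ (1 + d_n·ε)·K, where d_n = 4n·(b_n/a_n)·(1 + 5n·b_n/a_n), a_n = 2^{-n/2-1}·n^{-3n/4-3/2}, and b_n = 2^{n/2+1}·n^{3n/4+3/2}. -/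
open Set Metric Pointwise MeasureTheory

/-- The centroid (center of mass) of a set `K ⊆ ℝⁿ`. -/
noncomputable def centroid {n : ℕ} (K : Set (EuclideanSpace ℝ (Fin n))) :
    EuclideanSpace ℝ (Fin n) :=
  (volume K).toReal⁻¹ • ∫ x in K, x

/-- The Binet–Legendre ellipsoid of `K` is the Euclidean unit ball, expressed via the
defining inner product on linear functionals. -/
def isBLUnitBall {n : ℕ} (K : Set (EuclideanSpace ℝ (Fin n))) : Prop :=
  ∀ φ : EuclideanSpace ℝ (Fin n) →L[ℝ] ℝ,
    ((n : ℝ) + 2) / (volume K).toReal * ∫ y in K, (φ y) ^ 2 = ‖φ‖ ^ 2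

/-- `aConst n = 2^(-n/2-1) * n^(-3n/4-3/2)`. -/
noncomputable def aConst (n : ℕ) : ℝ :=
  (2 : ℝ) ^ (-(n : ℝ) / 2 - 1) * (n : ℝ) ^ (-(3 * (n : ℝ)) / 4 - 3 / 2)

/-- `bConst n = 2^(n/2+1) * n^(3n/4+3/2)`. -/
noncomputable def bConst (n : ℕ) : ℝ :=
  (2 : ℝ) ^ ((n : ℝ) / 2 + 1) * (n : ℝ) ^ (3 * (n : ℝ) / 4 + 3 / 2)

/-- `dConst n = 4n (b_n/a_n) (1 + 5n b_n/a_n)`. -/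
noncomputable def dConst (n : ℕ) : ℝ :=
  4 * n * (bConst n / aConst n) * (1 + 5 * n * bConst n / aConst n)

section NormalizedBodies

variable {n : ℕ} {K L : Set (EuclideanSpace ℝ (Fin n))}

lemma volume_real_pos_of_isCompact (hK : IsCompact K) (hi : (interior K).Nonempty) :
    0 < volume.real K :=
  ENNReal.toReal_pos (Measure.measure_pos_of_nonempty_interior _ hi).ne' hK.measure_lt_top.ne

lemma setIntegral_eq_zero_of_centroid_eq_zero (hK : IsCompact K) (hV : 0 < volume.real K)
    (hc : centroid K = 0) (φ : EuclideanSpace ℝ (Fin n) →L[ℝ] ℝ) : ∫ x in K, φ x = 0 := by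
  have h : ∫ x in K, x = 0 := (smul_eq_zero.1 hc).resolve_left (inv_ne_zero hV.ne')
  have hi : IntegrableOn (fun x : EuclideanSpace ℝ (Fin n) => x) K :=
    continuous_id.continuousOn.integrableOn_compact hK
  rw [φ.integral_comp_comm hi, h, map_zero]

lemma setIntegral_sq_of_isBLUnitBall (hV : 0 < volume.real K) (hb : isBLUnitBall K)
    (φ : EuclideanSpace ℝ (Fin n) →L[ℝ] ℝ) :
    ∫ x in K, (φ x) ^ 2 = volume.real K * ‖φ‖ ^ 2 / (n + 2) := by
  have hV' : (volume K).toReal ≠ 0 := hV.ne'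
  have hn : (n : ℝ) + 2 ≠ 0 := by positivity
  rw [← hb φ, measureReal_def]
  field_simp

/-- Second moments of affine functions on a normalized body. -/
lemma setIntegral_add_const_sq (hK : IsCompact K) (hV : 0 < volume.real K)
    (hc : centroid K = 0) (hb : isBLUnitBall K) (φ : EuclideanSpace ℝ (Fin n) →L[ℝ] ℝ) (c : ℝ) :
    ∫ x in K, (φ x + c) ^ 2 = volume.real K * (‖φ‖ ^ 2 / (n + 2) + c ^ 2) := by
  have h1 : IntegrableOn (fun x => φ x ^ 2) K :=
    ContinuousOn.integrableOn_compact hK (by fun_prop)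
  have h2 : IntegrableOn (fun x => 2 * c * φ x) K :=
    ContinuousOn.integrableOn_compact hK (by fun_prop)
  have h3 : IntegrableOn (fun _ => c ^ 2) K :=
    ContinuousOn.integrableOn_compact hK (by fun_prop)
  have : ∀ x, (φ x + c) ^ 2 = φ x ^ 2 + 2 * c * φ x + c ^ 2 := fun x => by ring
  simp_rw [this]
  have h12 : IntegrableOn (fun x => φ x ^ 2 + 2 * c * φ x) K := h1.add h2
  rw [integral_add h12 h3, integral_add h1 h2, integral_const_mul,
    setIntegral_eq_zero_of_centroid_eq_zero hK hV hc, setIntegral_sq_of_isBLUnitBall hV hb,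
    setIntegral_const, smul_eq_mul]
  ring

lemma setIntegral_image_affine (hK : MeasurableSet K)
    (A : EuclideanSpace ℝ (Fin n) →L[ℝ] EuclideanSpace ℝ (Fin n)) (hA : Function.Injective A)
    (c : EuclideanSpace ℝ (Fin n)) (g : EuclideanSpace ℝ (Fin n) → ℝ) :
    ∫ x in (fun y => A y + c) '' K, g x = |A.det| * ∫ x in K, g (A x + c) := by
  rw [integral_image_eq_integral_abs_det_fderiv_smul volume hK (f' := fun _ => A)
    (fun x _ => (A.hasFDerivAt.add_const c).hasFDerivWithinAt)
    (fun x _ y _ h => hA (add_right_cancel h))]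
  simp_rw [smul_eq_mul]
  rw [integral_const_mul]

lemma volume_real_image_affine (hK : MeasurableSet K)
    (A : EuclideanSpace ℝ (Fin n) →L[ℝ] EuclideanSpace ℝ (Fin n)) (hA : Function.Injective A)
    (c : EuclideanSpace ℝ (Fin n)) :
    volume.real ((fun y => A y + c) '' K) = |A.det| * volume.real K := by
  simpa using setIntegral_image_affine hK A hA c (fun _ => 1)

lemma abs_det_smul_id {t : ℝ} (ht : 0 ≤ t) :
    |(t • ContinuousLinearMap.id ℝ (EuclideanSpace ℝ (Fin n))).det| = t ^ n := by
  have : (t • ContinuousLinearMap.id ℝ (EuclideanSpace ℝ (Fin n))).det = t ^ n := by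
    rw [ContinuousLinearMap.det]
    simp
  rw [this, abs_of_nonneg (by positivity)]

lemma injective_smul_id {t : ℝ} (ht : 0 < t) :
    Function.Injective (t • ContinuousLinearMap.id ℝ (EuclideanSpace ℝ (Fin n))) :=
  fun _ _ h => smul_right_injective _ ht.ne' h

lemma sq_apply_le_of_normalized (hK : IsCompact K) (hcv : Convex ℝ K) (hV : 0 < volume.real K)
    (hc : centroid K = 0) (hb : isBLUnitBall K) {R : ℝ}
    (hR2 : (n + 2) * R ^ 2 = (2 : ℝ) ^ (n + 2)) {x : EuclideanSpace ℝ (Fin n)} (hx : x ∈ K)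
    (φ : EuclideanSpace ℝ (Fin n) →L[ℝ] ℝ) : (φ x) ^ 2 ≤ R ^ 2 * ‖φ‖ ^ 2 := by
  set A := (1 / 2 : ℝ) • ContinuousLinearMap.id ℝ (EuclideanSpace ℝ (Fin n)) with hA
  have hsub : (fun y => A y + (1 / 2 : ℝ) • x) '' K ⊆ K := by
    rintro _ ⟨y, hy, rfl⟩
    exact hcv hy hx (by norm_num) (by norm_num) (by norm_num)
  have hint : IntegrableOn (fun y => φ y ^ 2) K :=
    ContinuousOn.integrableOn_compact hK (by fun_prop)
  have hle := setIntegral_mono_set hint (.of_forall fun y => sq_nonneg (φ y))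
    (LE.le.eventuallyLE hsub)
  have hfun : ∀ y, φ (A y + (1 / 2 : ℝ) • x) ^ 2 = ((1 / 4 : ℝ)) * (φ y + φ x) ^ 2 := fun y => by
    simp [hA]; ring
  rw [setIntegral_image_affine hK.measurableSet A (injective_smul_id (by norm_num)),
    abs_det_smul_id (by norm_num)] at hle
  simp_rw [hfun] at hle
  rw [integral_const_mul, setIntegral_add_const_sq hK hV hc hb,
    setIntegral_sq_of_isBLUnitBall hV hb] at hle
  have h2 : (1 / 2 : ℝ) ^ n * 2 ^ n = 1 := by rw [← mul_pow]; norm_num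
  have hpow : (2 : ℝ) ^ (n + 2) = 4 * 2 ^ n := by ring
  have hn : (0 : ℝ) < n + 2 := by positivity
  have hR' : R ^ 2 = 4 * 2 ^ n / (n + 2) := by rw [← hpow, ← hR2]; field_simp
  have h3 : (1 / 2 : ℝ) ^ n * (1 / 4) * (‖φ‖ ^ 2 / (n + 2) + φ x ^ 2) ≤ ‖φ‖ ^ 2 / (n + 2) := by
    refine le_of_mul_le_mul_left ?_ hV
    rw [← mul_div_assoc (volume.real K)]
    refine le_of_eq_of_le ?_ hle
    ring
  have h4 := mul_le_mul_of_nonneg_left h3 (show (0 : ℝ) ≤ 4 * 2 ^ n by positivity)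
  have h5 : (4 : ℝ) * 2 ^ n * ((1 / 2 : ℝ) ^ n * (1 / 4) * (‖φ‖ ^ 2 / (n + 2) + φ x ^ 2))
      = ‖φ‖ ^ 2 / (n + 2) + φ x ^ 2 := by
    linear_combination (‖φ‖ ^ 2 / (n + 2) + φ x ^ 2) * h2
  have h6 : 0 ≤ ‖φ‖ ^ 2 / ((n : ℝ) + 2) := by positivity
  rw [h5] at h4
  calc φ x ^ 2 ≤ 4 * 2 ^ n * (‖φ‖ ^ 2 / (n + 2)) := by linarith
    _ = R ^ 2 * ‖φ‖ ^ 2 := by rw [hR']; ring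

lemma norm_le_of_forall_apply_le {x : EuclideanSpace ℝ (Fin n)} {c : ℝ} (hc : 0 ≤ c)
    (h : ∀ φ : EuclideanSpace ℝ (Fin n) →L[ℝ] ℝ, φ x ≤ c * ‖φ‖) : ‖x‖ ≤ c := by
  rcases eq_or_ne x 0 with rfl | hx
  · simpa
  · have := h (innerSL ℝ x)
    rw [innerSL_apply_norm, innerSL_apply_apply, real_inner_self_eq_norm_mul_norm] at this
    exact le_of_mul_le_mul_right this (norm_pos_iff.2 hx)

lemma norm_le_of_normalized (hK : IsCompact K) (hcv : Convex ℝ K) (hV : 0 < volume.real K)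
    (hc : centroid K = 0) (hb : isBLUnitBall K) {R : ℝ} (hR : 0 < R)
    (hR2 : (n + 2) * R ^ 2 = (2 : ℝ) ^ (n + 2)) {x : EuclideanSpace ℝ (Fin n)} (hx : x ∈ K) :
    ‖x‖ ≤ R := by
  refine norm_le_of_forall_apply_le hR.le fun φ => ?_
  refine le_of_abs_le (abs_le_of_sq_le_sq ?_ (by positivity))
  rw [mul_pow]
  exact sq_apply_le_of_normalized hK hcv hV hc hb hR2 hx φ

lemma norm_le_of_apply_le_of_normalized (hK : IsCompact K) (hV : 0 < volume.real K)
    (hc : centroid K = 0) (hb : isBLUnitBall K) {R : ℝ} (hR : ∀ x ∈ K, ‖x‖ ≤ R)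
    {φ : EuclideanSpace ℝ (Fin n) →L[ℝ] ℝ} (hφ : φ ≠ 0) {h : ℝ} (hh : ∀ x ∈ K, φ x ≤ h) :
    ‖φ‖ ≤ (n + 2) * R * h := by
  have h0 : 0 ≤ ∫ x in K, (h - φ x) * (φ x + R * ‖φ‖) := by
    refine setIntegral_nonneg hK.measurableSet fun x hx => mul_nonneg (by linarith [hh x hx]) ?_
    have h1 := (abs_le.1 (φ.le_opNorm x)).1
    have h2 := mul_le_mul_of_nonneg_left (hR x hx) (norm_nonneg φ)
    linarith
  have h1 : IntegrableOn (fun x => φ x ^ 2) K :=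
    ContinuousOn.integrableOn_compact hK (by fun_prop)
  have h2 : IntegrableOn (fun x => (h - R * ‖φ‖) * φ x) K :=
    ContinuousOn.integrableOn_compact hK (by fun_prop)
  have h3 : IntegrableOn (fun _ => h * (R * ‖φ‖)) K :=
    ContinuousOn.integrableOn_compact hK (by fun_prop)
  have hfun : ∀ x, (h - φ x) * (φ x + R * ‖φ‖)
      = h * (R * ‖φ‖) + (h - R * ‖φ‖) * φ x - φ x ^ 2 := fun x => by ring
  simp_rw [hfun] at h0
  have h32 : IntegrableOn (fun x => h * (R * ‖φ‖) + (h - R * ‖φ‖) * φ x) K := h3.add h2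
  rw [integral_sub h32 h1, integral_add h3 h2, integral_const_mul (h - R * ‖φ‖),
    setIntegral_eq_zero_of_centroid_eq_zero hK hV hc, setIntegral_sq_of_isBLUnitBall hV hb,
    setIntegral_const, smul_eq_mul] at h0
  have hp : 0 < ‖φ‖ := norm_pos_iff.2 hφ
  have hn : (0 : ℝ) < n + 2 := by positivity
  have h4 : volume.real K * (‖φ‖ * ‖φ‖) ≤ volume.real K * (‖φ‖ * ((n + 2) * R * h)) := by
    have : volume.real K * ‖φ‖ ^ 2 / (n + 2) ≤ volume.real K * (h * (R * ‖φ‖)) := by linarith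
    rw [div_le_iff₀ hn] at this
    linarith
  exact le_of_mul_le_mul_left (le_of_mul_le_mul_left h4 hV) hp

lemma mem_of_norm_le_of_normalized (hK : IsCompact K) (hcv : Convex ℝ K)
    (hV : 0 < volume.real K) (hc : centroid K = 0) (hb : isBLUnitBall K) {R : ℝ}
    (hR0 : 0 < R) (hR : ∀ x ∈ K, ‖x‖ ≤ R) {w : EuclideanSpace ℝ (Fin n)}
    (hw : (n + 2) * R * ‖w‖ ≤ 1) : w ∈ K := by
  by_contra hwK
  obtain ⟨f, u, hu, huw⟩ := geometric_hahn_banach_closed_point hcv hK.isClosed hwK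
  have hne : K.Nonempty := by
    by_contra h
    simp [not_nonempty_iff_eq_empty.1 h] at hV
  obtain ⟨k, hk⟩ := hne
  have hf : f ≠ 0 := by
    rintro rfl
    have := hu k hk
    simp only [zero_apply] at this huw
    linarith
  have h1 := norm_le_of_apply_le_of_normalized hK hV hc hb hR hf fun x hx => (hu x hx).le
  have h2 : (n + 2) * R * u < (n + 2) * R * f w := by gcongr
  have h3 : (n + 2) * R * f w ≤ (n + 2) * R * (‖f‖ * ‖w‖) := by
    gcongr
    exact le_of_abs_le (f.le_opNorm w)
  have h4 := mul_le_mul_of_nonneg_left hw (norm_nonneg f)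
  linarith

/-- A small perturbation of a dilated convex body is absorbed by a larger dilation. -/
lemma smul_add_mem_smul (hcv : Convex ℝ K) {c : ℝ} (hball : ∀ w, c * ‖w‖ ≤ 1 → w ∈ K)
    {a b : ℝ} (ha : 0 ≤ a) (hab : a < b) {k w : EuclideanSpace ℝ (Fin n)} (hk : k ∈ K)
    (hw : c * ‖w‖ ≤ b - a) : a • k + w ∈ b • K := by
  have hη : 0 < b - a := sub_pos.2 hab
  have : b • K = a • K + (b - a) • K := by
    rw [← hcv.add_smul ha hη.le, add_sub_cancel]
  rw [this]
  refine add_mem_add (smul_mem_smul_set hk) ((mem_smul_set_iff_inv_smul_mem₀ hη.ne' _ _).2 ?_)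
  apply hball
  rw [norm_smul, norm_inv, Real.norm_of_nonneg hη.le, mul_left_comm, inv_mul_le_iff₀ hη]
  linarith

lemma norm_translation_le (hK : IsCompact K) (hne : K.Nonempty) {R ε : ℝ} (hε : 0 ≤ ε)
    (hR0 : 0 ≤ R) (hR : ∀ x ∈ K, ‖x‖ ≤ R) {z : EuclideanSpace ℝ (Fin n)}
    (h : K ⊆ (1 + ε) • K + {z}) : ‖z‖ ≤ ε * R := by
  rw [← norm_neg]
  refine norm_le_of_forall_apply_le (by positivity) fun φ => ?_
  obtain ⟨k, hk, hmax⟩ := hK.exists_isMaxOn hne φ.continuous.continuousOn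
  obtain ⟨_, ⟨k', hk', rfl⟩, _, rfl, he⟩ := h hk
  have h1 : φ k' ≤ φ k := hmax hk'
  have h2 := congrArg φ he
  simp only [map_add, map_smul, smul_eq_mul] at h2
  have h3 : φ k ≤ ‖φ‖ * R :=
    (le_of_abs_le (φ.le_opNorm k)).trans (by gcongr; exact hR k hk)
  have h4 := mul_le_mul_of_nonneg_left h1 (show 0 ≤ 1 + ε by linarith)
  have h5 := mul_le_mul_of_nonneg_left h3 hε
  rw [map_neg]
  linarith

/-- A linear map whose adjoint nearly preserves norms is close to an isometry. -/
lemma exists_linearIsometryEquiv_near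
    (A : EuclideanSpace ℝ (Fin n) →L[ℝ] EuclideanSpace ℝ (Fin n)) (hA : Function.Surjective A)
    {δ : ℝ} (hδ : ∀ v, |‖A.adjoint v‖ ^ 2 - ‖v‖ ^ 2| ≤ δ * ‖v‖ ^ 2) :
    ∃ T : EuclideanSpace ℝ (Fin n) ≃ₗᵢ[ℝ] EuclideanSpace ℝ (Fin n),
      ∀ x, ‖A x - T x‖ ≤ |δ| * ‖x‖ := by
  set B := A ∘L A.adjoint with hB
  have hsym : (B : EuclideanSpace ℝ (Fin n) →ₗ[ℝ] EuclideanSpace ℝ (Fin n)).IsSymmetric := by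
    intro x y
    change inner ℝ (A (A.adjoint x)) y = inner ℝ x (A (A.adjoint y))
    rw [← ContinuousLinearMap.adjoint_inner_right, ContinuousLinearMap.adjoint_inner_left]
  have hrank : Module.finrank ℝ (EuclideanSpace ℝ (Fin n)) = n := finrank_euclideanSpace_fin
  set v := hsym.eigenvectorBasis hrank
  set l := hsym.eigenvalues hrank
  have hv : ∀ i, A (A.adjoint (v i)) = l i • v i := fun i => hsym.apply_eigenvectorBasis hrank i
  have hinner : ∀ i j, inner ℝ (A.adjoint (v i)) (A.adjoint (v j)) = if i = j then l j else 0 := by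
    intro i j
    rw [ContinuousLinearMap.adjoint_inner_left, hv, inner_smul_right,
      orthonormal_iff_ite.1 v.orthonormal]
    split_ifs <;> simp
  have hl : ∀ i, ‖A.adjoint (v i)‖ ^ 2 = l i := fun i => by
    rw [← real_inner_self_eq_norm_sq, hinner, if_pos rfl]
  have hlpos : ∀ i, 0 < l i := by
    intro i
    rw [← hl]
    refine pow_pos (norm_pos_iff.2 fun h0 => ?_) 2
    obtain ⟨x, hx⟩ := hA (v i)
    have : inner ℝ (v i) (v i) = (0 : ℝ) := by
      nth_rw 2 [← hx]
      rw [← ContinuousLinearMap.adjoint_inner_left, h0, inner_zero_left]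
    rw [real_inner_self_eq_norm_sq, v.norm_eq_one] at this
    norm_num at this
  have hlδ : ∀ i, |√(l i) - 1| ≤ |δ| := by
    intro i
    have h1 := hδ (v i)
    rw [hl, v.norm_eq_one, one_pow, mul_one] at h1
    have h2 : l i - 1 = (√(l i) - 1) * (√(l i) + 1) := by
      linear_combination -(Real.sq_sqrt (hlpos i).le)
    have h3 : 0 ≤ √(l i) := Real.sqrt_nonneg _
    rw [h2, abs_mul, abs_of_pos (by linarith : 0 < √(l i) + 1)] at h1
    nlinarith [abs_nonneg (√(l i) - 1), le_abs_self δ]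
  set w : Fin n → EuclideanSpace ℝ (Fin n) := fun i => (√(l i))⁻¹ • A.adjoint (v i) with hw
  have hwo : Orthonormal ℝ w := by
    rw [orthonormal_iff_ite]
    intro i j
    simp only [hw]
    rw [inner_smul_left, inner_smul_right, hinner]
    split_ifs with h
    · subst h
      have := Real.mul_self_sqrt (hlpos i).le
      have h0 := (Real.sqrt_pos.2 (hlpos i)).ne'
      simp only [conj_trivial]
      field_simp
      linarith
    · simp
  have hcard : Module.finrank ℝ (EuclideanSpace ℝ (Fin n)) = Fintype.card (Fin n) := by simp
  have hspan : ⊤ ≤ Submodule.span ℝ (range w) :=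
    (hwo.linearIndependent.span_eq_top_of_card_eq_finrank' hcard.symm).ge
  set W := OrthonormalBasis.mk hwo hspan
  have hW : ∀ i, W i = w i := fun i => by simp [W]
  have hAW : ∀ i, A (W i) = √(l i) • v i := by
    intro i
    have h0 := (Real.sqrt_pos.2 (hlpos i)).ne'
    rw [hW, hw]
    simp only [map_smul, hv, smul_smul]
    congr 1
    rw [inv_mul_eq_div, Real.div_sqrt]
  refine ⟨W.equiv v (Equiv.refl _), fun x => ?_⟩
  have hx : A x - W.equiv v (Equiv.refl _) x
      = ∑ i, (W.repr x i * (√(l i) - 1)) • v i := by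
    conv_lhs => rw [← W.sum_repr x]
    rw [map_sum, map_sum, ← Finset.sum_sub_distrib]
    refine Finset.sum_congr rfl fun i _ => ?_
    rw [map_smul, map_smul, hAW, OrthonormalBasis.equiv_apply_basis, Equiv.refl_apply, ← smul_sub,
      mul_smul, sub_smul, one_smul]
  refine le_of_sq_le_sq ?_ (by positivity)
  have hn1 : ‖A x - W.equiv v (Equiv.refl _) x‖ ^ 2 = ∑ i, (W.repr x i * (√(l i) - 1)) ^ 2 := by
    rw [hx, ← real_inner_self_eq_norm_sq, v.orthonormal.inner_sum]
    simp [sq]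
  have hn2 : ‖x‖ ^ 2 = ∑ i, (W.repr x i) ^ 2 := by
    rw [← W.repr.norm_map, EuclideanSpace.real_norm_sq_eq]
  rw [hn1, mul_pow, hn2, Finset.mul_sum]
  refine Finset.sum_le_sum fun i _ => ?_
  rw [mul_pow, mul_comm]
  gcongr ?_ * _
  exact sq_le_sq.2 (by simpa using hlδ i)

lemma volume_real_sub_le (hK : IsCompact K) {ε : ℝ} (hε : 0 < ε) (hε1 : ε ≤ 1)
    {z : EuclideanSpace ℝ (Fin n)} (h : L ⊆ (1 + ε) • K + {z}) :
    volume.real L - volume.real K ≤ n * ε * volume.real L := by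
  have hsub : L ⊆ (fun y => ((1 + ε) • ContinuousLinearMap.id ℝ (EuclideanSpace ℝ (Fin n))) y + z)
      '' K := by
    intro x hx
    obtain ⟨_, ⟨k, hk, rfl⟩, _, rfl, rfl⟩ := h hx
    exact ⟨k, hk, rfl⟩
  have himg := hK.image (f := fun y =>
    ((1 + ε) • ContinuousLinearMap.id ℝ (EuclideanSpace ℝ (Fin n))) y + z) (by fun_prop)
  have h1 := measureReal_mono (μ := volume) hsub himg.measure_lt_top.ne
  rw [volume_real_image_affine hK.measurableSet _ (injective_smul_id (by linarith)),
    abs_det_smul_id (by linarith)] at h1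
  have h2 : (1 : ℝ) + n * (-ε) ≤ (1 + -ε) ^ n := one_add_mul_le_pow (by linarith) n
  have h3 : (1 + -ε) ^ n * (1 + ε) ^ n ≤ 1 := by
    rw [← mul_pow]
    exact pow_le_one₀ (by nlinarith) (by nlinarith)
  have hL : 0 ≤ volume.real L := measureReal_nonneg
  have hK0 : 0 ≤ volume.real K := measureReal_nonneg
  have h4 : (1 + n * (-ε)) * volume.real L ≤ volume.real K :=
    calc (1 + n * (-ε)) * volume.real L ≤ (1 + -ε) ^ n * volume.real L := by gcongr
      _ ≤ (1 + -ε) ^ n * ((1 + ε) ^ n * volume.real K) := by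
        gcongr
        exact pow_nonneg (by linarith) n
      _ = ((1 + -ε) ^ n * (1 + ε) ^ n) * volume.real K := by ring
      _ ≤ volume.real K := mul_le_of_le_one_left hK0 h3
  linarith

lemma abs_setIntegral_sub_le (hK : IsCompact K) (hL : IsCompact L) (hKL : K ⊆ L)
    {f : EuclideanSpace ℝ (Fin n) → ℝ} (hf : Continuous f) {C : ℝ} (hC : ∀ x ∈ L, |f x| ≤ C) :
    |(∫ x in L, f x) - ∫ x in K, f x| ≤ C * (volume.real L - volume.real K) := by
  rw [← setIntegral_sdiff hK.measurableSet (hf.continuousOn.integrableOn_compact hL) hKL,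
    ← Real.norm_eq_abs, ← measureReal_sdiff hKL hK.measurableSet hL.measure_lt_top.ne]
  exact norm_setIntegral_le_of_norm_le_const
    ((measure_mono sdiff_subset).trans_lt hL.measure_lt_top) fun x hx => hC x hx.1

/-- If `K` is normalized and almost fills the affine image `A L + s` of a normalized body `L`,
then `s` is small and precomposition by `A` almost preserves norms of functionals. -/
lemma normalized_comparison (hK : IsCompact K) (hVK : 0 < volume.real K) (hcK : centroid K = 0)
    (hbK : isBLUnitBall K) (hL : IsCompact L) (hVL : 0 < volume.real L) (hcL : centroid L = 0)
    (hbL : isBLUnitBall L) (A : EuclideanSpace ℝ (Fin n) →L[ℝ] EuclideanSpace ℝ (Fin n))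
    (hA : Function.Injective A) (s : EuclideanSpace ℝ (Fin n))
    (hKM : K ⊆ (fun y => A y + s) '' L) {B η : ℝ} (hB : 0 ≤ B)
    (hM : ∀ x ∈ (fun y => A y + s) '' L, ‖x‖ ≤ B)
    (hη : volume.real ((fun y => A y + s) '' L) - volume.real K
      ≤ η * volume.real ((fun y => A y + s) '' L)) (φ : EuclideanSpace ℝ (Fin n) →L[ℝ] ℝ) :
    |φ s| ≤ η * (B * ‖φ‖) ∧
    ‖φ ∘L A‖ ^ 2 ≤ ‖φ‖ ^ 2 + (n + 2) * η * (B * ‖φ‖) ^ 2 ∧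
    (1 - η) * ‖φ‖ ^ 2 ≤ ‖φ ∘L A‖ ^ 2 + (n + 2) * φ s ^ 2 := by
  set M := (fun y => A y + s) '' L with hMdef
  have hMc : IsCompact M := hL.image (by fun_prop)
  have hVKM : volume.real K ≤ volume.real M := measureReal_mono hKM hMc.measure_lt_top.ne
  have hVM : volume.real M = |A.det| * volume.real L :=
    volume_real_image_affine hL.measurableSet A hA s
  have hVMpos : 0 < volume.real M := hVK.trans_le hVKM
  have hn : (0 : ℝ) < n + 2 := by positivity
  have hφM : ∀ x ∈ M, |φ x| ≤ B * ‖φ‖ := fun x hx =>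
    (φ.le_opNorm x).trans (by rw [mul_comm]; gcongr; exact hM x hx)
  have h1 : ∫ x in M, φ x = volume.real M * φ s := by
    rw [hMdef, setIntegral_image_affine hL.measurableSet A hA, ← hMdef, hVM]
    have hi : IntegrableOn (fun x => (φ ∘L A) x) L :=
      (φ ∘L A).continuous.continuousOn.integrableOn_compact hL
    have hi' : IntegrableOn (fun _ => φ s) L := continuousOn_const.integrableOn_compact hL
    have hadd := integral_add hi hi'
    rw [setIntegral_eq_zero_of_centroid_eq_zero hL hVL hcL, setIntegral_const] at hadd
    simp only [map_add]
    simp only [ContinuousLinearMap.comp_apply] at hadd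
    rw [hadd, smul_eq_mul]
    ring
  have h2 : ∫ x in M, φ x ^ 2 = volume.real M * (‖φ ∘L A‖ ^ 2 / (n + 2) + φ s ^ 2) := by
    rw [hMdef, setIntegral_image_affine hL.measurableSet A hA, ← hMdef, hVM, mul_assoc,
      ← setIntegral_add_const_sq hL hVL hcL hbL]
    simp
  have d1 := abs_setIntegral_sub_le hK hMc hKM φ.continuous hφM
  have d2 := abs_setIntegral_sub_le hK hMc hKM (f := fun x => φ x ^ 2) (φ.continuous.pow 2)
    (C := (B * ‖φ‖) ^ 2) fun x hx => by rw [abs_pow]; gcongr; exact hφM x hx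
  have d3 : ∫ x in K, φ x ^ 2 ≤ ∫ x in M, φ x ^ 2 :=
    setIntegral_mono_set ((φ.continuous.pow 2).continuousOn.integrableOn_compact hMc)
      (.of_forall fun y => sq_nonneg (φ y)) (LE.le.eventuallyLE hKM)
  rw [h1, setIntegral_eq_zero_of_centroid_eq_zero hK hVK hcK, sub_zero, abs_mul,
    abs_of_pos hVMpos] at d1
  have hBφ : 0 ≤ B * ‖φ‖ := by positivity
  have key := setIntegral_sq_of_isBLUnitBall hVK hbK φ
  rw [h2, key] at d2 d3
  refine ⟨le_of_mul_le_mul_left ?_ hVMpos, le_of_mul_le_mul_left ?_ hVMpos,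
    le_of_mul_le_mul_left ?_ hVMpos⟩
  · have := mul_le_mul_of_nonneg_left hη hBφ
    linarith
  · have e1 := (le_abs_self _).trans (d2.trans (mul_le_mul_of_nonneg_left hη (sq_nonneg _)))
    have e2 := mul_le_mul_of_nonneg_left e1 hn.le
    have e3 : (n + 2 : ℝ) * (volume.real M * (‖φ ∘L A‖ ^ 2 / (n + 2) + φ s ^ 2)
        - volume.real K * ‖φ‖ ^ 2 / (n + 2)) = volume.real M * ‖φ ∘L A‖ ^ 2
        + volume.real M * ((n + 2) * φ s ^ 2) - volume.real K * ‖φ‖ ^ 2 := by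
      field_simp
    rw [e3] at e2
    have e4 : 0 ≤ volume.real M * ((n + 2) * φ s ^ 2) := by positivity
    have e5 := mul_le_mul_of_nonneg_right hVKM (sq_nonneg ‖φ‖)
    linarith
  · have e2 := mul_le_mul_of_nonneg_left d3 hn.le
    have e3 : (n + 2 : ℝ) * (volume.real M * (‖φ ∘L A‖ ^ 2 / (n + 2) + φ s ^ 2))
        = volume.real M * (‖φ ∘L A‖ ^ 2 + (n + 2) * φ s ^ 2) := by
      field_simp
    have e4 : (n + 2 : ℝ) * (volume.real K * ‖φ‖ ^ 2 / (n + 2)) = volume.real K * ‖φ‖ ^ 2 := by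
      field_simp
    rw [e3, e4] at e2
    have e5 := mul_le_mul_of_nonneg_right hη (sq_nonneg ‖φ‖)
    linarith

lemma two_pow_le_bConst_div_aConst (hn : 1 ≤ n) : (2 : ℝ) ^ (n + 2) ≤ bConst n / aConst n := by
  have hn1 : (1 : ℝ) ≤ n := by exact_mod_cast hn
  have ha : aConst n = (bConst n)⁻¹ := by
    rw [aConst, bConst, mul_inv, ← Real.rpow_neg (by norm_num), ← Real.rpow_neg (by positivity)]
    congr 2 <;> ring
  have h1 : (2 : ℝ) ^ ((n : ℝ) / 2 + 1) ≤ bConst n :=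
    le_mul_of_one_le_right (by positivity) (Real.one_le_rpow hn1 (by positivity))
  have h2 : (2 : ℝ) ^ (n + 2) = (2 : ℝ) ^ ((n : ℝ) / 2 + 1) * (2 : ℝ) ^ ((n : ℝ) / 2 + 1) := by
    rw [← Real.rpow_add (by norm_num), ← Real.rpow_natCast]
    congr 1
    push_cast
    ring
  rw [ha, div_inv_eq_mul, h2]
  exact mul_self_le_mul_self (by positivity) h1

end NormalizedBodies

theorem stmt8 :
    ∀ n : ℕ, 1 ≤ n → ∃ εn : ℝ, 0 < εn ∧
      ∀ K L : Set (EuclideanSpace ℝ (Fin n)),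
        IsCompact K → Convex ℝ K → (interior K).Nonempty →
        IsCompact L → Convex ℝ L → (interior L).Nonempty →
        centroid K = 0 → isBLUnitBall K →
        centroid L = 0 → isBLUnitBall L →
        ∀ ε : ℝ, 0 < ε → ε ≤ εn →
          (∃ (S : EuclideanSpace ℝ (Fin n) ≃ᵃ[ℝ] EuclideanSpace ℝ (Fin n))
              (z : EuclideanSpace ℝ (Fin n)),
              K ⊆ S '' L ∧ S '' L ⊆ (1 + ε) • K + {z}) →
          ∃ T : EuclideanSpace ℝ (Fin n) ≃ₗᵢ[ℝ] EuclideanSpace ℝ (Fin n),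
            (1 + dConst n * ε)⁻¹ • K ⊆ T '' L ∧ T '' L ⊆ (1 + dConst n * ε) • K := by
  intro n hn
  have hn1 : (1 : ℝ) ≤ n := by exact_mod_cast hn
  refine ⟨1 / (2 * n), by positivity, ?_⟩
  rintro K L hK hcvK hiK hL hcvL hiL hcK hbK hcL hbL ε hε hεn ⟨S, z, hKS, hSK⟩
  have hnε : n * ε ≤ 1 / 2 := by
    rw [le_div_iff₀ (by positivity)] at hεn
    linarith
  have hε2 : ε ≤ 1 / 2 := (le_mul_of_one_le_left hε.le hn1).trans hnε
  set ρ : ℝ := 2 ^ (n + 2) with hρ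
  have hρ1 : 1 ≤ ρ := one_le_pow₀ (by norm_num)
  obtain ⟨R, hR, hR2⟩ : ∃ R : ℝ, 0 < R ∧ (n + 2) * R ^ 2 = ρ := by
    refine ⟨√(ρ / (n + 2)), by positivity, ?_⟩
    rw [Real.sq_sqrt (by positivity)]
    field_simp
  have hVK := volume_real_pos_of_isCompact hK hiK
  have hVL := volume_real_pos_of_isCompact hL hiL
  have hRK : ∀ x ∈ K, ‖x‖ ≤ R := fun x hx => norm_le_of_normalized hK hcvK hVK hcK hbK hR hR2 hx
  have hRL : ∀ x ∈ L, ‖x‖ ≤ R := fun x hx => norm_le_of_normalized hL hcvL hVL hcL hbL hR hR2 hx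
  set A : EuclideanSpace ℝ (Fin n) →L[ℝ] EuclideanSpace ℝ (Fin n) :=
    LinearMap.toContinuousLinearMap (S.linear : _ →ₗ[ℝ] _)
  set s := S 0
  have hS : ⇑S = fun y => A y + s := by
    funext y
    change S y = S.linear y + S 0
    simpa using S.map_vadd 0 y
  have hAi : Function.Injective A := S.linear.injective
  have hAs : Function.Surjective A := S.linear.surjective
  rw [hS] at hKS hSK
  have hz : ‖z‖ ≤ ε * R :=
    norm_translation_le hK (hiK.mono interior_subset) hε.le hR.le hRK (hKS.trans hSK)
  have hM : ∀ x ∈ (fun y => A y + s) '' L, ‖x‖ ≤ 2 * R := by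
    intro x hx
    obtain ⟨_, ⟨k, hk, rfl⟩, _, rfl, rfl⟩ := hSK hx
    refine (norm_add_le _ _).trans ?_
    simp only [norm_smul, Real.norm_of_nonneg (show 0 ≤ 1 + ε by linarith)]
    nlinarith [hRK k hk]
  have hcomp := normalized_comparison hK hVK hcK hbK hL hVL hcL hbL A hAi s hKS
    (by positivity : 0 ≤ 2 * R) hM (volume_real_sub_le hK hε (by linarith) hSK)
  have hs : ‖s‖ ≤ n * ε * (2 * R) := norm_le_of_forall_apply_le (by positivity) fun φ => by
    rw [mul_assoc]
    exact (le_abs_self _).trans (hcomp φ).1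
  obtain ⟨T, hT⟩ := exists_linearIsometryEquiv_near A hAs (δ := 5 * n * ρ * ε) fun v => by
    obtain ⟨h1, h2, h3⟩ := hcomp (innerSL ℝ v)
    have hadj : (innerSL ℝ v) ∘L A = innerSL ℝ (A.adjoint v) := by
      ext x
      simp [ContinuousLinearMap.adjoint_inner_left]
    rw [hadj, innerSL_apply_norm, innerSL_apply_norm] at h2 h3
    rw [innerSL_apply_norm] at h1
    have h4 : (n + 2) * (innerSL ℝ v s) ^ 2 ≤ 2 * n * ρ * ε * ‖v‖ ^ 2 :=
      calc (n + 2) * (innerSL ℝ v s) ^ 2 ≤ (n + 2) * (n * ε * (2 * R * ‖v‖)) ^ 2 := by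
            gcongr ?_ * ?_
            exact sq_le_sq.2 (h1.trans (le_abs_self _))
        _ = (n * ε) * (4 * n * ρ * ε * ‖v‖ ^ 2) := by rw [← hR2]; ring
        _ ≤ (1 / 2) * (4 * n * ρ * ε * ‖v‖ ^ 2) := by gcongr
        _ = 2 * n * ρ * ε * ‖v‖ ^ 2 := by ring
    have h5 : (n + 2) * (n * ε) * (2 * R * ‖v‖) ^ 2 = 4 * (n * ρ * ε * ‖v‖ ^ 2) := by
      rw [← hR2]; ring
    have h6 : n * ε * ‖v‖ ^ 2 ≤ n * ρ * ε * ‖v‖ ^ 2 := by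
      gcongr
      exact le_mul_of_one_le_right (by positivity) hρ1
    have h7 : 0 ≤ n * ε * ‖v‖ ^ 2 := by positivity
    rw [abs_le]
    constructor <;> linarith
  rw [abs_of_nonneg (by positivity)] at hT
  have hATL : ∀ x ∈ L, ‖A x - T x‖ ≤ 5 * n * ρ * ε * R := fun x hx =>
    (hT x).trans (by gcongr; exact hRL x hx)
  have hd : 1 + ρ * (1 + 2 * n + 5 * n * ρ) ≤ dConst n := by
    have h1 := two_pow_le_bConst_div_aConst hn
    rw [← hρ] at h1
    have h2 : 4 * n * ρ * (1 + 5 * n * ρ) ≤ dConst n := by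
      have h0 : 0 ≤ bConst n / aConst n := by linarith
      rw [dConst, mul_div_assoc]
      gcongr
    have h3 : ρ ≤ n * ρ := le_mul_of_one_le_left (by linarith) hn1
    have h4 : n * ρ ^ 2 ≤ n * (n * ρ ^ 2) := le_mul_of_one_le_left (by positivity) hn1
    have h5 : 0 ≤ n * ρ ^ 2 := by positivity
    linarith
  have hd1 : 0 < dConst n - 1 := by
    have : 0 < ρ * (1 + 2 * n + 5 * n * ρ) := by positivity
    linarith
  have hpert : ∀ w : EuclideanSpace ℝ (Fin n), ‖w‖ ≤ ε * R * (1 + 2 * n + 5 * n * ρ) →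
      (n + 2) * R * ‖w‖ ≤ (dConst n - 1) * ε := fun w hw =>
    calc (n + 2) * R * ‖w‖ ≤ (n + 2) * R * (ε * R * (1 + 2 * n + 5 * n * ρ)) := by gcongr
      _ = ρ * (1 + 2 * n + 5 * n * ρ) * ε := by
        linear_combination (1 + 2 * n + 5 * n * ρ) * ε * hR2
      _ ≤ (dConst n - 1) * ε := by gcongr; linarith
  have hb0 : 0 < 1 + dConst n * ε := by nlinarith
  refine ⟨T, ?_, ?_⟩
  · rintro _ ⟨k, hk, rfl⟩
    obtain ⟨x, hx, rfl⟩ := hKS hk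
    refine (mem_smul_set_iff_inv_smul_mem₀ hb0.ne' _ _).1 ?_
    have hcvT : Convex ℝ (T '' L) := hcvL.linear_image T.toLinearEquiv.toLinearMap
    have hballT : ∀ w, (n + 2) * R * ‖w‖ ≤ 1 → w ∈ T '' L := fun w hw =>
      ⟨T.symm w, mem_of_norm_le_of_normalized hL hcvL hVL hcL hbL hR hRL
        (by rwa [T.symm.norm_map]), T.apply_symm_apply w⟩
    have hw : ‖A x - T x + s‖ ≤ ε * R * (1 + 2 * n + 5 * n * ρ) := by
      have := norm_add_le (A x - T x) s
      have h0 : 0 ≤ ε * R := by positivity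
      linarith [hATL x hx]
    have := smul_add_mem_smul hcvT hballT zero_le_one (by nlinarith : 1 < 1 + dConst n * ε)
      (mem_image_of_mem T hx) (w := A x - T x + s) (by linarith [hpert _ hw])
    convert this using 1
    change A x + s = _
    rw [one_smul]
    abel
  · rintro _ ⟨x, hx, rfl⟩
    obtain ⟨_, ⟨k, hk, rfl⟩, z', hz', he⟩ := hSK (mem_image_of_mem _ hx)
    obtain rfl : z' = z := hz'
    have hw : ‖z' - s - (A x - T x)‖ ≤ ε * R * (1 + 2 * n + 5 * n * ρ) := by
      have h1 := norm_sub_le (z' - s) (A x - T x)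
      have h2 := norm_sub_le z' s
      linarith [hATL x hx]
    have := smul_add_mem_smul hcvK
      (fun w => mem_of_norm_le_of_normalized hK hcvK hVK hcK hbK hR hRK)
      (by linarith : 0 ≤ 1 + ε) (by nlinarith : 1 + ε < 1 + dConst n * ε) hk
      (w := z' - s - (A x - T x)) (by linarith [hpert _ hw])
    convert this using 1
    have he' : (1 + ε) • k = A x + s - z' := eq_sub_of_add_eq he
    rw [he']
    abel
end

section
/- For every n ≥ 1 there exists ε_n > 0, depending only on n, with the following property. Let K ⊆ ℝⁿ be a convex body with cent(K) = 0, let 0 < ε ≤ ε_n, and suppose there exist an invertible affine map T : ℝⁿ → ℝⁿ and z ∈ ℝⁿ with K ⊆ T(Bⁿ) ⊆ (1 + ε)·K + z, where Bⁿ is the closed Euclidean unit ball. Then (1 + d_n·ε)^{-1}·E(K) ⊆ K ⊆ (1 + d_n·ε)·E(K), where E(K) is the Binet–Legendre ellipsoid of K and d_n = 4n·(b_n/a_n)·(1 + 5n·b_n/a_n), with a_n = 2^{-n/2-1}·n^{-3n/4-3/2} and b_n = 2^{n/2+1}·n^{3n/4+3/2}. -/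
open Set Metric Pointwise MeasureTheory

/-- The Binet–Legendre ellipsoid of a centered convex body `K ⊆ ℝⁿ`. -/
def binetLegendre {n : ℕ} (K : Set (EuclideanSpace ℝ (Fin n))) :
    Set (EuclideanSpace ℝ (Fin n)) :=
  {x | ∀ φ : EuclideanSpace ℝ (Fin n) →ₗ[ℝ] ℝ,
    ((n : ℝ) + 2) / (volume K).toReal * ∫ y in K, (φ y) ^ 2 ≤ 1 → φ x ≤ 1}

theorem setIntegral_closedBall_norm_sq {n : ℕ} (hn : 1 ≤ n) {r : ℝ} (hr : 0 ≤ r) :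
    ∫ x in closedBall (0 : EuclideanSpace ℝ (Fin n)) r, ‖x‖ ^ 2 =
      n * (volume.real (ball (0 : EuclideanSpace ℝ (Fin n)) 1) * (r ^ (n + 2) / (n + 2))) := by
  have : Nonempty (Fin n) := ⟨⟨0, hn⟩⟩
  have h := integral_fun_norm_addHaar (volume : Measure (EuclideanSpace ℝ (Fin n)))
    ((Iic r).indicator fun y : ℝ => y ^ 2)
  have h_ball : ∫ x in closedBall (0 : EuclideanSpace ℝ (Fin n)) r, ‖x‖ ^ 2 =
      ∫ x : EuclideanSpace ℝ (Fin n), (Iic r).indicator (fun y : ℝ => y ^ 2) ‖x‖ := by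
    classical
    rw [← integral_indicator measurableSet_closedBall]
    refine integral_congr_ae (Filter.Eventually.of_forall fun x => ?_)
    simp only [indicator_apply, mem_closedBall_zero_iff, mem_Iic]
  have h_radial : ∫ y in Ioi (0 : ℝ), y ^ (n - 1) • (Iic r).indicator (fun y : ℝ => y ^ 2) y =
      r ^ (n + 2) / (n + 2) := by
    have : ∀ y : ℝ, y ^ (n - 1) • (Iic r).indicator (fun y : ℝ => y ^ 2) y =
        (Iic r).indicator (fun y : ℝ => y ^ (n + 1)) y := by
      intro y
      by_cases hy : y ∈ Iic r
      · simp only [indicator_of_mem hy, smul_eq_mul, ← pow_add]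
        congr 1
        omega
      · simp [indicator_of_notMem hy]
    simp only [this]
    rw [setIntegral_indicator measurableSet_Iic, Ioi_inter_Iic,
      ← intervalIntegral.integral_of_le hr, integral_pow]
    push_cast
    ring
  rw [h_ball, h, finrank_euclideanSpace_fin, h_radial]
  simp

theorem setIntegral_closedBall_inner_sq_eq_of_norm_eq {E : Type*} [NormedAddCommGroup E]
    [InnerProductSpace ℝ E] [FiniteDimensional ℝ E] [MeasurableSpace E] [BorelSpace E]
    (r : ℝ) {u v : E} (huv : ‖u‖ = ‖v‖) :
    ∫ x in closedBall (0 : E) r, inner ℝ u x ^ 2 = ∫ x in closedBall (0 : E) r, inner ℝ v x ^ 2 := by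
  let R := (ℝ ∙ (u - v))ᗮ.reflection
  have hR : R u = v := Submodule.reflection_sub huv
  have h := (R.measurePreserving).setIntegral_preimage_emb
    R.toHomeomorph.measurableEmbedding (fun x => inner ℝ v x ^ 2) (closedBall 0 r)
  rw [← h, R.preimage_closedBall, map_zero]
  refine integral_congr_ae (Filter.Eventually.of_forall fun x => ?_)
  simp only
  rw [← hR, R.inner_map_map]

theorem setIntegral_closedBall_inner_sq {n : ℕ} (hn : 1 ≤ n) {r : ℝ} (hr : 0 ≤ r)
    (u : EuclideanSpace ℝ (Fin n)) :
    ∫ x in closedBall (0 : EuclideanSpace ℝ (Fin n)) r, inner ℝ u x ^ 2 =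
      volume.real (ball (0 : EuclideanSpace ℝ (Fin n)) 1) * (r ^ (n + 2) / (n + 2)) *
        ‖u‖ ^ 2 := by
  have h_coord : ∀ i : Fin n,
      ∫ x in closedBall (0 : EuclideanSpace ℝ (Fin n)) r, inner ℝ u x ^ 2 =
      ‖u‖ ^ 2 * ∫ x in closedBall (0 : EuclideanSpace ℝ (Fin n)) r, x i ^ 2 := by
    intro i
    rw [setIntegral_closedBall_inner_sq_eq_of_norm_eq (v := EuclideanSpace.single i ‖u‖) r
      (by simp), ← integral_const_mul]
    refine integral_congr_ae (Filter.Eventually.of_forall fun x => ?_)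
    simp [EuclideanSpace.inner_single_left, mul_pow]
  have h_sum : ∫ x in closedBall (0 : EuclideanSpace ℝ (Fin n)) r, ‖x‖ ^ 2 =
      ∑ i : Fin n, ∫ x in closedBall (0 : EuclideanSpace ℝ (Fin n)) r, x i ^ 2 := by
    rw [← integral_finsetSum]
    · simp [EuclideanSpace.real_norm_sq_eq]
    · intro i _
      exact ContinuousOn.integrableOn_compact (isCompact_closedBall _ _) (by fun_prop)
  have h := Finset.sum_congr (s₁ := Finset.univ) rfl fun i _ => h_coord i
  rw [← Finset.mul_sum, ← h_sum, setIntegral_closedBall_norm_sq hn hr] at h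
  simp only [Finset.sum_const, Finset.card_univ, Fintype.card_fin, nsmul_eq_mul] at h
  have hn' : (n : ℝ) ≠ 0 := by positivity
  apply mul_left_cancel₀ hn'
  rw [h]
  ring

theorem volume_real_closedBall_eq {n : ℕ} (x : EuclideanSpace ℝ (Fin n)) {r : ℝ} (hr : 0 ≤ r) :
    volume.real (closedBall x r) = r ^ n * volume.real (ball (0 : EuclideanSpace ℝ (Fin n)) 1) := by
  rw [Measure.addHaar_real_closedBall volume x hr, finrank_euclideanSpace_fin]

theorem volume_real_unitBall_pos (n : ℕ) :
    0 < volume.real (ball (0 : EuclideanSpace ℝ (Fin n)) 1) :=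
  ENNReal.toReal_pos (measure_ball_pos _ _ one_pos).ne' measure_ball_lt_top.ne

/-- Comparison of the Binet–Legendre norm of a functional with its Euclidean norm, for a body
squeezed between two balls centred at the origin. -/
theorem binetLegendre_form_bounds {n : ℕ} (hn : 1 ≤ n) {K : Set (EuclideanSpace ℝ (Fin n))}
    (hK : IsCompact K) {s t : ℝ} (hs : 0 < s) (ht : 0 < t)
    (hsK : closedBall 0 s ⊆ K) (hKt : K ⊆ closedBall 0 t) (u : EuclideanSpace ℝ (Fin n)) :
    s ^ (n + 2) / t ^ n * ‖u‖ ^ 2 ≤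
      ((n : ℝ) + 2) / (volume K).toReal * ∫ y in K, inner ℝ u y ^ 2 ∧
    ((n : ℝ) + 2) / (volume K).toReal * ∫ y in K, inner ℝ u y ^ 2 ≤
      t ^ (n + 2) / s ^ n * ‖u‖ ^ 2 := by
  set ω := volume.real (ball (0 : EuclideanSpace ℝ (Fin n)) 1)
  have hω : 0 < ω := volume_real_unitBall_pos n
  have h_int : ∀ C : Set (EuclideanSpace ℝ (Fin n)), IsCompact C →
      IntegrableOn (fun y => inner ℝ u y ^ 2) C := fun C hC =>
    ContinuousOn.integrableOn_compact hC (by fun_prop)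
  have h_lower : ω * (s ^ (n + 2) / (n + 2)) * ‖u‖ ^ 2 ≤ ∫ y in K, inner ℝ u y ^ 2 := by
    rw [← setIntegral_closedBall_inner_sq hn hs.le]
    exact setIntegral_mono_set (h_int K hK)
      (Filter.Eventually.of_forall fun _ => sq_nonneg _) hsK.eventuallyLE
  have h_upper : ∫ y in K, inner ℝ u y ^ 2 ≤ ω * (t ^ (n + 2) / (n + 2)) * ‖u‖ ^ 2 := by
    rw [← setIntegral_closedBall_inner_sq hn ht.le]
    exact setIntegral_mono_set (h_int _ (isCompact_closedBall _ _))
      (Filter.Eventually.of_forall fun _ => sq_nonneg _) hKt.eventuallyLE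
  have hV_lower : s ^ n * ω ≤ (volume K).toReal := by
    rw [← volume_real_closedBall_eq 0 hs.le]
    exact measureReal_mono hsK hK.measure_ne_top
  have hV_upper : (volume K).toReal ≤ t ^ n * ω := by
    rw [← volume_real_closedBall_eq 0 ht.le]
    exact measureReal_mono hKt (isCompact_closedBall _ _).measure_ne_top
  have hV : 0 < (volume K).toReal := lt_of_lt_of_le (by positivity) hV_lower
  constructor
  · calc s ^ (n + 2) / t ^ n * ‖u‖ ^ 2
        = ((n : ℝ) + 2) / (t ^ n * ω) * (ω * (s ^ (n + 2) / (n + 2)) * ‖u‖ ^ 2) := by field_simp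
      _ ≤ _ := by gcongr
  · calc _ ≤ ((n : ℝ) + 2) / (s ^ n * ω) * (ω * (t ^ (n + 2) / (n + 2)) * ‖u‖ ^ 2) := by
          gcongr
      _ = _ := by field_simp

theorem binetLegendre_subset_and_subset {n : ℕ} (hn : 1 ≤ n)
    {K : Set (EuclideanSpace ℝ (Fin n))} (hK : IsCompact K) {s t c : ℝ} (hs : 0 < s) (ht : 0 < t)
    (hsK : closedBall 0 s ⊆ K) (hKt : K ⊆ closedBall 0 t) (hc : 0 < c)
    (hstc : t ^ (n + 2) ≤ c ^ 2 * s ^ (n + 2)) :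
    c⁻¹ • binetLegendre K ⊆ K ∧ K ⊆ c • binetLegendre K := by
  have hform := binetLegendre_form_bounds hn hK hs ht hsK hKt
  constructor
  · rintro _ ⟨x, hx, rfl⟩
    apply hsK
    simp only [mem_closedBall_zero_iff, norm_smul, norm_inv, Real.norm_of_nonneg hc.le]
    rw [inv_mul_le_iff₀ hc]
    rcases eq_or_ne x 0 with rfl | hx0
    · simp only [norm_zero]; positivity
    have hxn : 0 < ‖x‖ := norm_pos_iff.mpr hx0
    have h := hx (innerₗ _ ((‖x‖ * (c * s))⁻¹ • x)) (by
      refine (hform _).2.trans ?_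
      rw [norm_smul, norm_inv, Real.norm_of_nonneg (by positivity)]
      have : t ^ (n + 2) / s ^ n * ((‖x‖ * (c * s))⁻¹ * ‖x‖) ^ 2 =
          t ^ (n + 2) / (c ^ 2 * s ^ (n + 2)) := by
        field_simp
        ring
      rw [this]
      exact div_le_one_of_le₀ hstc (by positivity))
    rw [innerₗ_apply_apply, real_inner_smul_left, real_inner_self_eq_norm_sq,
      inv_mul_le_iff₀ (by positivity)] at h
    nlinarith
  · intro x hx
    rw [mem_smul_set_iff_inv_smul_mem₀ hc.ne']
    intro φ hφ
    obtain ⟨u, hu⟩ : ∃ u, φ = innerₗ (EuclideanSpace ℝ (Fin n)) u :=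
      ⟨(InnerProductSpace.toDual ℝ _).symm (LinearMap.toContinuousLinearMap φ), by
        ext; simp⟩
    subst hu
    have h1 := (hform u).1.trans hφ
    have hxt : ‖x‖ ≤ t := by simpa using hKt hx
    rw [map_smul, innerₗ_apply_apply, smul_eq_mul, inv_mul_le_iff₀ hc, mul_one]
    refine (real_inner_le_norm u x).trans ((mul_le_mul_of_nonneg_left hxt (norm_nonneg u)).trans ?_)
    refine (sq_le_sq₀ (by positivity) hc.le).mp ?_
    rw [div_mul_eq_mul_div, div_le_one (by positivity)] at h1
    have : s ^ (n + 2) * (‖u‖ * t) ^ 2 ≤ s ^ (n + 2) * c ^ 2 := by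
      calc s ^ (n + 2) * (‖u‖ * t) ^ 2 = (s ^ (n + 2) * ‖u‖ ^ 2) * t ^ 2 := by ring
        _ ≤ t ^ n * t ^ 2 := by gcongr
        _ = t ^ (n + 2) := by ring
        _ ≤ _ := by linarith
    exact le_of_mul_le_mul_left this (by positivity)

theorem setIntegral_image_continuousLinearEquiv {E F : Type*} [NormedAddCommGroup E]
    [NormedSpace ℝ E] [FiniteDimensional ℝ E] [MeasurableSpace E] [BorelSpace E]
    [NormedAddCommGroup F] [NormedSpace ℝ F] (μ : Measure E) [μ.IsAddHaarMeasure]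
    (A : E ≃L[ℝ] E) {K : Set E} (hK : MeasurableSet K) (g : E → F) :
    ∫ x in A '' K, g x ∂μ = |(A : E →L[ℝ] E).det| • ∫ x in K, g (A x) ∂μ := by
  rw [integral_image_eq_integral_abs_det_fderiv_smul μ hK
    (fun x _ => A.hasFDerivAt.hasFDerivWithinAt) A.injective.injOn, integral_smul]

theorem volume_image_continuousLinearEquiv_toReal {n : ℕ}
    (A : EuclideanSpace ℝ (Fin n) ≃L[ℝ] EuclideanSpace ℝ (Fin n))
    (K : Set (EuclideanSpace ℝ (Fin n))) :
    (volume (A '' K)).toReal =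
      |(A : EuclideanSpace ℝ (Fin n) →L[ℝ] EuclideanSpace ℝ (Fin n)).det| *
        (volume K).toReal := by
  rw [Measure.addHaar_image_continuousLinearEquiv, ENNReal.toReal_mul,
    ENNReal.toReal_ofReal (abs_nonneg _)]
  rfl

theorem abs_det_continuousLinearEquiv_ne_zero {n : ℕ}
    (A : EuclideanSpace ℝ (Fin n) ≃L[ℝ] EuclideanSpace ℝ (Fin n)) :
    |(A : EuclideanSpace ℝ (Fin n) →L[ℝ] EuclideanSpace ℝ (Fin n)).det| ≠ 0 :=
  abs_ne_zero.mpr (LinearEquiv.isUnit_det' A.toLinearEquiv).ne_zero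

theorem centroid_image_continuousLinearEquiv {n : ℕ}
    (A : EuclideanSpace ℝ (Fin n) ≃L[ℝ] EuclideanSpace ℝ (Fin n))
    {K : Set (EuclideanSpace ℝ (Fin n))} (hK : MeasurableSet K) :
    centroid (A '' K) = A (centroid K) := by
  unfold centroid
  have hA := abs_det_continuousLinearEquiv_ne_zero A
  rw [setIntegral_image_continuousLinearEquiv volume A hK, A.integral_comp_comm,
    volume_image_continuousLinearEquiv_toReal, smul_smul, map_smul]
  congr 1
  rw [mul_inv, mul_right_comm, inv_mul_cancel₀ hA, one_mul]

theorem binetLegendre_image_continuousLinearEquiv {n : ℕ}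
    (A : EuclideanSpace ℝ (Fin n) ≃L[ℝ] EuclideanSpace ℝ (Fin n))
    {K : Set (EuclideanSpace ℝ (Fin n))} (hK : MeasurableSet K) :
    binetLegendre (A '' K) = A '' binetLegendre K := by
  have hA := abs_det_continuousLinearEquiv_ne_zero A
  have h_form : ∀ φ : EuclideanSpace ℝ (Fin n) →ₗ[ℝ] ℝ,
      ((n : ℝ) + 2) / (volume (A '' K)).toReal * ∫ y in A '' K, (φ y) ^ 2 =
      ((n : ℝ) + 2) / (volume K).toReal * ∫ y in K, (φ (A y)) ^ 2 := by
    intro φ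
    rw [setIntegral_image_continuousLinearEquiv volume A hK,
      volume_image_continuousLinearEquiv_toReal, smul_eq_mul, ← mul_assoc, div_mul_eq_mul_div,
      mul_comm ((n : ℝ) + 2), mul_div_mul_left _ _ hA]
  ext x
  constructor
  · intro hx
    refine ⟨A.symm x, fun φ hφ => ?_, A.apply_symm_apply x⟩
    refine hx (φ ∘ₗ A.symm.toLinearEquiv.toLinearMap) ?_
    rw [h_form]
    simpa using hφ
  · rintro ⟨y, hy, rfl⟩ φ hφ
    rw [h_form] at hφ
    exact hy (φ ∘ₗ A.toLinearEquiv.toLinearMap) hφ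

theorem setIntegral_closedBall_sub_center {E : Type*} [NormedAddCommGroup E] [NormedSpace ℝ E]
    [FiniteDimensional ℝ E] [MeasurableSpace E] [BorelSpace E]
    (μ : Measure E) [μ.IsAddHaarMeasure] (q : E) (r : ℝ) :
    ∫ x in closedBall q r, (x - q) ∂μ = 0 := by
  have h := (Measure.measurePreserving_sub_left μ (q + q)).setIntegral_preimage_emb
    (Homeomorph.subLeft (q + q)).measurableEmbedding (fun x => x - q) (closedBall q r)
  have h_pre : (fun x => q + q - x) ⁻¹' closedBall q r = closedBall q r := by
    ext x
    simp only [mem_preimage, mem_closedBall, dist_eq_norm]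
    rw [show q + q - x - q = -(x - q) by abel, norm_neg]
  rw [h_pre] at h
  have h_neg : ∀ x : E, q + q - x - q = -(x - q) := fun x => by abel
  simp only [h_neg, integral_neg] at h
  have h_two : (2 : ℝ) • ∫ x in closedBall q r, (x - q) ∂μ = 0 := by
    rw [two_smul]
    nth_rewrite 1 [← h]
    exact neg_add_cancel _
  exact (smul_eq_zero.mp h_two).resolve_left two_ne_zero

theorem norm_center_le_of_centroid_eq_zero {n : ℕ} {K : Set (EuclideanSpace ℝ (Fin n))}
    (hK : IsCompact K) (hK0 : centroid K = 0) {p q : EuclideanSpace ℝ (Fin n)} {r : ℝ}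
    (hr : 0 < r) (hqK : closedBall q r ⊆ K) (hKp : K ⊆ closedBall p 1) :
    ‖q‖ ≤ 2 * (1 - r ^ n) := by
  set ω := volume.real (ball (0 : EuclideanSpace ℝ (Fin n)) 1)
  have hω : 0 < ω := volume_real_unitBall_pos n
  have hB : volume.real (closedBall q r) = r ^ n * ω := volume_real_closedBall_eq q hr.le
  have hV_lower : r ^ n * ω ≤ volume.real K := hB ▸ measureReal_mono hqK hK.measure_ne_top
  have hV_upper : volume.real K ≤ ω := by
    have := volume_real_closedBall_eq p zero_le_one
    rw [one_pow, one_mul] at this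
    exact (measureReal_mono hKp (isCompact_closedBall _ _).measure_ne_top).trans_eq this
  have hV : 0 < volume.real K := lt_of_lt_of_le (by positivity) hV_lower
  have h_dist : ∀ x ∈ K \ closedBall q r, ‖x - q‖ ≤ 2 := by
    intro x hx
    have hx' : dist x p ≤ 1 := hKp hx.1
    have hq' : dist q p ≤ 1 := hKp (hqK (mem_closedBall_self hr.le))
    rw [← dist_eq_norm]
    linarith [dist_triangle_right x q p]
  have h_int : IntegrableOn (fun x => x - q) K volume :=
    ContinuousOn.integrableOn_compact hK (by fun_prop)
  have h_first : ∫ x in K, x = 0 := by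
    have : (volume.real K)⁻¹ • ∫ x in K, x = 0 := hK0
    exact (smul_eq_zero.mp this).resolve_left (inv_ne_zero hV.ne')
  have h_moment : ∫ x in K, (x - q) = -(volume.real K • q) := by
    rw [integral_sub (ContinuousOn.integrableOn_compact hK (by fun_prop))
      (ContinuousOn.integrableOn_compact hK (by fun_prop)), h_first, setIntegral_const, zero_sub]
  have h_diff : ∫ x in K \ closedBall q r, (x - q) = -(volume.real K • q) := by
    rw [setIntegral_sdiff measurableSet_closedBall h_int hqK,
      setIntegral_closedBall_sub_center, sub_zero, h_moment]
  have h_norm : ‖∫ x in K \ closedBall q r, (x - q)‖ ≤ 2 * volume.real (K \ closedBall q r) :=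
    norm_setIntegral_le_of_norm_le_const
      ((measure_mono Set.sdiff_subset).trans_lt hK.measure_lt_top) h_dist
  rw [h_diff, norm_neg, norm_smul, Real.norm_of_nonneg hV.le,
    measureReal_sdiff hqK measurableSet_closedBall hK.measure_ne_top, hB] at h_norm
  refine le_of_mul_le_mul_left ?_ hV
  nlinarith [mul_le_mul_of_nonneg_left hV_upper (pow_pos hr n).le]

theorem dist_add_le_of_closedBall_subset {E : Type*} [NormedAddCommGroup E] [NormedSpace ℝ E]
    [Nontrivial E] {p q : E} {r R : ℝ} (hr : 0 ≤ r) (h : closedBall q r ⊆ closedBall p R) :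
    dist q p + r ≤ R := by
  rcases eq_or_ne q p with rfl | hqp
  · obtain ⟨v, hv⟩ := exists_norm_eq E hr
    have : q + v ∈ closedBall q R := h (by simp [hv])
    simpa [hv] using this
  · have hpos : 0 < ‖q - p‖ := norm_pos_iff.mpr (sub_ne_zero.mpr hqp)
    have hmem : q + (r / ‖q - p‖) • (q - p) ∈ closedBall p R := h (by
      rw [mem_closedBall, dist_eq_norm, add_sub_cancel_left, norm_smul,
        Real.norm_of_nonneg (by positivity), div_mul_cancel₀ _ hpos.ne'])
    rw [mem_closedBall, dist_eq_norm,
      show q + (r / ‖q - p‖) • (q - p) - p = (1 + r / ‖q - p‖) • (q - p) by module, norm_smul,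
      Real.norm_of_nonneg (by positivity), add_mul, one_mul, div_mul_cancel₀ _ hpos.ne'] at hmem
    rwa [dist_eq_norm]

theorem le_dConst {n : ℕ} (hn : 1 ≤ n) : 96 * (n : ℝ) ^ 2 ≤ dConst n := by
  have hn' : (1 : ℝ) ≤ n := by exact_mod_cast hn
  have ha : 0 < aConst n := by unfold aConst; positivity
  have h_two : (2 : ℝ) ≤ bConst n := by
    unfold bConst
    calc (2 : ℝ) = 2 ^ (1 : ℝ) * 1 := by simp
      _ ≤ _ := by
        gcongr
        · norm_num
        · linarith [show (0 : ℝ) ≤ n / 2 by positivity]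
        · exact Real.one_le_rpow hn' (by positivity)
  have h_inv : aConst n = (bConst n)⁻¹ := by
    unfold aConst bConst
    rw [mul_inv, ← Real.rpow_neg (by norm_num), ← Real.rpow_neg (by positivity)]
    congr 2 <;> ring
  have h_ratio : 4 ≤ bConst n / aConst n := by
    rw [h_inv, div_inv_eq_mul]
    nlinarith
  unfold dConst
  rw [mul_div_assoc]
  set R := bConst n / aConst n
  nlinarith [mul_nonneg (by positivity : (0 : ℝ) ≤ (n : ℝ) ^ 2) (by nlinarith : (0 : ℝ) ≤ R ^ 2 - 16),
    mul_nonneg (by positivity : (0 : ℝ) ≤ (n : ℝ)) (by linarith : (0 : ℝ) ≤ R)]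

theorem one_add_pow_le_one_add_two_mul {x : ℝ} (hx : 0 ≤ x) (m : ℕ) (hmx : m * x ≤ 1) :
    (1 + x) ^ m ≤ 1 + 2 * (m * x) := by
  have h1 : (1 + x) ^ m ≤ Real.exp (m * x) := by
    rw [Real.exp_nat_mul]
    gcongr
    linarith [Real.add_one_le_exp x]
  have hmx0 : 0 ≤ m * x := by positivity
  have h2 := Real.abs_exp_sub_one_sub_id_le (abs_le.mpr ⟨by linarith, hmx⟩)
  nlinarith [le_abs_self (Real.exp (m * x) - 1 - m * x)]

theorem one_add_pow_le_mul_one_sub_pow {n : ℕ} (hn : 1 ≤ n) {ε : ℝ} (hε : 0 < ε)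
    (hεn : ε ≤ 1 / (48 * n ^ 2)) :
    (1 + 3 * n * ε) ^ (n + 2) ≤ (1 + dConst n * ε) ^ 2 * (1 - 3 * n * ε) ^ (n + 2) := by
  have hn' : (1 : ℝ) ≤ n := by exact_mod_cast hn
  have hε48 : 48 * (n : ℝ) ^ 2 * ε ≤ 1 := by
    rw [le_div_iff₀ (by positivity)] at hεn
    linarith
  have hnε : 0 < n * ε := by positivity
  have hnε' : 48 * (n * ε) ≤ 1 := by nlinarith
  have h_ratio : 1 + 3 * n * ε ≤ (1 + 16 * (n * ε)) * (1 - 3 * n * ε) := by nlinarith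
  have h_pow : (1 + 16 * (n * ε)) ^ (n + 2) ≤ 1 + 2 * (((n + 2 : ℕ) : ℝ) * (16 * (n * ε))) :=
    one_add_pow_le_one_add_two_mul (by positivity) _ (by push_cast; nlinarith)
  have h_d : 96 * (n : ℝ) ^ 2 * ε ≤ dConst n * ε := by
    gcongr
    exact le_dConst hn
  have h_pow' : (1 + 16 * (n * ε)) ^ (n + 2) ≤ (1 + dConst n * ε) ^ 2 := by
    push_cast at h_pow
    have h_lin : ((n : ℝ) + 2) * (n * ε) ≤ 3 * n ^ 2 * ε := by nlinarith
    nlinarith [sq_nonneg (dConst n * ε)]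
  have hs : 0 < 1 - 3 * n * ε := by nlinarith
  calc (1 + 3 * n * ε) ^ (n + 2) ≤ ((1 + 16 * (n * ε)) * (1 - 3 * n * ε)) ^ (n + 2) := by gcongr
    _ = (1 + 16 * (n * ε)) ^ (n + 2) * (1 - 3 * n * ε) ^ (n + 2) := mul_pow _ _ _
    _ ≤ _ := by gcongr

/-- A centred body squeezed between two nearly equal balls is squeezed between two nearly equal
balls centred at the origin. -/
theorem closedBall_subset_and_subset_of_centroid_eq_zero {n : ℕ} (hn : 1 ≤ n)
    {K : Set (EuclideanSpace ℝ (Fin n))} (hK : IsCompact K) (hK0 : centroid K = 0)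
    {p q : EuclideanSpace ℝ (Fin n)} {ε : ℝ} (hε : 0 < ε)
    (hqK : closedBall q (1 + ε)⁻¹ ⊆ K) (hKp : K ⊆ closedBall p 1) :
    closedBall 0 (1 - 3 * n * ε) ⊆ K ∧ K ⊆ closedBall 0 (1 + 3 * n * ε) := by
  have : Nonempty (Fin n) := ⟨⟨0, hn⟩⟩
  have hn' : (1 : ℝ) ≤ n := by exact_mod_cast hn
  have hr : 0 < (1 + ε)⁻¹ := by positivity
  have hrε : 1 - ε ≤ (1 + ε)⁻¹ := by
    rw [← one_div, le_div_iff₀ (by positivity)]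
    nlinarith
  have hpow : 1 - n * ε ≤ ((1 + ε)⁻¹) ^ n := by
    have := one_add_mul_le_pow (a := (1 + ε)⁻¹ - 1) (by linarith) n
    rw [add_sub_cancel] at this
    nlinarith
  have hq := norm_center_le_of_centroid_eq_zero hK hK0 hr hqK hKp
  have hqp := dist_add_le_of_closedBall_subset hr.le (hqK.trans hKp)
  have hεn : ε ≤ n * ε := by nlinarith
  constructor
  · refine (closedBall_subset_closedBall' ?_).trans hqK
    rw [dist_zero_left]
    linarith
  · refine hKp.trans (closedBall_subset_closedBall' ?_)
    have := dist_triangle p q 0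
    rw [dist_comm p q, dist_zero_right q] at this
    linarith

theorem stmt9 :
    ∀ n : ℕ, 1 ≤ n → ∃ εn : ℝ, 0 < εn ∧
      ∀ K : Set (EuclideanSpace ℝ (Fin n)),
        IsCompact K → Convex ℝ K → (interior K).Nonempty → centroid K = 0 →
        ∀ ε : ℝ, 0 < ε → ε ≤ εn →
          (∃ (T : EuclideanSpace ℝ (Fin n) ≃ᵃ[ℝ] EuclideanSpace ℝ (Fin n))
              (z : EuclideanSpace ℝ (Fin n)),
              K ⊆ T '' closedBall (0 : EuclideanSpace ℝ (Fin n)) 1 ∧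
              T '' closedBall (0 : EuclideanSpace ℝ (Fin n)) 1 ⊆ (1 + ε) • K + {z}) →
          (1 + dConst n * ε)⁻¹ • binetLegendre K ⊆ K ∧
          K ⊆ (1 + dConst n * ε) • binetLegendre K := by
  intro n hn
  have hn' : (1 : ℝ) ≤ n := by exact_mod_cast hn
  refine ⟨1 / (48 * n ^ 2), by positivity, ?_⟩
  rintro K hK - - hK0 ε hε hεn ⟨T, z, hKT, hTK⟩
  let A : EuclideanSpace ℝ (Fin n) ≃L[ℝ] EuclideanSpace ℝ (Fin n) :=
    T.linear.toContinuousLinearEquiv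
  have hT : ∀ x, T x = A x + T 0 := fun x => by
    simpa [A] using T.map_vadd 0 x
  set K' := A.symm '' K
  have hAK : A '' K' = K := by simp [K', image_image]
  have hK' : IsCompact K' := hK.image A.symm.continuous
  have hK0' : centroid K' = 0 := by
    rw [centroid_image_continuousLinearEquiv A.symm hK.measurableSet, hK0, map_zero]
  have h_outer : K' ⊆ closedBall (A.symm (T 0)) 1 := by
    rintro _ ⟨y, hy, rfl⟩
    obtain ⟨b, hb, rfl⟩ := hKT hy
    rw [hT b, map_add, A.symm_apply_apply, mem_closedBall, dist_eq_norm, add_sub_cancel_right]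
    simpa using hb
  have h_inner : closedBall ((1 + ε)⁻¹ • (A.symm (T 0) - A.symm z)) (1 + ε)⁻¹ ⊆ K' := by
    intro y hy
    have h1ε : 0 < 1 + ε := by positivity
    refine ⟨A y, ?_, A.symm_apply_apply y⟩
    have hb : (1 + ε) • y - (A.symm (T 0) - A.symm z) ∈
        closedBall (0 : EuclideanSpace ℝ (Fin n)) 1 := by
      have h_eq : (1 + ε) • y - (A.symm (T 0) - A.symm z) =
          (1 + ε) • (y - (1 + ε)⁻¹ • (A.symm (T 0) - A.symm z)) := by
        rw [smul_sub, smul_inv_smul₀ h1ε.ne']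
      rw [mem_closedBall, dist_eq_norm] at hy
      rw [mem_closedBall_zero_iff, h_eq, norm_smul, Real.norm_of_nonneg h1ε.le]
      calc _ ≤ (1 + ε) * (1 + ε)⁻¹ := by gcongr
        _ = 1 := mul_inv_cancel₀ h1ε.ne'
    obtain ⟨_, ⟨k, hk, rfl⟩, z', hz', h⟩ := hTK (mem_image_of_mem T hb)
    obtain rfl : z' = z := hz'
    rw [hT, map_sub, map_smul, map_sub, A.apply_symm_apply, A.apply_symm_apply] at h
    have h' : (1 + ε) • k = (1 + ε) • A y := by
      apply add_right_cancel (b := z')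
      refine Eq.trans h ?_
      abel
    rwa [← smul_right_injective _ h1ε.ne' h']
  obtain ⟨hs, ht⟩ :=
    closedBall_subset_and_subset_of_centroid_eq_zero hn hK' hK0' hε h_inner h_outer
  have hnε : 48 * (n * ε) ≤ 1 := by
    rw [le_div_iff₀ (by positivity)] at hεn
    nlinarith [mul_pos (by linarith : (0 : ℝ) < n) hε]
  have hd : 0 ≤ dConst n := le_trans (by positivity) (le_dConst hn)
  have h := binetLegendre_subset_and_subset hn hK' (by linarith) (by positivity) hs ht
    (by positivity) (one_add_pow_le_mul_one_sub_pow hn hε hεn)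
  rw [← hAK, binetLegendre_image_continuousLinearEquiv A hK'.measurableSet, ← image_smul_set,
    ← image_smul_set]
  exact ⟨image_mono h.1, image_mono h.2⟩
end

section
/- Let K ⊆ ℝ² be a convex body with centroid at the origin whose Binet–Legendre ellipsoid is the closed Euclidean unit disc B², i.e. (4/vol(K))∫_K φ(y)² dy = ‖φ‖² for every linear functional φ. Let ε, α, β > 0 satisfy α/a₂ + (b₂/a₂)·β ≤ ε, where a₂ = 1/32 and b₂ = 32. Suppose that for every θ₀ ∈ ℝ there exists θ ∈ ℝ with |θ − θ₀| ≤ β/2 such that the rotation R_θ of ℝ² about the origin by angle θ satisfies R_θ(K) ⊆ K + α·B² and K ⊆ R_θ(K) + α·B² (i.e. the Hausdorff distance between R_θK and K is less than α). Then there exist an invertible affine map T : ℝ² → ℝ² and z ∈ ℝ² with K ⊆ T(B²) ⊆ (1 + ε)·K + z, i.e. d_BM(K, B²) < 1 + ε. -/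
open Set Metric Pointwise MeasureTheory

/-- Rotation of the Euclidean plane about the origin by angle `θ`. -/
noncomputable def rot (θ : ℝ) (x : EuclideanSpace ℝ (Fin 2)) : EuclideanSpace ℝ (Fin 2) :=
  (WithLp.equiv 2 (Fin 2 → ℝ)).symm
    ![Real.cos θ * x 0 - Real.sin θ * x 1, Real.sin θ * x 0 + Real.cos θ * x 1]

/-- In a convex body with vanishing first moment, the second moment in a direction dominates the
square of the value at any point of the body. -/
theorem volume_mul_sq_le_integral_sq {K : Set (EuclideanSpace ℝ (Fin 2))}
    (hKcomp : IsCompact K) (hKconv : Convex ℝ K) (φ : EuclideanSpace ℝ (Fin 2) →L[ℝ] ℝ)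
    (hφ : ∫ x in K, φ x = 0) {p : EuclideanSpace ℝ (Fin 2)} (hp : p ∈ K) :
    (volume K).toReal * φ p ^ 2 ≤ 15 * ∫ x in K, φ x ^ 2 := by
  have hKm : MeasurableSet K := hKcomp.measurableSet
  have hi : ∀ f : EuclideanSpace ℝ (Fin 2) → ℝ, Continuous f → IntegrableOn f K := fun f hf =>
    hf.continuousOn.integrableOn_compact hKcomp
  set F : EuclideanSpace ℝ (Fin 2) → ℝ := K.indicator (fun x => φ x ^ 2) with hF
  have hFint : Integrable F := (integrable_indicator_iff hKm).2 (hi _ (by fun_prop))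
  have hscale : ∫ x, F ((2 : ℝ)⁻¹ • (x + p)) = 4 * ∫ x in K, φ x ^ 2 := by
    rw [integral_add_right_eq_self (fun x => F ((2 : ℝ)⁻¹ • x)) p, Measure.integral_comp_smul,
      hF, integral_indicator hKm]
    norm_num
  have hmono : ∫ x in K, (2⁻¹ * (φ x + φ p)) ^ 2 ≤ ∫ x, F ((2 : ℝ)⁻¹ • (x + p)) := by
    rw [← integral_indicator hKm]
    refine integral_mono ((integrable_indicator_iff hKm).2 (hi _ (by fun_prop)))
      ((hFint.comp_smul (by norm_num : (2 : ℝ)⁻¹ ≠ 0)).comp_add_right p) fun x => ?_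
    by_cases hx : x ∈ K
    · have hmem : (2 : ℝ)⁻¹ • (x + p) ∈ K := by
        rw [smul_add]
        exact hKconv hx hp (by norm_num) (by norm_num) (by norm_num)
      rw [hF, indicator_of_mem hx, indicator_of_mem hmem]
      simp only [map_smul, map_add, smul_eq_mul, le_refl]
    · rw [indicator_of_notMem hx]
      exact indicator_nonneg (fun y _ => sq_nonneg (φ y)) _
  have hexp : ∫ x in K, (2⁻¹ * (φ x + φ p)) ^ 2 =
      4⁻¹ * (∫ x in K, φ x ^ 2) + 4⁻¹ * ((volume K).toReal * φ p ^ 2) := by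
    have : ∀ x, (2⁻¹ * (φ x + φ p)) ^ 2 =
        (4⁻¹ * φ x ^ 2 + (2⁻¹ * φ p) * φ x) + 4⁻¹ * φ p ^ 2 := fun x => by ring
    simp_rw [this]
    rw [integral_add (hi _ (by fun_prop)) (hi _ (by fun_prop)),
      integral_add (hi _ (by fun_prop)) (hi _ (by fun_prop)), integral_const_mul,
      integral_const_mul, hφ, setIntegral_const, Measure.real, smul_eq_mul]
    ring
  linarith

/-- If a functional with vanishing first moment on `K` takes values in `[-a, b]`, its second
moment is at most `a * b` times the volume. -/
theorem integral_sq_le_volume_mul {K : Set (EuclideanSpace ℝ (Fin 2))}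
    (hKcomp : IsCompact K) (φ : EuclideanSpace ℝ (Fin 2) →L[ℝ] ℝ)
    (hφ : ∫ x in K, φ x = 0) {a b : ℝ} (ha : ∀ x ∈ K, -a ≤ φ x) (hb : ∀ x ∈ K, φ x ≤ b) :
    ∫ x in K, φ x ^ 2 ≤ (volume K).toReal * (a * b) := by
  have hi : ∀ f : EuclideanSpace ℝ (Fin 2) → ℝ, Continuous f → IntegrableOn f K := fun f hf =>
    hf.continuousOn.integrableOn_compact hKcomp
  have hle : ∫ x in K, φ x ^ 2 ≤ ∫ x in K, (a * b + (b - a) * φ x) :=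
    setIntegral_mono_on (hi _ (by fun_prop)) (hi _ (by fun_prop)) hKcomp.measurableSet fun x hx => by
      nlinarith [mul_nonneg (sub_nonneg.2 (ha x hx)) (sub_nonneg.2 (hb x hx))]
  rwa [integral_add (hi _ (by fun_prop)) (hi _ (by fun_prop)), setIntegral_const,
    integral_const_mul, hφ, Measure.real, smul_eq_mul, mul_zero, add_zero] at hle

theorem exists_polar (x : EuclideanSpace ℝ (Fin 2)) :
    ∃ t : ℝ, x 0 = ‖x‖ * Real.cos t ∧ x 1 = ‖x‖ * Real.sin t := by
  have hn : ‖(⟨x 0, x 1⟩ : ℂ)‖ = ‖x‖ := by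
    rw [EuclideanSpace.norm_eq, Complex.norm_eq_sqrt_sq_add_sq]
    simp
  refine ⟨Complex.arg ⟨x 0, x 1⟩, ?_, ?_⟩
  · rw [← hn, Complex.norm_mul_cos_arg]
  · rw [← hn, Complex.norm_mul_sin_arg]

/-- Rotating `p` to within angle `δ` of the direction of a unit vector `u` makes its component along
`u` at least `‖p‖ * (1 - δ)`. -/
theorem exists_angle_le_inner_rot (p u : EuclideanSpace ℝ (Fin 2)) (hu : ‖u‖ = 1) :
    ∃ θ₀ : ℝ, ∀ θ : ℝ, ‖p‖ * (1 - |θ - θ₀|) ≤ inner ℝ u (rot θ p) := by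
  obtain ⟨a, ha0, ha1⟩ := exists_polar p
  obtain ⟨b, hb0, hb1⟩ := exists_polar u
  rw [hu, one_mul] at hb0 hb1
  refine ⟨b - a, fun θ => ?_⟩
  have hinner : inner ℝ u (rot θ p) = ‖p‖ * Real.cos (θ - (b - a)) := by
    rw [show θ - (b - a) = θ + a - b by ring, Real.cos_sub, Real.cos_add, Real.sin_add]
    simp only [rot, PiLp.inner_apply, Fin.sum_univ_two]
    simp [ha0, ha1, hb0, hb1]
    ring
  rw [hinner]
  refine mul_le_mul_of_nonneg_left ?_ (norm_nonneg p)
  rw [← Real.cos_abs]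
  have hsin := Real.sin_le (abs_nonneg (θ - (b - a)))
  have hcos := Real.one_sub_sq_div_two_le_cos (x := |θ - (b - a)|)
  rcases le_or_gt |θ - (b - a)| 2 with h | h
  · nlinarith [abs_nonneg (θ - (b - a))]
  · linarith [Real.neg_one_le_cos |θ - (b - a)|]

/-- A point outside a closed convex set is strictly separated from it by a unit vector. -/
theorem exists_unit_separating {K : Set (EuclideanSpace ℝ (Fin 2))} (hconv : Convex ℝ K)
    (hclosed : IsClosed K) (hne : K.Nonempty) {y : EuclideanSpace ℝ (Fin 2)} (hy : y ∉ K) :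
    ∃ u : EuclideanSpace ℝ (Fin 2), ‖u‖ = 1 ∧ ∀ x ∈ K, inner ℝ u x < inner ℝ u y := by
  obtain ⟨f, c, hfc, hcy⟩ := geometric_hahn_banach_closed_point hconv hclosed hy
  obtain ⟨v, rfl⟩ := (InnerProductSpace.toDual ℝ (EuclideanSpace ℝ (Fin 2))).surjective f
  simp only [InnerProductSpace.toDual_apply_apply] at hfc hcy
  have hv : v ≠ 0 := by
    rintro rfl
    obtain ⟨x, hx⟩ := hne
    have := hfc x hx
    simp only [inner_zero_left] at this hcy
    linarith
  refine ⟨‖v‖⁻¹ • v, by simp [norm_smul, hv], fun x hx => ?_⟩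
  rw [real_inner_smul_left, real_inner_smul_left]
  exact mul_lt_mul_of_pos_left ((hfc x hx).trans hcy) (by positivity)

theorem stmt10 (K : Set (EuclideanSpace ℝ (Fin 2)))
    (hKcomp : IsCompact K) (hKconv : Convex ℝ K) (hKint : (interior K).Nonempty)
    (hKcent : centroid K = 0) (hKBL : isBLUnitBall K)
    (ε α β : ℝ) (hε : 0 < ε) (hα : 0 < α) (hβ : 0 < β)
    (hαβ : α / (1 / 32 : ℝ) + ((32 : ℝ) / (1 / 32 : ℝ)) * β ≤ ε)
    (hnet : ∀ θ₀ : ℝ, ∃ θ : ℝ, |θ - θ₀| ≤ β / 2 ∧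
      rot θ '' K ⊆ K + α • closedBall (0 : EuclideanSpace ℝ (Fin 2)) 1 ∧
      K ⊆ rot θ '' K + α • closedBall (0 : EuclideanSpace ℝ (Fin 2)) 1) :
    ∃ (T : EuclideanSpace ℝ (Fin 2) ≃ᵃ[ℝ] EuclideanSpace ℝ (Fin 2))
      (z : EuclideanSpace ℝ (Fin 2)),
        K ⊆ T '' closedBall (0 : EuclideanSpace ℝ (Fin 2)) 1 ∧
        T '' closedBall (0 : EuclideanSpace ℝ (Fin 2)) 1 ⊆ (1 + ε) • K + {z} := by
  have hne : K.Nonempty := hKint.mono interior_subset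
  have hV : 0 < (volume K).toReal :=
    ENNReal.toReal_pos (Measure.measure_pos_of_nonempty_interior volume hKint).ne' hKcomp.measure_ne_top
  have hid : ∫ x in K, x = 0 :=
    (smul_eq_zero.1 hKcent).resolve_left (inv_ne_zero hV.ne')
  have hfirst : ∀ φ : EuclideanSpace ℝ (Fin 2) →L[ℝ] ℝ, ∫ x in K, φ x = 0 := fun φ => by
    rw [φ.integral_comp_comm (φ := fun x => x)
      (continuous_id.continuousOn.integrableOn_compact hKcomp), hid, map_zero]
  have hsecond : ∀ φ : EuclideanSpace ℝ (Fin 2) →L[ℝ] ℝ,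
      4 * ∫ x in K, φ x ^ 2 = (volume K).toReal * ‖φ‖ ^ 2 := fun φ => by
    have h := hKBL φ
    rw [← h]
    field_simp
    norm_num [mul_comm]
  obtain ⟨p, hpK, hpmax⟩ := hKcomp.exists_isMaxOn hne continuous_norm.continuousOn
  have hmax : ∀ x ∈ K, ‖x‖ ≤ ‖p‖ := fun x hx => hpmax hx
  have hp2 : ‖p‖ ≤ 2 := by
    by_contra! hlt
    have h1 := volume_mul_sq_le_integral_sq hKcomp hKconv (innerSL ℝ p) (hfirst _) hpK
    have h2 := hsecond (innerSL ℝ p)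
    rw [innerSL_apply_norm] at h2
    rw [innerSL_apply_apply, real_inner_self_eq_norm_sq] at h1
    have h3 : (volume K).toReal * (‖p‖ ^ 2 * (4 * ‖p‖ ^ 2 - 15)) ≤ 0 := by linarith
    have h4 : 0 < ‖p‖ ^ 2 * (4 * ‖p‖ ^ 2 - 15) := mul_pos (by positivity) (by nlinarith)
    exact absurd h3 (not_le.2 (mul_pos hV h4))
  have hlower : ∀ (u : EuclideanSpace ℝ (Fin 2)) (s : ℝ), ‖u‖ = 1 →
      (∀ x ∈ K, inner ℝ u x ≤ s) → 1 ≤ 4 * (‖p‖ * s) := fun u s hu hs => by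
    have h1 := integral_sq_le_volume_mul hKcomp (innerSL ℝ u) (hfirst _) (a := ‖p‖) (b := s)
      (fun x hx => by
        have := (abs_le.1 (abs_real_inner_le_norm u x)).1
        rw [hu, one_mul] at this
        rw [innerSL_apply_apply]
        linarith [hmax x hx]) hs
    have h2 := hsecond (innerSL ℝ u)
    rw [innerSL_apply_norm, hu] at h2
    refine le_of_mul_le_mul_left ?_ hV
    linarith
  have hnear : ∀ (u : EuclideanSpace ℝ (Fin 2)) (s : ℝ), ‖u‖ = 1 →
      (∀ x ∈ K, inner ℝ u x ≤ s) → ‖p‖ * (1 - β / 2) - α ≤ s := fun u s hu hs => by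
    obtain ⟨θ₀, hθ₀⟩ := exists_angle_le_inner_rot p u hu
    obtain ⟨θ, hθ, hsub, -⟩ := hnet θ₀
    obtain ⟨x, hx, w, hw, hxw⟩ := hsub (mem_image_of_mem _ hpK)
    obtain ⟨b, hb, rfl⟩ := hw
    have h1 := hθ₀ θ
    have h2 := real_inner_le_norm u b
    rw [mem_closedBall_zero_iff] at hb
    rw [hu, one_mul] at h2
    simp only [] at hxw
    rw [← hxw, inner_add_right, real_inner_smul_right] at h1
    have h3 : ‖p‖ * (1 - β / 2) ≤ ‖p‖ * (1 - |θ - θ₀|) :=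
      mul_le_mul_of_nonneg_left (by linarith) (norm_nonneg p)
    have h4 : α * inner ℝ u b ≤ α * 1 := mul_le_mul_of_nonneg_left (h2.trans hb) hα.le
    linarith [hs x hx]
  have hp0 : 0 < ‖p‖ := by
    rw [norm_pos_iff]
    rintro rfl
    have h := hlower (EuclideanSpace.single 0 1) 0 (by simp) fun x hx => by
      have := hmax x hx
      rw [norm_zero, norm_le_zero_iff] at this
      simp [this]
    norm_num at h
  have hε1 : 0 < 1 + ε := by linarith
  refine ⟨(LinearEquiv.smulOfNeZero ℝ (EuclideanSpace ℝ (Fin 2)) ‖p‖ hp0.ne').toAffineEquiv, 0,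
    fun x hx => ⟨‖p‖⁻¹ • x, ?_, ?_⟩, ?_⟩
  · rw [mem_closedBall_zero_iff, norm_smul, norm_inv, norm_norm]
    exact inv_mul_le_one_of_le₀ (hmax x hx) hp0.le
  · simp [smul_smul, hp0.ne']
  · rintro _ ⟨b, hb, rfl⟩
    rw [mem_closedBall_zero_iff] at hb
    simp only [LinearEquiv.coe_toAffineEquiv, LinearEquiv.smulOfNeZero_apply, singleton_zero,
      add_zero]
    rw [mem_smul_set_iff_inv_smul_mem₀ hε1.ne']
    by_contra hy
    obtain ⟨u, hu, hsep⟩ := exists_unit_separating hKconv hKcomp.isClosed hne hy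
    have hs : ∀ x ∈ K, inner ℝ u x ≤ ‖p‖ / (1 + ε) := fun x hx => by
      refine (hsep x hx).le.trans ((real_inner_le_norm _ _).trans ?_)
      rw [hu, one_mul, norm_smul, norm_smul, norm_inv, norm_norm, Real.norm_of_nonneg hε1.le,
        div_eq_inv_mul]
      exact mul_le_mul_of_nonneg_left (mul_le_of_le_one_right hp0.le hb) (by positivity)
    have h1 := hlower u _ hu hs
    have h2 := hnear u _ hu hs
    have h3 : ‖p‖ = ‖p‖ / (1 + ε) + ε * (‖p‖ / (1 + ε)) := by field_simp
    have hs0 : 0 < ‖p‖ / (1 + ε) := by positivity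
    generalize ‖p‖ / (1 + ε) = s at h1 h2 h3 hs0
    have h4 : 1 / 8 ≤ s := by nlinarith
    have h5 : ε * (1 / 8) ≤ ε * s := mul_le_mul_of_nonneg_left h4 hε.le
    have h6 : ‖p‖ * β ≤ 2 * β := mul_le_mul_of_nonneg_right hp2 hβ.le
    norm_num at hαβ
    linarith
end

section
/- There is a universal constant c > 0 with the following property. Let S² = {x ∈ ℝ³ : |x| = 1}, and for each x ∈ S² let K_x ⊆ x^⊥ be a convex body in the plane x^⊥ (compact, convex, with nonempty interior relative to x^⊥), such that the map x ↦ K_x is continuous from S² to the space of nonempty compact subsets of ℝ³ equipped with the Hausdorff distance. Let δ > 0 and suppose that for all x, y ∈ S² one has d_BM(K_x, K_y) < 1 + δ. Then for every x ∈ S² one has d_BM(K_x, B²) < 1 + c·δ^{1/3}, where B² is the closed Euclidean unit disc. -/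
open Set Metric Pointwise

/-- `dBMlt K L lam` expresses that the (affine) Banach–Mazur distance between the
convex bodies `K ⊆ V` and `L ⊆ W` is `< lam`: there exist an invertible affine map
`T : W → V` and a vector `z ∈ V` with `K ⊆ T(L) ⊆ lam • K + z`. -/
def dBMlt {V W : Type*} [AddCommGroup V] [Module ℝ V] [AddCommGroup W] [Module ℝ W]
    (K : Set V) (L : Set W) (lam : ℝ) : Prop :=
  ∃ (T : W ≃ᵃ[ℝ] V) (z : V), K ⊆ T '' L ∧ T '' L ⊆ lam • K + {z}

/-- The tangent plane `x^⊥ ⊆ ℝ³` at a point `x` of the unit sphere `S²`. -/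
noncomputable def tangentPlane (x : Metric.sphere (0 : EuclideanSpace ℝ (Fin 3)) 1) :
    Submodule ℝ (EuclideanSpace ℝ (Fin 3)) :=
  (Submodule.span ℝ {(x : EuclideanSpace ℝ (Fin 3))})ᗮ

section

open scoped ComplexConjugate

lemma eq_of_exp_eq_const {g : ℝ → ℂ} (hg : Continuous g) {c : ℂ}
    (h : ∀ t, Complex.exp (g t) = c) (t s : ℝ) : g t = g s := by
  have := Complex.isCoveringMap_exp.eq_of_comp_eq hg (continuous_const (y := g s))
    (by ext x; simp [h]) s rfl
  exact congrFun this t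

theorem exists_zero_of_twisted {n : ℤ} (hn : n ≠ 0) {H : ℝ × ℝ → ℂ} (hH : Continuous H)
    (hper : ∀ s, H (s, 2 * Real.pi) = H (s, 0))
    (h0 : ∀ t : ℝ, H (0, t) = Complex.exp (n * t * Complex.I) * H (0, 0))
    (h1 : ∀ t : ℝ, H (Real.pi, t) = Complex.exp (-(n * t * Complex.I)) * H (Real.pi, 0)) :
    ∃ p, H p = 0 := by
  by_contra! hne
  obtain ⟨Ψ, ⟨-, hΨ⟩, -⟩ := Complex.isCoveringMapOn_exp.existsUnique_continuousMap_lifts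
    (⟨H, hH⟩ : C(ℝ × ℝ, ℂ)) (a₀ := (0, 0)) (Complex.exp_log (hne (0, 0))) (fun p => hne p)
  have hΨ' : ∀ p, Complex.exp (Ψ p) = H p := fun p => congrFun hΨ p
  have hc : Continuous Ψ := Ψ.continuous
  have e1 := eq_of_exp_eq_const (g := fun s => Ψ (s, 2 * Real.pi) - Ψ (s, 0)) (by fun_prop) (c := 1)
    (fun s => by simp [Complex.exp_sub, hΨ', hper, hne]) 0 Real.pi
  have e2 := eq_of_exp_eq_const (g := fun t => Ψ (0, t) - n * t * Complex.I) (by fun_prop)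
    (c := H (0, 0)) (fun s => by
      rw [Complex.exp_sub, hΨ', h0, mul_div_cancel_left₀ _ (Complex.exp_ne_zero _)])
    (2 * Real.pi) 0
  have e3 := eq_of_exp_eq_const (g := fun t => Ψ (Real.pi, t) + n * t * Complex.I) (by fun_prop)
    (c := H (Real.pi, 0)) (fun s => by
      rw [Complex.exp_add, hΨ', h1, mul_right_comm, ← Complex.exp_add]; simp)
    (2 * Real.pi) 0
  simp only [Complex.ofReal_zero, mul_zero, zero_mul, sub_zero, add_zero] at e1 e2 e3
  have : (n : ℂ) * (2 * Real.pi : ℝ) * Complex.I = 0 := by linear_combination (e1 - e2 + e3) / 2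
  simp [hn, Real.pi_ne_zero] at this

/-- The (unnormalised) `n`-th Fourier coefficient of `f` along the unit circle. -/
noncomputable def circleCoef (n : ℤ) (f : ℂ → ℝ) : ℂ :=
  ∫ t in (0 : ℝ)..2 * Real.pi, (f (Complex.exp (t * Complex.I)) : ℂ) *
    Complex.exp (-(n * t * Complex.I))

lemma integral_exp_int_mul_I {n : ℤ} (hn : n ≠ 0) :
    ∫ t in (0 : ℝ)..2 * Real.pi, Complex.exp (-(n * t * Complex.I)) = 0 := by
  have h := integral_exp_mul_complex (a := 0) (b := 2 * Real.pi) (c := -(n * Complex.I))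
    (by simp [hn])
  have e : ∀ t : ℝ, -(n * t * Complex.I) = -(n * Complex.I) * t := fun t => by ring
  simp only [e, h]
  have : Complex.exp (-(n * Complex.I) * (2 * Real.pi : ℝ)) = 1 :=
    Complex.exp_eq_one_iff.2 ⟨-n, by push_cast; ring⟩
  rw [this]
  simp

lemma circleCoef_zero (f : ℂ → ℝ) :
    circleCoef 0 f = (∫ t in (0 : ℝ)..2 * Real.pi, f (Complex.exp (t * Complex.I)) : ℝ) := by
  simp [circleCoef, intervalIntegral.integral_ofReal]

lemma norm_geom_sum_sq (N : ℕ) (t : ℝ) :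
    ((‖∑ k ∈ Finset.range N, Complex.exp (t * Complex.I) ^ k‖ ^ 2 : ℝ) : ℂ) =
      ∑ j ∈ Finset.range N, ∑ k ∈ Finset.range N,
        Complex.exp (-(((k : ℤ) - (j : ℤ) : ℤ) * t * Complex.I)) := by
  rw [Complex.ofReal_pow, ← Complex.mul_conj', map_sum, Finset.sum_mul_sum]
  refine Finset.sum_congr rfl fun j _ => Finset.sum_congr rfl fun k _ => ?_
  rw [map_pow, ← Complex.exp_conj, ← Complex.exp_nat_mul, ← Complex.exp_nat_mul, ← Complex.exp_add]
  congr 1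
  simp only [map_mul, Complex.conj_I, Complex.conj_ofReal]
  push_cast
  ring

lemma integral_mul_geom_sum_sq {F : ℂ → ℝ} (hF : Continuous F) (N : ℕ) :
    ((∫ t in (0 : ℝ)..2 * Real.pi, F (Complex.exp (t * Complex.I)) *
      ‖∑ k ∈ Finset.range N, Complex.exp (t * Complex.I) ^ k‖ ^ 2 : ℝ) : ℂ) =
      ∑ j ∈ Finset.range N, ∑ k ∈ Finset.range N, circleCoef ((k : ℤ) - (j : ℤ)) F := by
  rw [← intervalIntegral.integral_ofReal]
  simp_rw [Complex.ofReal_mul, norm_geom_sum_sq, Finset.mul_sum]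
  rw [intervalIntegral.integral_finsetSum]
  · refine Finset.sum_congr rfl fun j _ => ?_
    rw [intervalIntegral.integral_finsetSum]
    · rfl
    · intro k _
      exact Continuous.intervalIntegrable (by fun_prop) _ _
  · intro k _
    exact Continuous.intervalIntegrable (by fun_prop) _ _

lemma norm_sum_sub_diag_le {a : ℤ → ℂ} {ε : ℝ} (h : ∀ n, n ≠ 0 → ‖a n‖ ≤ ε) (hε : 0 ≤ ε) (N : ℕ) :
    ‖∑ j ∈ Finset.range N, ∑ k ∈ Finset.range N, a ((k : ℤ) - (j : ℤ)) - N * a 0‖ ≤ N ^ 2 * ε := by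
  have e : (N : ℂ) * a 0 = ∑ j ∈ Finset.range N, ∑ k ∈ Finset.range N,
      if k = j then a 0 else 0 := by
    rw [Finset.sum_congr rfl (g := fun _ => a 0)]
    · simp
    · intro j hj
      rw [Finset.sum_ite_eq' _ j, if_pos hj]
  rw [e, ← Finset.sum_sub_distrib]
  simp_rw [← Finset.sum_sub_distrib]
  calc _ ≤ ∑ j ∈ Finset.range N, ∑ k ∈ Finset.range N, ε := by
        refine norm_sum_le_of_le _ fun j _ => norm_sum_le_of_le _ fun k _ => ?_
        split_ifs with hkj
        · simp [hkj, hε]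
        · rw [sub_zero]; exact h _ (by omega)
    _ = N ^ 2 * ε := by simp; ring

theorem fejer_bound {F : ℂ → ℝ} (hF : Continuous F) {L ε : ℝ} (hL : 0 ≤ L) (hε : 0 ≤ ε)
    (hLip : ∀ u : ℂ, ‖u‖ = 1 → |F 1 - F u| ≤ L * ‖u - 1‖)
    (hcoef : ∀ n, n ≠ 0 → ‖circleCoef n F‖ ≤ ε) {N : ℕ} (hN : 0 < N) :
    |2 * Real.pi * F 1 - ∫ t in (0 : ℝ)..2 * Real.pi, F (Complex.exp (t * Complex.I))| ≤
      N * ε + 4 * Real.pi * L / √N := by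
  set c := ∫ t in (0 : ℝ)..2 * Real.pi, F (Complex.exp (t * Complex.I)) with hc
  set κ : ℝ → ℝ := fun t => ‖∑ k ∈ Finset.range N, Complex.exp (t * Complex.I) ^ k‖ ^ 2 with hκ
  have hκc : Continuous κ := by fun_prop
  have hN' : (0 : ℝ) < N := by exact_mod_cast hN
  have hsq : 0 < √(N : ℝ) := Real.sqrt_pos.2 hN'
  have hsq2 : √(N : ℝ) * √(N : ℝ) = N := Real.mul_self_sqrt hN'.le
  have hpi := Real.pi_pos
  have hint1 : ∫ t in (0 : ℝ)..2 * Real.pi, κ t = 2 * Real.pi * N := by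
    have h := integral_mul_geom_sum_sq (F := fun _ => (1 : ℝ)) continuous_const N
    have h2 := norm_sum_sub_diag_le (a := fun n => circleCoef n fun _ => (1 : ℝ)) (ε := 0)
      (fun n hn => by
        simp only [circleCoef, Complex.ofReal_one, one_mul, integral_exp_int_mul_I hn, norm_zero,
          le_refl]) le_rfl N
    rw [← h, circleCoef_zero, mul_zero, norm_le_zero_iff, sub_eq_zero] at h2
    simp only [one_mul, intervalIntegral.integral_const, sub_zero, smul_eq_mul, mul_one] at h2
    have h3 : (∫ t in (0 : ℝ)..2 * Real.pi, κ t) = N * (2 * Real.pi) := by exact_mod_cast h2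
    rw [h3]; ring
  have hint2 : |(∫ t in (0 : ℝ)..2 * Real.pi, F (Complex.exp (t * Complex.I)) * κ t) - N * c| ≤
      N ^ 2 * ε := by
    have h2 := norm_sum_sub_diag_le hcoef hε N
    rw [← integral_mul_geom_sum_sq hF, circleCoef_zero] at h2
    rw [← Real.norm_eq_abs, ← Complex.norm_real]
    convert h2 using 2
    push_cast
    rfl
  have hint3 : |2 * Real.pi * N * F 1 -
      ∫ t in (0 : ℝ)..2 * Real.pi, F (Complex.exp (t * Complex.I)) * κ t| ≤
      4 * Real.pi * L * √N := by
    have e : 2 * Real.pi * N * F 1 -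
        ∫ t in (0 : ℝ)..2 * Real.pi, F (Complex.exp (t * Complex.I)) * κ t =
        ∫ t in (0 : ℝ)..2 * Real.pi, (F 1 - F (Complex.exp (t * Complex.I))) * κ t := by
      simp_rw [sub_mul]
      rw [intervalIntegral.integral_sub (Continuous.intervalIntegrable (by fun_prop) _ _)
        (Continuous.intervalIntegrable (by fun_prop) _ _), intervalIntegral.integral_const_mul,
        hint1]
      ring
    rw [e, ← Real.norm_eq_abs]
    have hb : ∀ t : ℝ, ‖(F 1 - F (Complex.exp (t * Complex.I))) * κ t‖ ≤
        L * ((√N)⁻¹ * κ t + √N) := by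
      intro t
      have hu : ‖Complex.exp (t * Complex.I)‖ = 1 := Complex.norm_exp_ofReal_mul_I t
      have hκ0 : 0 ≤ κ t := by positivity
      have hg : ‖Complex.exp (t * Complex.I) - 1‖ ^ 2 * κ t ≤ 4 := by
        rw [hκ]
        simp only
        rw [← mul_pow, ← norm_mul, mul_geom_sum]
        have : ‖Complex.exp (t * Complex.I) ^ N - 1‖ ≤ 2 := by
          refine (norm_sub_le _ _).trans ?_
          rw [norm_pow, hu]; norm_num
        nlinarith [norm_nonneg (Complex.exp (t * Complex.I) ^ N - 1)]
      rw [norm_mul, Real.norm_eq_abs, Real.norm_eq_abs, abs_of_nonneg hκ0]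
      have h1 := hLip _ hu
      set d := ‖Complex.exp (t * Complex.I) - 1‖
      have hd : d ≤ (√N)⁻¹ + √N * d ^ 2 / 4 := by
        have h := sq_nonneg (√N * d / 2 - 1)
        have : (√N)⁻¹ + √N * d ^ 2 / 4 - d = (√N)⁻¹ * (√N * d / 2 - 1) ^ 2 := by
          field_simp; ring
        have h' : 0 ≤ (√N)⁻¹ * (√N * d / 2 - 1) ^ 2 := by positivity
        linarith
      calc _ ≤ L * d * κ t := by gcongr
        _ ≤ L * ((√N)⁻¹ + √N * d ^ 2 / 4) * κ t := by gcongr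
        _ = L * ((√N)⁻¹ * κ t + √N * (d ^ 2 * κ t) / 4) := by ring
        _ ≤ L * ((√N)⁻¹ * κ t + √N * 4 / 4) := by gcongr
        _ = _ := by ring
    refine (intervalIntegral.norm_integral_le_of_norm_le (by positivity)
      (Filter.Eventually.of_forall fun t _ => hb t)
      (Continuous.intervalIntegrable (by fun_prop) _ _)).trans (le_of_eq ?_)
    rw [intervalIntegral.integral_const_mul, intervalIntegral.integral_add
      (Continuous.intervalIntegrable (by fun_prop) _ _)
      (Continuous.intervalIntegrable (by fun_prop) _ _), intervalIntegral.integral_const_mul,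
      hint1, intervalIntegral.integral_const, smul_eq_mul]
    nth_rewrite 2 [← hsq2]
    field_simp
    ring
  have h4 : |N * (2 * Real.pi * F 1 - c)| ≤ N * (N * ε + 4 * Real.pi * L / √N) := by
    have e : (N : ℝ) * (2 * Real.pi * F 1 - c) = (2 * Real.pi * N * F 1 -
      ∫ t in (0 : ℝ)..2 * Real.pi, F (Complex.exp (t * Complex.I)) * κ t) +
      ((∫ t in (0 : ℝ)..2 * Real.pi, F (Complex.exp (t * Complex.I)) * κ t) - N * c) := by ring
    rw [e]
    refine (abs_add_le _ _).trans ((add_le_add hint3 hint2).trans (le_of_eq ?_))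
    rw [mul_add, ← mul_div_assoc, mul_comm (N : ℝ) (4 * Real.pi * L), mul_div_assoc, Real.div_sqrt]
    ring
  rw [abs_mul, abs_of_pos hN'] at h4
  exact le_of_mul_le_mul_left h4 hN'

/-- The properties of the support function of a planar convex body that are used below. -/
structure IsSupportLike (f : ℂ → ℝ) : Prop where
  continuous : Continuous f
  exists_support : ∀ u, ∃ φ : ℂ →ₗ[ℝ] ℝ, φ u = f u ∧ ∀ v, φ v ≤ f v
  pos : ∀ v, v ≠ 0 → 0 < f v + f (-v)

/-- The width function associated with a support function. -/
def width (f : ℂ → ℝ) (v : ℂ) : ℝ := f v + f (-v)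

/-- The second radial moment of the measure with density `exp (-width f)`. -/
noncomputable def radialMoment (f : ℂ → ℝ) : ℝ := ∫ v, Real.exp (-width f v) * ‖v‖ ^ 2

/-- The complex second moment of the measure with density `exp (-width f)`; it vanishes exactly
when the measure is isotropic. -/
noncomputable def squareMoment (f : ℂ → ℝ) : ℂ := ∫ v, (Real.exp (-width f v) : ℂ) * v ^ 2

/-- The real-linear map `v ↦ p * v + q * conj v` of the complex plane. -/
noncomputable def conjLin (p q : ℂ) : ℂ →ₗ[ℝ] ℂ where
  toFun v := p * v + q * conj v
  map_add' u v := by simp only [map_add]; ring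
  map_smul' c v := by simp; ring

lemma conjLin_apply (p q v : ℂ) : conjLin p q v = p * v + q * conj v := rfl

lemma continuous_conjLin (p q : ℂ) : Continuous (conjLin p q) :=
  LinearMap.continuous_of_finiteDimensional _

lemma exists_eq_conjLin (C : ℂ →ₗ[ℝ] ℂ) : ∃ p q, C = conjLin p q := by
  refine ⟨(C 1 - Complex.I * C Complex.I) / 2, (C 1 + Complex.I * C Complex.I) / 2, ?_⟩
  refine Complex.basisOneI.ext fun i => ?_
  fin_cases i
  · simp [conjLin_apply]; ring
  · simp [conjLin_apply]; linear_combination (C Complex.I) * Complex.I_sq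

lemma det_conjLin (p q : ℂ) : LinearMap.det (conjLin p q) = ‖p‖ ^ 2 - ‖q‖ ^ 2 := by
  rw [← LinearMap.det_toMatrix Complex.basisOneI, Matrix.det_fin_two, ← Complex.normSq_eq_norm_sq,
    ← Complex.normSq_eq_norm_sq, Complex.normSq_apply, Complex.normSq_apply]
  simp [LinearMap.toMatrix_apply, conjLin_apply]
  ring

lemma conjLin_inverse {p q : ℂ} (h : ‖p‖ ^ 2 - ‖q‖ ^ 2 ≠ 0) (v : ℂ) :
    ((‖p‖ ^ 2 - ‖q‖ ^ 2 : ℝ) : ℂ)⁻¹ * conjLin (conj p) (-q) (conjLin p q v) = v := by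
  have h' : ((‖p‖ ^ 2 - ‖q‖ ^ 2 : ℝ) : ℂ) ≠ 0 := by exact_mod_cast h
  rw [inv_mul_eq_iff_eq_mul₀ h']
  simp only [conjLin_apply, map_add, map_mul, Complex.conj_conj]
  push_cast
  rw [← Complex.mul_conj', ← Complex.mul_conj']
  ring

lemma conjLin_injective {p q : ℂ} (h : ‖p‖ ^ 2 - ‖q‖ ^ 2 ≠ 0) :
    Function.Injective (conjLin p q) := fun u v huv => by
  rw [← conjLin_inverse h u, huv, conjLin_inverse h v]

lemma integral_comp_conjLin {E : Type*} [NormedAddCommGroup E] [NormedSpace ℝ E] {p q : ℂ}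
    (h : ‖p‖ ^ 2 - ‖q‖ ^ 2 ≠ 0) {g : ℂ → E} (hg : Continuous g) :
    ∫ v, g (conjLin p q v) = |‖p‖ ^ 2 - ‖q‖ ^ 2|⁻¹ • ∫ v, g v := by
  have hm := MeasureTheory.Measure.map_linearMap_addHaar_eq_smul_addHaar
    (MeasureTheory.volume : MeasureTheory.Measure ℂ) (f := conjLin p q) (by rwa [det_conjLin])
  have := MeasureTheory.integral_map (μ := (MeasureTheory.volume : MeasureTheory.Measure ℂ))
    (φ := conjLin p q) (continuous_conjLin p q).aemeasurable
    (f := g) hg.aestronglyMeasurable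
  rw [← this, hm, MeasureTheory.integral_smul_measure, det_conjLin,
    ENNReal.toReal_ofReal (abs_nonneg _), abs_inv]

lemma integrable_exp_neg_mul_norm {r : ℝ} (hr : 0 < r) :
    MeasureTheory.Integrable fun v : ℂ => Real.exp (-(r * ‖v‖)) * (1 + ‖v‖ ^ 2) := by
  have h : MeasureTheory.Integrable fun v : ℂ => (Real.exp r * 120 / r ^ 5) *
      (1 + ‖v‖) ^ (-3 : ℝ) :=
    (integrable_one_add_norm (by simp; norm_num)).const_mul _
  refine h.mono' (Continuous.aestronglyMeasurable (by fun_prop))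
    (Filter.Eventually.of_forall fun v => ?_)
  have hs := norm_nonneg v
  set s := ‖v‖
  have h1 : (r * (1 + s)) ^ 5 / 120 ≤ Real.exp (r * (1 + s)) := by
    have := Real.pow_div_factorial_le_exp (x := r * (1 + s)) (by positivity) 5
    simpa [Nat.factorial] using this
  have h2 : Real.exp (-(r * s)) = Real.exp r * (Real.exp (r * (1 + s)))⁻¹ := by
    rw [← Real.exp_neg, ← Real.exp_add]; congr 1; ring
  rw [Real.norm_of_nonneg (by positivity), h2, Real.rpow_neg (by positivity)]
  have h3 : (Real.exp (r * (1 + s)))⁻¹ ≤ ((r * (1 + s)) ^ 5 / 120)⁻¹ := by gcongr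
  have h4 : (1 + s) ^ (3 : ℝ) = (1 + s) ^ 3 := by
    rw [← Real.rpow_natCast]; norm_num
  rw [h4]
  calc _ ≤ Real.exp r * ((r * (1 + s)) ^ 5 / 120)⁻¹ * (1 + s) ^ 2 := by
        gcongr; nlinarith
    _ = _ := by field_simp

namespace IsSupportLike

variable {f : ℂ → ℝ}

lemma add_le (hf : IsSupportLike f) (u v : ℂ) : f (u + v) ≤ f u + f v := by
  obtain ⟨φ, h, h'⟩ := hf.exists_support (u + v)
  rw [← h, map_add]
  exact _root_.add_le_add (h' u) (h' v)

lemma map_ofReal_mul (hf : IsSupportLike f) {c : ℝ} (hc : 0 ≤ c) (v : ℂ) : f (c * v) = c * f v := by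
  obtain ⟨φ, h, h'⟩ := hf.exists_support (c * v)
  obtain ⟨ψ, k, k'⟩ := hf.exists_support v
  have e : (c : ℂ) * v = c • v := by simp
  refine le_antisymm ?_ ?_
  · rw [← h, e, map_smul, smul_eq_mul]
    exact mul_le_mul_of_nonneg_left (h' v) hc
  · rw [← k]
    refine le_trans ?_ (k' _)
    rw [e, map_smul, smul_eq_mul]

lemma continuous_width (hf : IsSupportLike f) : Continuous (width f) :=
  hf.continuous.add (hf.continuous.comp continuous_neg)

lemma width_mul (hf : IsSupportLike f) {c : ℝ} (hc : 0 ≤ c) (v : ℂ) :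
    width f (c * v) = c * width f v := by
  rw [width, width, ← mul_neg, hf.map_ofReal_mul hc, hf.map_ofReal_mul hc]; ring

lemma width_nonneg (hf : IsSupportLike f) (v : ℂ) : 0 ≤ width f v := by
  by_cases hv : v = 0
  · have := hf.width_mul (le_refl 0) v
    rw [hv] at this ⊢
    simp at this
    exact this.ge
  · exact (hf.pos v hv).le

lemma width_eq_norm_mul (hf : IsSupportLike f) {v : ℂ} (hv : v ≠ 0) :
    width f v = ‖v‖ * width f (v / ‖v‖) := by
  rw [← hf.width_mul (norm_nonneg v)]
  congr 1
  have : (‖v‖ : ℂ) ≠ 0 := by simpa using hv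
  field_simp

lemma width_zero (hf : IsSupportLike f) : width f 0 = 0 := by
  simpa using hf.width_mul (le_refl 0) 0

lemma mul_norm_le_width_of_sphere (hf : IsSupportLike f) {r : ℝ}
    (h : ∀ v : ℂ, ‖v‖ = 1 → r ≤ width f v) (v : ℂ) : r * ‖v‖ ≤ width f v := by
  by_cases hv : v = 0
  · simp [hv, hf.width_zero]
  · rw [hf.width_eq_norm_mul hv, mul_comm]
    gcongr
    exact h _ (by simp [hv])

lemma width_le_mul_norm_of_sphere (hf : IsSupportLike f) {r : ℝ}
    (h : ∀ v : ℂ, ‖v‖ = 1 → width f v ≤ r) (v : ℂ) : width f v ≤ r * ‖v‖ := by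
  by_cases hv : v = 0
  · simp [hv, hf.width_zero]
  · rw [hf.width_eq_norm_mul hv, mul_comm]
    gcongr
    exact h _ (by simp [hv])

lemma exists_mul_norm_le_width (hf : IsSupportLike f) :
    ∃ r, 0 < r ∧ ∀ v, r * ‖v‖ ≤ width f v := by
  obtain ⟨x, hx, hmin⟩ := (isCompact_sphere (0 : ℂ) 1).exists_isMinOn
    ⟨1, by simp⟩ hf.continuous_width.continuousOn
  refine ⟨width f x, hf.pos x ?_, hf.mul_norm_le_width_of_sphere fun v hv => ?_⟩
  · rintro rfl; simp at hx
  · exact hmin (by simpa using hv)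

lemma integrable_of_le (hf : IsSupportLike f) {E : Type*} [NormedAddCommGroup E] {g : ℂ → E}
    (hg : Continuous g) {c : ℝ}
    (h : ∀ v, ‖g v‖ ≤ Real.exp (-width f v) * (c * (1 + ‖v‖ ^ 2))) :
    MeasureTheory.Integrable g := by
  obtain ⟨r, hr, hw⟩ := hf.exists_mul_norm_le_width
  refine ((integrable_exp_neg_mul_norm hr).const_mul |c|).mono' hg.aestronglyMeasurable
    (Filter.Eventually.of_forall fun v => (h v).trans ?_)
  calc _ ≤ Real.exp (-width f v) * (|c| * (1 + ‖v‖ ^ 2)) := by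
        gcongr
        exact le_abs_self c
    _ ≤ Real.exp (-(r * ‖v‖)) * (|c| * (1 + ‖v‖ ^ 2)) := by
        gcongr
        exact hw v
    _ = _ := by ring

lemma integrable_radial (hf : IsSupportLike f) :
    MeasureTheory.Integrable fun v => Real.exp (-width f v) * ‖v‖ ^ 2 := by
  have := hf.continuous_width
  refine hf.integrable_of_le (by fun_prop) (c := 1) fun v => ?_
  rw [Real.norm_of_nonneg (by positivity)]
  gcongr; linarith

lemma integrable_square (hf : IsSupportLike f) :
    MeasureTheory.Integrable fun v => (Real.exp (-width f v) : ℂ) * v ^ 2 := by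
  have := hf.continuous_width
  refine hf.integrable_of_le (by fun_prop) (c := 1) fun v => ?_
  rw [norm_mul, Complex.norm_real, Real.norm_of_nonneg (by positivity), norm_pow]
  gcongr; linarith

lemma integrable_form (hf : IsSupportLike f) (s : ℝ) (a : ℂ) :
    MeasureTheory.Integrable fun v =>
      Real.exp (-width f v) * (s * ‖v‖ ^ 2 + (a * v ^ 2).re) := by
  have h := (hf.integrable_radial.const_mul s).add (hf.integrable_square.const_mul a).re
  refine h.congr (Filter.Eventually.of_forall fun v => ?_)
  simp only [Pi.add_apply, mul_left_comm a, RCLike.re_to_complex, Complex.re_ofReal_mul]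
  ring

lemma form_eq_integral (hf : IsSupportLike f) (s : ℝ) (a : ℂ) :
    s * radialMoment f + (a * squareMoment f).re =
      ∫ v, Real.exp (-width f v) * (s * ‖v‖ ^ 2 + (a * v ^ 2).re) := by
  have h1 := hf.integrable_radial.const_mul s
  have h2 := (hf.integrable_square.const_mul a)
  have h3 : ∫ v, (a * ((Real.exp (-width f v) : ℂ) * v ^ 2)).re = (a * squareMoment f).re := by
    rw [squareMoment, ← MeasureTheory.integral_const_mul]
    exact integral_re h2
  rw [radialMoment, ← MeasureTheory.integral_const_mul, ← h3]
  refine (MeasureTheory.integral_add h1 h2.re).symm.trans ?_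
  refine MeasureTheory.integral_congr_ae (Filter.Eventually.of_forall fun v => ?_)
  simp only [mul_left_comm a, RCLike.re_to_complex, Complex.re_ofReal_mul]
  ring

lemma exists_rotation_neg (z : ℂ) : ∃ a : ℂ, ‖a‖ = 1 ∧ (a * z).re = -‖z‖ := by
  by_cases hz : z = 0
  · exact ⟨1, by simp [hz]⟩
  · have hz' : (‖z‖ : ℂ) ≠ 0 := by simpa using hz
    refine ⟨-(conj z / ‖z‖), by simp [hz], ?_⟩
    have : -(conj z / ‖z‖) * z = ((-‖z‖ : ℝ) : ℂ) := by
      push_cast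
      field_simp
      rw [Complex.conj_mul']
    rw [this, Complex.ofReal_re]

lemma neg_norm_le_form {a : ℂ} (ha : ‖a‖ = 1) (v : ℂ) : 0 ≤ ‖v‖ ^ 2 + (a * v ^ 2).re := by
  have h := Complex.abs_re_le_norm (a * v ^ 2)
  rw [norm_mul, ha, one_mul, norm_pow] at h
  linarith [neg_abs_le (a * v ^ 2).re]

lemma norm_squareMoment_lt (hf : IsSupportLike f) : ‖squareMoment f‖ < radialMoment f := by
  obtain ⟨a, ha, h⟩ := exists_rotation_neg (squareMoment f)
  have h2 := hf.form_eq_integral 1 a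
  rw [h] at h2
  obtain ⟨v, hv⟩ := IsAlgClosed.exists_pow_nat_eq (conj a) (n := 2) (by norm_num)
  have hc := hf.continuous_width
  have := MeasureTheory.integral_pos_of_integrable_nonneg_nonzero (x := v)
    (μ := MeasureTheory.volume) (f := fun v => Real.exp (-width f v) *
      (1 * ‖v‖ ^ 2 + (a * v ^ 2).re)) (by fun_prop)
    (hf.integrable_form 1 a) (fun v => by
      have := neg_norm_le_form ha v
      simp only [one_mul]
      positivity) (by
      have : ‖v‖ ^ 2 = 1 := by rw [← norm_pow, hv]; simpa using ha
      rw [hv, Complex.mul_conj', ha, this]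
      simp only [mul_one, Complex.ofReal_one, one_pow, Complex.one_re]
      positivity)
  linarith

lemma radialMoment_pos (hf : IsSupportLike f) : 0 < radialMoment f :=
  (norm_nonneg _).trans_lt hf.norm_squareMoment_lt

lemma comp_conjLin (hf : IsSupportLike f) {p q : ℂ} (h : ‖p‖ ^ 2 - ‖q‖ ^ 2 ≠ 0) :
    IsSupportLike fun v => f (conjLin p q v) where
  continuous := hf.continuous.comp (continuous_conjLin p q)
  exists_support u := by
    obtain ⟨φ, h1, h2⟩ := hf.exists_support (conjLin p q u)
    exact ⟨φ ∘ₗ conjLin p q, h1, fun v => h2 _⟩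
  pos v hv := by
    rw [map_neg]
    refine hf.pos _ fun h0 => hv (conjLin_injective h (h0.trans (map_zero _).symm))

lemma width_comp (f : ℂ → ℝ) (p q v : ℂ) :
    width (fun v => f (conjLin p q v)) v = width f (conjLin p q v) := by
  simp [width]

lemma radialMoment_comp (hf : IsSupportLike f) {p q : ℂ} (h : ‖p‖ ^ 2 - ‖q‖ ^ 2 ≠ 0) :
    radialMoment (fun v => f (conjLin p q v)) =
      |‖p‖ ^ 2 - ‖q‖ ^ 2|⁻¹ * ((‖p‖ ^ 2 - ‖q‖ ^ 2) ^ 2)⁻¹ *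
      ((‖p‖ ^ 2 + ‖q‖ ^ 2) * radialMoment f + (-2 * conj p * conj q * squareMoment f).re) := by
  set d := ‖p‖ ^ 2 - ‖q‖ ^ 2 with hd
  have hc := hf.continuous_width
  have key : ∀ u : ℂ, ‖conjLin (conj p) (-q) u‖ ^ 2 =
      (‖p‖ ^ 2 + ‖q‖ ^ 2) * ‖u‖ ^ 2 + (-2 * conj p * conj q * u ^ 2).re := by
    intro u
    simp only [conjLin_apply, Complex.sq_norm, Complex.normSq_apply]
    rw [pow_two u]
    simp
    ring
  have h1 := integral_comp_conjLin h (g := fun u => Real.exp (-width f u) *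
    ‖(d : ℂ)⁻¹ * conjLin (conj p) (-q) u‖ ^ 2) (by
      have := continuous_conjLin (conj p) (-q)
      fun_prop)
  simp only [hd, conjLin_inverse h] at h1
  rw [radialMoment]
  simp only [width_comp]
  rw [h1, form_eq_integral hf, smul_eq_mul, mul_assoc]
  congr 1
  rw [← MeasureTheory.integral_const_mul]
  refine MeasureTheory.integral_congr_ae (Filter.Eventually.of_forall fun v => ?_)
  simp only
  rw [norm_mul, mul_pow, key, norm_inv, Complex.norm_real, inv_pow, Real.norm_eq_abs, sq_abs]
  ring

lemma squareMoment_comp (hf : IsSupportLike f) {p q : ℂ} (h : ‖p‖ ^ 2 - ‖q‖ ^ 2 ≠ 0) :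
    squareMoment (fun v => f (conjLin p q v)) =
      ((|‖p‖ ^ 2 - ‖q‖ ^ 2|⁻¹ * ((‖p‖ ^ 2 - ‖q‖ ^ 2) ^ 2)⁻¹ : ℝ) : ℂ) *
      (conj p ^ 2 * squareMoment f - 2 * conj p * q * radialMoment f +
        q ^ 2 * conj (squareMoment f)) := by
  set d := ‖p‖ ^ 2 - ‖q‖ ^ 2 with hd
  have hc := hf.continuous_width
  have h1 := integral_comp_conjLin h (g := fun u => (Real.exp (-width f u) : ℂ) *
    ((d : ℂ)⁻¹ * conjLin (conj p) (-q) u) ^ 2) (by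
      have := continuous_conjLin (conj p) (-q)
      fun_prop)
  simp only [hd, conjLin_inverse h] at h1
  rw [squareMoment]
  simp only [width_comp]
  rw [h1, Complex.real_smul, Complex.ofReal_mul, mul_assoc]
  congr 1
  have i1 := hf.integrable_square.const_mul (conj p ^ 2)
  have i2 : MeasureTheory.Integrable fun v : ℂ =>
      2 * conj p * q * ((Real.exp (-width f v) * ‖v‖ ^ 2 : ℝ) : ℂ) :=
    (hf.integrable_radial.ofReal (𝕜 := ℂ)).const_mul (2 * conj p * q)
  have i3 : MeasureTheory.Integrable fun v : ℂ =>
      q ^ 2 * conj ((Real.exp (-width f v) : ℂ) * v ^ 2) :=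
    ((Complex.conjCLE.toContinuousLinearMap.integrable_comp
      hf.integrable_square)).const_mul (q ^ 2)
  have i12 : MeasureTheory.Integrable fun v : ℂ =>
      conj p ^ 2 * ((Real.exp (-width f v) : ℂ) * v ^ 2) -
        2 * conj p * q * ((Real.exp (-width f v) * ‖v‖ ^ 2 : ℝ) : ℂ) := i1.sub i2
  have e3 : conj (squareMoment f) = ∫ v, conj ((Real.exp (-width f v) : ℂ) * v ^ 2) :=
    integral_conj.symm
  have e2 : (radialMoment f : ℂ) = ∫ v, ((Real.exp (-width f v) * ‖v‖ ^ 2 : ℝ) : ℂ) :=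
    integral_ofReal.symm
  rw [e2, e3, squareMoment, ← MeasureTheory.integral_const_mul, ← MeasureTheory.integral_const_mul,
    ← MeasureTheory.integral_const_mul, ← MeasureTheory.integral_sub i1 i2,
    ← MeasureTheory.integral_add i12 i3, ← MeasureTheory.integral_const_mul]
  refine MeasureTheory.integral_congr_ae (Filter.Eventually.of_forall fun v => ?_)
  simp only [← hd, conjLin_apply, map_mul, Complex.conj_ofReal, map_pow, Complex.ofReal_mul,
    Complex.ofReal_pow, Complex.ofReal_inv, ← Complex.mul_conj' v]
  ring

end IsSupportLike

lemma circleCoef_integrand_continuous {f : ℂ → ℝ} (hf : Continuous f) (n : ℤ) :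
    Continuous fun t : ℝ => (f (Complex.exp (t * Complex.I)) : ℂ) *
      Complex.exp (-(n * t * Complex.I)) := by fun_prop

lemma circleCoef_rotation (n : ℤ) (g : ℂ → ℝ) (α : ℝ) :
    circleCoef n (fun v => g (Complex.exp (α * Complex.I) * v)) =
      Complex.exp (n * α * Complex.I) * circleCoef n g := by
  set k : ℝ → ℂ := fun t => (g (Complex.exp (t * Complex.I)) : ℂ) *
    Complex.exp (-(n * t * Complex.I)) with hk
  have hper : Function.Periodic k (2 * Real.pi) := fun t => by
    have e1 : Complex.exp (((t + 2 * Real.pi : ℝ) : ℂ) * Complex.I) =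
        Complex.exp (t * Complex.I) := by
      push_cast
      rw [add_mul, Complex.exp_add, Complex.exp_two_pi_mul_I, mul_one]
    have e2 : Complex.exp (-(n * ((t + 2 * Real.pi : ℝ) : ℂ) * Complex.I)) =
        Complex.exp (-(n * t * Complex.I)) :=
      Complex.exp_eq_exp_iff_exists_int.2 ⟨-n, by push_cast; ring⟩
    simp only [hk, e1, e2]
  have h1 : ∀ t : ℝ, (g (Complex.exp (α * Complex.I) * Complex.exp (t * Complex.I)) : ℂ) *
      Complex.exp (-(n * t * Complex.I)) = Complex.exp (n * α * Complex.I) * k (t + α) := by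
    intro t
    simp only [hk]
    rw [← Complex.exp_add, mul_left_comm, ← Complex.exp_add]
    push_cast
    congr 3 <;> ring_nf
  simp only [circleCoef, h1]
  rw [intervalIntegral.integral_const_mul, intervalIntegral.integral_comp_add_right (f := k)]
  congr 1
  have := hper.intervalIntegral_add_eq α 0
  rw [zero_add] at this
  rw [zero_add, add_comm, this]

lemma circleCoef_conj (n : ℤ) (g : ℂ → ℝ) :
    circleCoef n (fun v => g (conj v)) = conj (circleCoef n g) := by
  set k : ℝ → ℂ := fun t => (g (Complex.exp (t * Complex.I)) : ℂ) *
    Complex.exp (n * t * Complex.I) with hk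
  have hper : Function.Periodic k (2 * Real.pi) := fun t => by
    have e1 : Complex.exp (((t + 2 * Real.pi : ℝ) : ℂ) * Complex.I) =
        Complex.exp (t * Complex.I) := by
      push_cast
      rw [add_mul, Complex.exp_add, Complex.exp_two_pi_mul_I, mul_one]
    have e2 : Complex.exp (n * ((t + 2 * Real.pi : ℝ) : ℂ) * Complex.I) =
        Complex.exp (n * t * Complex.I) :=
      Complex.exp_eq_exp_iff_exists_int.2 ⟨n, by push_cast; ring⟩
    simp only [hk, e1, e2]
  have h1 : ∀ t : ℝ, (g (conj (Complex.exp (t * Complex.I))) : ℂ) *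
      Complex.exp (-(n * t * Complex.I)) = k (-t) := by
    intro t
    simp only [hk]
    rw [← Complex.exp_conj]
    simp
  have h2 : ∀ t : ℝ, conj ((g (Complex.exp (t * Complex.I)) : ℂ) *
      Complex.exp (-(n * t * Complex.I))) = k t := by
    intro t
    simp only [hk]
    rw [map_mul, ← Complex.exp_conj]
    simp
  have h3 : conj (circleCoef n g) = ∫ t in (0 : ℝ)..2 * Real.pi, k t := by
    simp only [← h2, circleCoef]
    rw [intervalIntegral.integral_of_le (by positivity), intervalIntegral.integral_of_le
      (by positivity)]
    exact integral_conj.symm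
  rw [h3]
  simp only [circleCoef, h1]
  rw [intervalIntegral.integral_comp_neg]
  have := hper.intervalIntegral_add_eq (-(2 * Real.pi)) 0
  simpa using this

lemma norm_circleCoef_sub_le {F G : ℂ → ℝ} (hF : Continuous F) (hG : Continuous G) {c : ℝ}
    (h : ∀ u : ℂ, ‖u‖ = 1 → |F u - G u| ≤ c) (n : ℤ) :
    ‖circleCoef n F - circleCoef n G‖ ≤ 2 * Real.pi * c := by
  rw [circleCoef, circleCoef, ← intervalIntegral.integral_sub
    ((circleCoef_integrand_continuous hF n).intervalIntegrable _ _)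
    ((circleCoef_integrand_continuous hG n).intervalIntegrable _ _)]
  refine (intervalIntegral.norm_integral_le_of_norm_le_const (C := c) fun t _ => ?_).trans ?_
  · have e : Complex.exp (-(n * t * Complex.I)) = Complex.exp ((-(n * t) : ℝ) * Complex.I) := by
      push_cast; ring_nf
    rw [← sub_mul, norm_mul, e, Complex.norm_exp_ofReal_mul_I, mul_one, ← Complex.ofReal_sub,
      Complex.norm_real]
    exact h _ (Complex.norm_exp_ofReal_mul_I t)
  · rw [sub_zero, abs_of_pos (by positivity), mul_comm]

lemma circleCoef_add {F G : ℂ → ℝ} (hF : Continuous F) (hG : Continuous G) (n : ℤ) :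
    circleCoef n (fun v => F v + G v) = circleCoef n F + circleCoef n G := by
  rw [circleCoef, circleCoef, circleCoef, ← intervalIntegral.integral_add
    ((circleCoef_integrand_continuous hF n).intervalIntegrable _ _)
    ((circleCoef_integrand_continuous hG n).intervalIntegrable _ _)]
  simp [add_mul]

lemma circleCoef_const_mul (F : ℂ → ℝ) (c : ℝ) (n : ℤ) :
    circleCoef n (fun v => c * F v) = c * circleCoef n F := by
  rw [circleCoef, circleCoef, ← intervalIntegral.integral_const_mul]
  simp [mul_assoc]

lemma exists_re_form (φ : ℂ →ₗ[ℝ] ℝ) : ∃ b : ℂ, ∀ v, φ v = (b * v).re := by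
  refine ⟨φ 1 - φ Complex.I * Complex.I, fun v => ?_⟩
  have : v = v.re • 1 + v.im • Complex.I := by simp
  rw [this, map_add, map_smul, map_smul]
  simp
  ring

lemma integral_exp_mul_exp (k n : ℤ) :
    ∫ t in (0 : ℝ)..2 * Real.pi, Complex.exp (k * t * Complex.I) *
      Complex.exp (-(n * t * Complex.I)) = if n = k then 2 * Real.pi else 0 := by
  have e : ∀ t : ℝ, Complex.exp (k * t * Complex.I) * Complex.exp (-(n * t * Complex.I)) =
      Complex.exp (-((n - k : ℤ) * t * Complex.I)) := fun t => by
    rw [← Complex.exp_add]; push_cast; ring_nf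
  simp only [e]
  split_ifs with h
  · simp [h]
  · exact integral_exp_int_mul_I (sub_ne_zero.2 h)

lemma circleCoef_re_mul (b : ℂ) (n : ℤ) :
    circleCoef n (fun v => (b * v).re) =
      b / 2 * (if n = 1 then 2 * Real.pi else 0) +
        conj b / 2 * (if n = -1 then 2 * Real.pi else 0) := by
  rw [← integral_exp_mul_exp 1 n, ← integral_exp_mul_exp (-1) n,
    ← intervalIntegral.integral_const_mul, ← intervalIntegral.integral_const_mul,
    ← intervalIntegral.integral_add (Continuous.intervalIntegrable (by fun_prop) _ _)
      (Continuous.intervalIntegrable (by fun_prop) _ _), circleCoef]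
  refine intervalIntegral.integral_congr fun t _ => ?_
  simp only [Complex.re_eq_add_conj, map_mul, ← Complex.exp_conj, Complex.conj_I,
    Complex.conj_ofReal]
  push_cast
  ring_nf

lemma circleCoef_linear (φ : ℂ →ₗ[ℝ] ℝ) {n : ℤ} (h1 : n ≠ 1) (h2 : n ≠ -1) :
    circleCoef n φ = 0 := by
  obtain ⟨b, hb⟩ := exists_re_form φ
  rw [funext hb, circleCoef_re_mul]
  simp [h1, h2]

/-- A support function in isotropic position. -/
structure IsNormalized (f : ℂ → ℝ) : Prop extends IsSupportLike f where
  radialMoment_eq : radialMoment f = 1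
  squareMoment_eq : squareMoment f = 0

/-- The holomorphic part of a linear map putting `f` in isotropic position, the antiholomorphic
part being `squareMoment f`; see `conjLin`. -/
noncomputable def normP (f : ℂ → ℝ) : ℂ :=
  ((radialMoment f + √(radialMoment f ^ 2 - ‖squareMoment f‖ ^ 2) : ℝ) : ℂ)

lemma IsSupportLike.radicand_pos {f : ℂ → ℝ} (hf : IsSupportLike f) :
    0 < radialMoment f ^ 2 - ‖squareMoment f‖ ^ 2 := by
  have := hf.norm_squareMoment_lt
  have := norm_nonneg (squareMoment f)
  nlinarith

lemma IsSupportLike.normP_det_pos {f : ℂ → ℝ} (hf : IsSupportLike f) :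
    0 < ‖normP f‖ ^ 2 - ‖squareMoment f‖ ^ 2 := by
  have h1 := hf.radicand_pos
  have h2 := Real.sqrt_pos.2 h1
  have h3 := hf.radialMoment_pos
  rw [normP, Complex.norm_real, Real.norm_of_nonneg (by positivity)]
  nlinarith

lemma IsSupportLike.squareMoment_normP {f : ℂ → ℝ} (hf : IsSupportLike f) :
    squareMoment (fun v => f (conjLin (normP f) (squareMoment f) v)) = 0 := by
  rw [hf.squareMoment_comp hf.normP_det_pos.ne', normP]
  have h := Real.sq_sqrt hf.radicand_pos.le
  set D := √(radialMoment f ^ 2 - ‖squareMoment f‖ ^ 2)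
  refine mul_eq_zero_of_right _ ?_
  rw [Complex.conj_ofReal]
  have h' : (D : ℂ) ^ 2 = radialMoment f ^ 2 - squareMoment f * conj (squareMoment f) := by
    rw [Complex.mul_conj']
    exact_mod_cast h
  push_cast
  linear_combination squareMoment f * h'

lemma conjLin_real (c : ℝ) (v : ℂ) : conjLin c 0 v = c * v := by simp [conjLin_apply]

lemma IsSupportLike.radialMoment_real_mul {f : ℂ → ℝ} (hf : IsSupportLike f) {c : ℝ} (hc : 0 < c) :
    radialMoment (fun v => f (c * v)) = (c ^ 4)⁻¹ * radialMoment f := by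
  have := hf.radialMoment_comp (p := c) (q := 0) (by simp [hc.ne'])
  simp only [conjLin_real] at this
  rw [this]
  simp
  field_simp

lemma IsSupportLike.squareMoment_real_mul {f : ℂ → ℝ} (hf : IsSupportLike f) {c : ℝ} (hc : 0 < c) :
    squareMoment (fun v => f (c * v)) = (c ^ 4 : ℂ)⁻¹ * squareMoment f := by
  have := hf.squareMoment_comp (p := c) (q := 0) (by simp [hc.ne'])
  simp only [conjLin_real] at this
  rw [this]
  have : (c : ℂ) ≠ 0 := by exact_mod_cast hc.ne'
  simp
  field_simp

lemma IsSupportLike.real_mul {f : ℂ → ℝ} (hf : IsSupportLike f) {c : ℝ} (hc : 0 < c) :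
    IsSupportLike fun v => f (c * v) := by
  have := hf.comp_conjLin (p := c) (q := 0) (by simp [hc.ne'])
  simpa only [conjLin_real] using this

lemma IsSupportLike.exists_normalized {f : ℂ → ℝ} (hf : IsSupportLike f) :
    ∃ τ : ℝ, 0 < τ ∧ IsNormalized fun v =>
      f (conjLin (τ * normP f) (τ * squareMoment f) v) := by
  have hg := hf.comp_conjLin hf.normP_det_pos.ne'
  set g := fun v => f (conjLin (normP f) (squareMoment f) v) with hgdef
  have hm := hg.radialMoment_pos
  have hτ : 0 < √(√(radialMoment g)) := by positivity
  refine ⟨√(√(radialMoment g)), hτ, ?_⟩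
  have e : (fun v => f (conjLin ((√(√(radialMoment g)) : ℝ) * normP f)
      ((√(√(radialMoment g)) : ℝ) * squareMoment f) v)) =
      fun v => g ((√(√(radialMoment g)) : ℝ) * v) := by
    ext v
    simp only [hgdef, conjLin_apply, map_mul, Complex.conj_ofReal]
    ring_nf
  rw [e]
  refine ⟨hg.real_mul hτ, ?_, ?_⟩
  · rw [hg.radialMoment_real_mul hτ]
    have : √(√(radialMoment g)) ^ 4 = radialMoment g := by
      rw [show 4 = 2 * 2 from rfl, pow_mul, Real.sq_sqrt (by positivity), Real.sq_sqrt hm.le]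
    rw [this, inv_mul_cancel₀ hm.ne']
  · rw [hg.squareMoment_real_mul hτ, hf.squareMoment_normP, mul_zero]

namespace IsSupportLike

variable {f : ℂ → ℝ}

lemma width_half (f : ℂ → ℝ) (hf : IsSupportLike f) (v : ℂ) :
    width (fun v => f (((1 / 2 : ℝ) : ℂ) * v)) v = width f v / 2 := by
  have := hf.width_mul (c := 1 / 2) (by norm_num) v
  simp only [width, mul_neg] at this ⊢
  rw [this]; ring

lemma integral_exp_neg_half_width_le (hf : IsSupportLike f) :
    MeasureTheory.Integrable (fun v => Real.exp (-(width f v / 2))) ∧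
    ∫ v, Real.exp (-(width f v / 2)) ≤ Real.pi + 16 * radialMoment f := by
  have hg := hf.real_mul (c := 1 / 2) (by norm_num)
  have hw := width_half f hf
  have hm := hf.radialMoment_real_mul (c := 1 / 2) (by norm_num)
  have hc := hf.continuous_width
  have hint := hg.integrable_radial
  rw [radialMoment] at hm
  simp only [hw] at hm hint
  have hI : MeasureTheory.Integrable (fun v => Real.exp (-(width f v / 2))) := by
    refine hg.integrable_of_le (by fun_prop) (c := 1) fun v => ?_
    rw [hw, Real.norm_of_nonneg (by positivity)]
    exact le_mul_of_one_le_right (by positivity) (by nlinarith [sq_nonneg ‖v‖])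
  refine ⟨hI, ?_⟩
  have hB : MeasureTheory.Integrable ((ball (0 : ℂ) 1).indicator fun _ => (1 : ℝ)) :=
    (MeasureTheory.integrable_indicator_iff measurableSet_ball).2
      (MeasureTheory.integrableOn_const (by simp [Complex.volume_ball]))
  have hBi : ∫ v, (ball (0 : ℂ) 1).indicator (fun _ => (1 : ℝ)) v = Real.pi := by
    rw [MeasureTheory.integral_indicator measurableSet_ball]
    simp [MeasureTheory.measureReal_def, Complex.volume_ball]
  calc _ ≤ ∫ v, ((ball (0 : ℂ) 1).indicator (fun _ => (1 : ℝ)) v +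
        Real.exp (-(width f v / 2)) * ‖v‖ ^ 2) := by
        refine MeasureTheory.integral_mono hI (hB.add hint) fun v => ?_
        by_cases hv : v ∈ ball (0 : ℂ) 1
        · simp only [indicator_of_mem hv]
          have : Real.exp (-(width f v / 2)) ≤ 1 :=
            Real.exp_le_one_iff.2 (by linarith [hf.width_nonneg v])
          nlinarith [Real.exp_pos (-(width f v / 2)), sq_nonneg ‖v‖,
            mul_nonneg (Real.exp_pos (-(width f v / 2))).le (sq_nonneg ‖v‖)]
        · simp only [indicator_of_notMem hv, zero_add]
          have : 1 ≤ ‖v‖ := by simpa using hv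
          exact le_mul_of_one_le_right (by positivity) (by nlinarith)
    _ = _ := by
        rw [MeasureTheory.integral_add hB hint, hBi, hm]
        norm_num

end IsSupportLike

namespace IsNormalized

variable {f g : ℂ → ℝ}

lemma width_le (hf : IsNormalized f) (u : ℂ) : width f u ≤ 18 * ‖u‖ := by
  have hS := hf.toIsSupportLike
  obtain ⟨φ, h1, h2⟩ := hS.exists_support u
  obtain ⟨ψ, k1, k2⟩ := hS.exists_support (-u)
  obtain ⟨b, hb⟩ := exists_re_form (φ - ψ)
  have hu : width f u = (b * u).re := by
    rw [← hb, LinearMap.sub_apply, h1, width, ← k1, map_neg]; ring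
  have hle : ∀ v, (b * v).re ≤ width f v := fun v => by
    rw [← hb, LinearMap.sub_apply, width]
    have := h2 v
    have := k2 (-v)
    rw [map_neg] at this
    linarith
  have hsq : ∀ v, (b * v).re ^ 2 ≤ width f v ^ 2 := fun v => by
    refine sq_le_sq' ?_ (hle v)
    have := hle (-v)
    rw [mul_neg, Complex.neg_re] at this
    have e : width f (-v) = width f v := by simp only [width, neg_neg, add_comm]
    linarith
  have hform := hS.form_eq_integral (‖b‖ ^ 2 / 2) (b ^ 2 / 2)
  have hint := hS.integrable_form (‖b‖ ^ 2 / 2) (b ^ 2 / 2)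
  obtain ⟨hI, hle16⟩ := hS.integral_exp_neg_half_width_le
  have e : ∀ v : ℂ, ‖b‖ ^ 2 / 2 * ‖v‖ ^ 2 + (b ^ 2 / 2 * v ^ 2).re = (b * v).re ^ 2 := fun v => by
    have : b ^ 2 / 2 * v ^ 2 = (b * v) ^ 2 / 2 := by ring
    rw [this, show ‖b‖ ^ 2 / 2 * ‖v‖ ^ 2 = ‖b * v‖ ^ 2 / 2 by rw [norm_mul]; ring,
      Complex.sq_norm, Complex.normSq_apply, pow_two (b * v)]
    simp
    ring
  simp only [e] at hform hint
  rw [hf.radialMoment_eq, hf.squareMoment_eq] at hform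
  have hmono : ∫ v, Real.exp (-width f v) * (b * v).re ^ 2 ≤
      ∫ v, 8 * Real.exp (-(width f v / 2)) := by
    refine MeasureTheory.integral_mono hint (hI.const_mul 8) fun v => ?_
    have hw := hS.width_nonneg v
    have h8 : width f v ^ 2 ≤ 8 * Real.exp (width f v / 2) := by
      have := Real.pow_div_factorial_le_exp (x := width f v / 2) (by positivity) 2
      simp [Nat.factorial] at this
      nlinarith
    have e2 : Real.exp (-width f v) * Real.exp (width f v / 2) = Real.exp (-(width f v / 2)) := by
      rw [← Real.exp_add]; ring_nf
    calc Real.exp (-width f v) * (b * v).re ^ 2 ≤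
          Real.exp (-width f v) * (8 * Real.exp (width f v / 2)) := by
          gcongr
          exact (hsq v).trans h8
      _ = 8 * Real.exp (-(width f v / 2)) := by rw [← e2]; ring
  rw [MeasureTheory.integral_const_mul] at hmono
  rw [hf.radialMoment_eq] at hle16
  have hb18 : ‖b‖ ≤ 18 := by
    have := Real.pi_lt_d2
    rw [mul_zero, Complex.zero_re, mul_one, add_zero] at hform
    nlinarith [norm_nonneg b]
  rw [hu]
  calc (b * u).re ≤ ‖b * u‖ := Complex.re_le_norm _
    _ = ‖b‖ * ‖u‖ := norm_mul _ _
    _ ≤ _ := by gcongr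

lemma exists_one_le_width (hf : IsNormalized f) : ∃ u : ℂ, ‖u‖ = 1 ∧ 1 ≤ width f u := by
  by_contra! h
  have hS := hf.toIsSupportLike
  have hw : ∀ v, width f v ≤ ‖v‖ := fun v => by
    simpa using hS.width_le_mul_norm_of_sphere (fun v hv => (h v hv).le) v
  have h1 := hf.radialMoment_eq
  rw [radialMoment] at h1
  set A : Set ℂ := ball 0 2 \ ball 0 1
  have hA : MeasurableSet A := measurableSet_ball.diff measurableSet_ball
  have hvol : MeasureTheory.volume.real A = 3 * Real.pi := by
    rw [MeasureTheory.measureReal_sdiff (ball_subset_ball (by norm_num)) measurableSet_ball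
      MeasureTheory.measure_ball_lt_top.ne]
    simp [MeasureTheory.measureReal_def, Complex.volume_ball]
    ring
  have h2 : ∫ v, A.indicator (fun _ => Real.exp (-2)) v ≤
      ∫ v, Real.exp (-width f v) * ‖v‖ ^ 2 := by
    refine MeasureTheory.integral_mono ((MeasureTheory.integrable_indicator_iff hA).2
      (MeasureTheory.integrableOn_const ?_)) hS.integrable_radial fun v => ?_
    · exact ((MeasureTheory.measure_mono sdiff_subset).trans_lt
        MeasureTheory.measure_ball_lt_top).ne
    · by_cases hv : v ∈ A
      · simp only [indicator_of_mem hv]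
        have hv1 : 1 ≤ ‖v‖ := by simpa using hv.2
        have hv2 : ‖v‖ < 2 := by simpa using hv.1
        have h3 : Real.exp (-2) ≤ Real.exp (-width f v) := Real.exp_le_exp.2 (by linarith [hw v])
        exact h3.trans (le_mul_of_one_le_right (by positivity) (by nlinarith))
      · simp only [indicator_of_notMem hv]
        positivity
  rw [MeasureTheory.integral_indicator hA, h1, MeasureTheory.setIntegral_const, hvol,
    smul_eq_mul] at h2
  have h4 : Real.exp 2 < 8 := by
    have := Real.exp_one_lt_d9
    rw [show (2 : ℝ) = 1 + 1 by norm_num, Real.exp_add]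
    nlinarith [Real.exp_pos 1]
  have h5 : Real.exp (-2) * Real.exp 2 = 1 := by rw [← Real.exp_add]; norm_num
  have := Real.pi_gt_three
  nlinarith [Real.exp_pos (-2), Real.exp_pos 2]

end IsNormalized

namespace IsNormalized

variable {f g : ℂ → ℝ}

lemma exists_linear_lipschitz (hg : IsNormalized g) :
    ∃ φ : ℂ →ₗ[ℝ] ℝ, (∀ v, φ v ≤ g v) ∧ ∀ x y, |(g x - φ x) - (g y - φ y)| ≤ 18 * ‖x - y‖ := by
  have hS := hg.toIsSupportLike
  obtain ⟨φ, -, h⟩ := hS.exists_support 0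
  have key : ∀ x y, (g x - φ x) - (g y - φ y) ≤ 18 * ‖x - y‖ := fun x y => by
    have h1 := hS.add_le (x - y) y
    rw [sub_add_cancel] at h1
    have h2 := hg.width_le (x - y)
    have h3 := h (-(x - y))
    rw [map_neg, map_sub] at h3
    rw [width] at h2
    linarith
  refine ⟨φ, h, fun x y => abs_sub_le_iff.2 ⟨key x y, ?_⟩⟩
  rw [norm_sub_rev]
  exact key y x

lemma radial_add_norm_le (hf : IsNormalized f) {G : ℂ → ℝ} (hG : IsSupportLike G)
    (h : ∀ v, width f v ≤ width G v) : radialMoment G + ‖squareMoment G‖ ≤ 1 := by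
  obtain ⟨a, ha, ha'⟩ := IsSupportLike.exists_rotation_neg (squareMoment G)
  have ha2 : ‖-a‖ = 1 := by rwa [norm_neg]
  have h1 := hG.form_eq_integral 1 (-a)
  have h2 := hf.toIsSupportLike.form_eq_integral 1 (-a)
  rw [neg_mul, Complex.neg_re, ha', neg_neg, one_mul] at h1
  rw [hf.radialMoment_eq, hf.squareMoment_eq, mul_zero, Complex.zero_re, mul_one, add_zero] at h2
  rw [h1]
  refine le_of_le_of_eq (MeasureTheory.integral_mono (hG.integrable_form _ _)
    (hf.toIsSupportLike.integrable_form _ _) fun v => ?_) h2.symm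
  have := IsSupportLike.neg_norm_le_form ha2 v
  simp only [one_mul]
  gcongr
  exact h v

lemma le_radial_sub_norm (hf : IsNormalized f) {G : ℂ → ℝ} (hG : IsSupportLike G) {c : ℝ}
    (hc : 0 < c) (h : ∀ v, width G v ≤ c * width f v) :
    (c ^ 4)⁻¹ ≤ radialMoment G - ‖squareMoment G‖ := by
  obtain ⟨a, ha, ha'⟩ := IsSupportLike.exists_rotation_neg (squareMoment G)
  have hS := hf.toIsSupportLike
  have hF := hS.real_mul hc
  have h1 := hG.form_eq_integral 1 a
  have h2 := hF.form_eq_integral 1 a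
  rw [ha', one_mul, ← sub_eq_add_neg] at h1
  rw [hS.radialMoment_real_mul hc, hS.squareMoment_real_mul hc, hf.radialMoment_eq,
    hf.squareMoment_eq, mul_zero, mul_zero, Complex.zero_re, mul_one, add_zero, one_mul] at h2
  rw [h1, h2]
  refine MeasureTheory.integral_mono (hF.integrable_form _ _) (hG.integrable_form _ _) fun v => ?_
  have := IsSupportLike.neg_norm_le_form ha v
  simp only [one_mul]
  gcongr
  refine (h v).trans_eq ?_
  rw [← hS.width_mul hc.le]
  simp [width]

end IsNormalized

lemma singular_values_bound {s₁ s₂ δ : ℝ} (hs₂ : 0 < s₂) (h12 : s₂ ≤ s₁) (hδ : 0 ≤ δ)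
    (hδ1 : δ ≤ 1) (h1 : ((s₁ * s₂) ^ 3)⁻¹ * s₁ ^ 2 ≤ 1)
    (h2 : ((1 + δ) ^ 4)⁻¹ ≤ ((s₁ * s₂) ^ 3)⁻¹ * s₂ ^ 2) :
    1 ≤ s₁ ∧ s₁ ≤ 1 + 3 * δ ∧ 1 - δ ≤ s₂ ∧ s₂ ≤ 1 + δ := by
  have hs₁ : 0 < s₁ := hs₂.trans_le h12
  have a1 : 1 ≤ s₁ * s₂ ^ 3 := by
    have : ((s₁ * s₂) ^ 3)⁻¹ * s₁ ^ 2 = (s₁ * s₂ ^ 3)⁻¹ := by field_simp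
    rw [this] at h1
    exact (inv_le_one₀ (by positivity)).1 h1
  have a2 : s₁ ^ 3 * s₂ ≤ (1 + δ) ^ 4 := by
    have : ((s₁ * s₂) ^ 3)⁻¹ * s₂ ^ 2 = (s₁ ^ 3 * s₂)⁻¹ := by field_simp
    rw [this] at h2
    exact (inv_le_inv₀ (by positivity) (by positivity)).1 h2
  have b1 : 1 ≤ s₁ := by
    have : s₁ * s₂ ^ 3 ≤ s₁ * s₁ ^ 3 := by gcongr
    by_contra! hlt
    have : s₁ ^ 4 < 1 := pow_lt_one₀ hs₁.le hlt (by norm_num)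
    nlinarith
  have b4 : s₂ ≤ 1 + δ := by
    have : s₂ ^ 3 * s₂ ≤ s₁ ^ 3 * s₂ := by gcongr
    exact le_of_pow_le_pow_left₀ (n := 4) (by norm_num) (by positivity) (by nlinarith)
  have b2 : s₁ ≤ (1 + δ) ^ 2 := by
    refine le_of_pow_le_pow_left₀ (n := 8) (by norm_num) (by positivity) ?_
    calc s₁ ^ 8 ≤ s₁ ^ 8 * (s₁ * s₂ ^ 3) := le_mul_of_one_le_right (by positivity) a1
      _ = (s₁ ^ 3 * s₂) ^ 3 := by ring
      _ ≤ ((1 + δ) ^ 4) ^ 3 := by gcongr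
      _ = (1 + δ) ^ 12 := by ring
      _ ≤ (1 + δ) ^ 16 := pow_le_pow_right₀ (by linarith) (by norm_num)
      _ = _ := by ring
  have b3 : 1 ≤ (1 + δ) * s₂ := by
    by_contra! hlt
    have h3 : ((1 + δ) * s₂) ^ 3 < 1 := pow_lt_one₀ (by positivity) hlt (by norm_num)
    have : s₁ * s₂ ^ 3 ≤ (1 + δ) ^ 2 * s₂ ^ 3 := by gcongr
    have : (1 + δ) ^ 2 * s₂ ^ 3 ≤ (1 + δ) ^ 3 * s₂ ^ 3 := by
      gcongr
      · linarith
      · norm_num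
    nlinarith
  refine ⟨b1, by nlinarith, by nlinarith, b4⟩

lemma exists_exp_eq {ω : ℂ} (h : ‖ω‖ = 1) : ∃ α : ℝ, Complex.exp (α * Complex.I) = ω :=
  ⟨Complex.arg ω, by
    have := Complex.norm_mul_exp_arg_mul_I ω
    rwa [h, Complex.ofReal_one, one_mul] at this⟩

lemma norm_circleCoef_comp_rotation {ω : ℂ} (h : ‖ω‖ = 1) (n : ℤ) (g : ℂ → ℝ) :
    ‖circleCoef n (fun v => g (ω * v))‖ = ‖circleCoef n g‖ := by
  obtain ⟨α, rfl⟩ := exists_exp_eq h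
  have e : (n : ℂ) * α * Complex.I = ((n * α : ℝ) : ℂ) * Complex.I := by push_cast; ring
  rw [circleCoef_rotation, norm_mul, e, Complex.norm_exp_ofReal_mul_I, one_mul]

lemma norm_circleCoef_comp_reflection {ω : ℂ} (h : ‖ω‖ = 1) (n : ℤ) (g : ℂ → ℝ) :
    ‖circleCoef n (fun v => g (ω * conj v))‖ = ‖circleCoef n g‖ := by
  rw [circleCoef_conj n fun v => g (ω * v), Complex.norm_conj, norm_circleCoef_comp_rotation h]

lemma norm_sub_div_norm_mul {p v : ℂ} (hp : p ≠ 0) :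
    ‖p * v - p / ‖p‖ * v‖ = |‖p‖ - 1| * ‖v‖ := by
  have h : (‖p‖ : ℂ) ≠ 0 := by simpa using hp
  have e : p * v - p / ‖p‖ * v = ((‖p‖ - 1 : ℝ) : ℂ) * (p / ‖p‖) * v := by
    push_cast; field_simp
  rw [e, norm_mul, norm_mul, Complex.norm_real, Real.norm_eq_abs]
  simp [hp]

lemma exists_isometry_near {p q : ℂ} {δ : ℝ} (hδ : 0 ≤ δ) (hδ1 : δ ≤ 1)
    (hd : ‖p‖ ^ 2 - ‖q‖ ^ 2 ≠ 0)
    (h1 : |‖p‖ ^ 2 - ‖q‖ ^ 2|⁻¹ * ((‖p‖ ^ 2 - ‖q‖ ^ 2) ^ 2)⁻¹ * (‖p‖ + ‖q‖) ^ 2 ≤ 1)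
    (h2 : ((1 + δ) ^ 4)⁻¹ ≤
      |‖p‖ ^ 2 - ‖q‖ ^ 2|⁻¹ * ((‖p‖ ^ 2 - ‖q‖ ^ 2) ^ 2)⁻¹ * (‖p‖ - ‖q‖) ^ 2) :
    ∃ O : ℂ →ₗ[ℝ] ℂ, (∀ v, ‖conjLin p q v - O v‖ ≤ 4 * δ * ‖v‖) ∧
      ∀ n g, ‖circleCoef n (fun v => g (O v))‖ = ‖circleCoef n g‖ := by
  have hP := norm_nonneg p
  have hQ := norm_nonneg q
  have habs : |‖p‖ ^ 2 - ‖q‖ ^ 2| = (‖p‖ + ‖q‖) * |‖p‖ - ‖q‖| := by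
    rw [sq_sub_sq, abs_mul, abs_of_nonneg (by positivity)]
  have hs₂ : 0 < |‖p‖ - ‖q‖| := abs_pos.2 fun h => hd (by rw [sq_sub_sq, h, mul_zero])
  have h12 : |‖p‖ - ‖q‖| ≤ ‖p‖ + ‖q‖ := abs_le.2 ⟨by linarith, by linarith⟩
  have ek : |‖p‖ ^ 2 - ‖q‖ ^ 2|⁻¹ * ((‖p‖ ^ 2 - ‖q‖ ^ 2) ^ 2)⁻¹ =
      (((‖p‖ + ‖q‖) * |‖p‖ - ‖q‖|) ^ 3)⁻¹ := by
    rw [← habs, ← sq_abs (‖p‖ ^ 2 - ‖q‖ ^ 2), ← mul_inv, ← pow_succ']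
  rw [ek] at h1 h2
  rw [← sq_abs (‖p‖ - ‖q‖)] at h2
  obtain ⟨b1, b2, b3, b4⟩ := singular_values_bound hs₂ h12 hδ hδ1 h1 h2
  rcases le_total ‖q‖ ‖p‖ with hle | hle
  · rw [abs_of_nonneg (by linarith)] at b3 b4
    have hp : p ≠ 0 := norm_pos_iff.1 (by linarith)
    refine ⟨conjLin (p / ‖p‖) 0, fun v => ?_, fun n g => ?_⟩
    · have e : conjLin p q v - conjLin (p / ‖p‖) 0 v = (p * v - p / ‖p‖ * v) + q * conj v := by
        simp only [conjLin_apply]; ring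
      rw [e]
      calc _ ≤ |‖p‖ - 1| * ‖v‖ + ‖q‖ * ‖v‖ := by
            refine (norm_add_le _ _).trans_eq ?_
            rw [norm_sub_div_norm_mul hp, norm_mul, Complex.norm_conj]
        _ = (|‖p‖ - 1| + ‖q‖) * ‖v‖ := by ring
        _ ≤ _ := by
            gcongr
            have : |‖p‖ - 1| ≤ 2 * δ := abs_le.2 ⟨by linarith, by linarith⟩
            linarith
    · have : ∀ v, conjLin (p / ‖p‖) 0 v = p / ‖p‖ * v := fun v => by simp [conjLin_apply]
      simp only [this]
      exact norm_circleCoef_comp_rotation (by simp [hp]) n g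
  · rw [abs_of_nonpos (by linarith)] at b3 b4
    have hq : q ≠ 0 := norm_pos_iff.1 (by linarith)
    refine ⟨conjLin 0 (q / ‖q‖), fun v => ?_, fun n g => ?_⟩
    · have e : conjLin p q v - conjLin 0 (q / ‖q‖) v =
          (q * conj v - q / ‖q‖ * conj v) + p * v := by
        simp only [conjLin_apply]; ring
      rw [e]
      calc _ ≤ |‖q‖ - 1| * ‖v‖ + ‖p‖ * ‖v‖ := by
            refine (norm_add_le _ _).trans_eq ?_
            rw [norm_sub_div_norm_mul hq, norm_mul, Complex.norm_conj]
        _ = (|‖q‖ - 1| + ‖p‖) * ‖v‖ := by ring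
        _ ≤ _ := by
            gcongr
            have : |‖q‖ - 1| ≤ 2 * δ := abs_le.2 ⟨by linarith, by linarith⟩
            linarith
    · have : ∀ v, conjLin 0 (q / ‖q‖) v = q / ‖q‖ * conj v := fun v => by simp [conjLin_apply]
      simp only [this]
      exact norm_circleCoef_comp_reflection (by simp [hq]) n g

lemma IsNormalized.norm_circleCoef_le {f g : ℂ → ℝ} (hf : IsNormalized f) (hg : IsNormalized g)
    {δ : ℝ} (hδ : 0 ≤ δ) (hδ1 : δ ≤ 1) {p q : ℂ} (hd : ‖p‖ ^ 2 - ‖q‖ ^ 2 ≠ 0)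
    {l l' : ℂ →ₗ[ℝ] ℝ} (h1 : ∀ u, f u ≤ g (conjLin p q u) + l u)
    (h2 : ∀ u, g (conjLin p q u) + l u ≤ (1 + δ) * f u + l' u)
    {n : ℤ} (hn1 : n ≠ 1) (hn2 : n ≠ -1) :
    ‖circleCoef n f‖ ≤ ‖circleCoef n g‖ + 600 * δ := by
  have hfS := hf.toIsSupportLike
  have hgS := hg.toIsSupportLike
  have hG := hgS.comp_conjLin hd
  have w1 : ∀ v, width f v ≤ width (fun v => g (conjLin p q v)) v := fun v => by
    have := h1 v
    have := h1 (-v)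
    rw [map_neg l] at this
    simp only [width]
    linarith
  have w2 : ∀ v, width (fun v => g (conjLin p q v)) v ≤ (1 + δ) * width f v := fun v => by
    have := h2 v
    have := h2 (-v)
    rw [map_neg l, map_neg l'] at this
    simp only [width]
    linarith
  have m1 := hf.radial_add_norm_le hG w1
  have m2 := hf.le_radial_sub_norm hG (by positivity) w2
  have r1 := hgS.radialMoment_comp hd
  have r2 := hgS.squareMoment_comp hd
  rw [hg.radialMoment_eq, hg.squareMoment_eq, mul_zero, Complex.zero_re, mul_one, add_zero] at r1
  rw [hg.radialMoment_eq, hg.squareMoment_eq, map_zero, mul_zero, mul_zero, add_zero, zero_sub,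
    Complex.ofReal_one, mul_one] at r2
  have r3 := congrArg norm r2
  rw [norm_mul, norm_neg, norm_mul, norm_mul, Complex.norm_conj, Complex.norm_real,
    Real.norm_of_nonneg (by positivity), Complex.norm_ofNat] at r3
  rw [r1, r3] at m1 m2
  obtain ⟨O, hO, hOc⟩ := exists_isometry_near hδ hδ1 hd (by linarith) (by linarith)
  obtain ⟨φ, -, hφ⟩ := hg.exists_linear_lipschitz
  set Λ : ℂ →ₗ[ℝ] ℝ := l + φ ∘ₗ conjLin p q - φ ∘ₗ O with hΛ
  have hOcont : Continuous O := O.continuous_of_finiteDimensional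
  have hgO : Continuous fun v => g (O v) := hgS.continuous.comp hOcont
  have hΛc : Continuous Λ := Λ.continuous_of_finiteDimensional
  have key : ∀ u : ℂ, ‖u‖ = 1 → |f u - (g (O u) + Λ u)| ≤ 90 * δ := by
    intro u hu
    have a1 := hφ (conjLin p q u) (O u)
    have a2 := hO u
    rw [hu] at a2
    have a3 := h1 u
    have a4 := h2 u
    have a5 := (h1 (-u)).trans (h2 (-u))
    have a6 := hf.width_le u
    rw [width, hu] at a6
    rw [map_neg l'] at a5
    have a7 : δ * (f u + f (-u)) ≤ δ * (18 * 1) := by gcongr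
    have a8 := a1.trans (mul_le_mul_of_nonneg_left a2 (by norm_num))
    obtain ⟨a9, a10⟩ := abs_le.1 a8
    simp only [hΛ, LinearMap.sub_apply, LinearMap.add_apply, LinearMap.comp_apply]
    refine abs_le.2 ⟨by linarith, by linarith⟩
  have h3 := norm_circleCoef_sub_le hfS.continuous (hgO.add hΛc) key n
  rw [show ((fun v => g (O v)) + ⇑Λ) = fun v => g (O v) + Λ v from rfl, circleCoef_add hgO hΛc,
    circleCoef_linear Λ hn1 hn2, add_zero] at h3
  have h4 := norm_le_norm_add_norm_sub' (circleCoef n f) (circleCoef n fun v => g (O v))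
  rw [hOc] at h4
  have := Real.pi_lt_d2
  nlinarith

lemma circleCoef_neg (n : ℤ) (f : ℂ → ℝ) : circleCoef (-n) f = conj (circleCoef n f) := by
  rw [circleCoef, circleCoef, intervalIntegral.integral_of_le (by positivity),
    intervalIntegral.integral_of_le (by positivity), ← integral_conj]
  refine MeasureTheory.integral_congr_ae (Filter.Eventually.of_forall fun t => ?_)
  simp [← Complex.exp_conj]

lemma norm_circleCoef_le_of_sphere {F : ℂ → ℝ} (hF : Continuous F) {c : ℝ}
    (h : ∀ u : ℂ, ‖u‖ = 1 → |F u| ≤ c) (n : ℤ) : ‖circleCoef n F‖ ≤ 2 * Real.pi * c := by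
  have := norm_circleCoef_sub_le hF (continuous_const (y := (0 : ℝ))) (c := c)
    (fun u hu => by simpa using h u hu) n
  simpa [circleCoef] using this

lemma exists_const_near_of_circleCoef_le {F : ℂ → ℝ} (hF : Continuous F) {L ε : ℝ}
    (hL : 0 ≤ L) (hε : 0 ≤ ε) (hLip : ∀ u v, |F u - F v| ≤ L * ‖u - v‖)
    (hcoef : ∀ n : ℤ, n ≠ 0 → ‖circleCoef n F‖ ≤ ε) :
    ∃ a : ℝ, ∀ N : ℕ, 0 < N → ∀ u : ℂ, ‖u‖ = 1 →
      |F u - a| ≤ N * ε / 6 + 2 * L / √N := by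
  refine ⟨(∫ t in (0 : ℝ)..2 * Real.pi, F (Complex.exp (t * Complex.I))) / (2 * Real.pi),
    fun N hN u hu => ?_⟩
  have h1 := fejer_bound (F := fun v => F (u * v)) (by fun_prop) hL hε (fun v hv => by
    refine (hLip _ _).trans_eq ?_
    rw [← mul_sub, norm_mul, hu, one_mul, norm_sub_rev]) (fun n hn => by
    rw [norm_circleCoef_comp_rotation hu]; exact hcoef n hn) hN
  have h2 : ∫ t in (0 : ℝ)..2 * Real.pi, F (u * Complex.exp (t * Complex.I)) =
      ∫ t in (0 : ℝ)..2 * Real.pi, F (Complex.exp (t * Complex.I)) := by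
    obtain ⟨α, rfl⟩ := exists_exp_eq hu
    have h3 := circleCoef_rotation 0 F α
    rw [circleCoef_zero, circleCoef_zero] at h3
    simp at h3
    exact_mod_cast h3
  rw [mul_one, h2] at h1
  set J := ∫ t in (0 : ℝ)..2 * Real.pi, F (Complex.exp (t * Complex.I))
  have hpi := Real.pi_gt_three
  have e : F u - J / (2 * Real.pi) = (2 * Real.pi * F u - J) / (2 * Real.pi) := by
    field_simp
  rw [e, abs_div, abs_of_pos (show 0 < 2 * Real.pi by positivity), div_le_iff₀ (by positivity)]
  refine h1.trans ?_
  have h4 : (N * ε / 6) * 6 ≤ (N * ε / 6) * (2 * Real.pi) := by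
    gcongr; linarith
  calc N * ε + 4 * Real.pi * L / √N = (N * ε / 6) * 6 + 2 * L / √N * (2 * Real.pi) := by ring
    _ ≤ _ := by linarith

lemma exists_nat_balance {s : ℝ} (hs : 0 < s) (hs1 : s ≤ 1) :
    ∃ N : ℕ, 0 < N ∧ N * s ^ 3 ≤ 2 * s ∧ 1 / √N ≤ s := by
  refine ⟨⌈(s ^ 2)⁻¹⌉₊, Nat.ceil_pos.2 (by positivity), ?_, ?_⟩
  · have h1 := (Nat.ceil_lt_add_one (a := (s ^ 2)⁻¹) (by positivity)).le
    have h2 : 1 ≤ (s ^ 2)⁻¹ := (one_le_inv₀ (by positivity)).2 (by nlinarith)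
    calc _ ≤ (2 * (s ^ 2)⁻¹) * s ^ 3 := by gcongr; linarith
      _ = 2 * s := by field_simp
  · have h1 := Nat.le_ceil (s ^ 2)⁻¹
    have h2 : s⁻¹ ≤ √(⌈(s ^ 2)⁻¹⌉₊ : ℝ) := Real.le_sqrt_of_sq_le (by rwa [inv_pow])
    rw [one_div]
    exact inv_le_of_inv_le₀ hs h2

lemma IsNormalized.exists_near_const {f : ℂ → ℝ} (hf : IsNormalized f) {s : ℝ} (hs : 0 < s)
    (hs1 : s ≤ 1)
    (hcoef : ∀ n : ℤ, n ≠ 0 → n ≠ 1 → n ≠ -1 → ‖circleCoef n f‖ ≤ 600 * s ^ 3) :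
    ∃ (l : ℂ →ₗ[ℝ] ℝ) (a : ℝ), 1 / 2 - 308 * s ≤ a ∧
      ∀ u : ℂ, ‖u‖ = 1 → |f u - (l u + a)| ≤ 308 * s := by
  have hS := hf.toIsSupportLike
  obtain ⟨φ, hφ1, hφ2⟩ := hf.exists_linear_lipschitz
  have hφc : Continuous φ := φ.continuous_of_finiteDimensional
  have hGc : Continuous fun v => f v - φ v := hS.continuous.sub hφc
  have hG : ∀ u : ℂ, ‖u‖ = 1 → |f u - φ u| ≤ 18 := fun u hu => by
    have h1 := hf.width_le u
    rw [hu, width] at h1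
    have h2 := hφ1 u
    have h3 := hφ1 (-u)
    rw [map_neg] at h3
    exact abs_le.2 ⟨by linarith, by linarith⟩
  have hc1 := norm_circleCoef_le_of_sphere hGc hG 1
  set b : ℂ := circleCoef 1 (fun v => f v - φ v) / Real.pi with hb
  have hpi : (Real.pi : ℂ) ≠ 0 := by exact_mod_cast Real.pi_ne_zero
  have hbn : ‖b‖ ≤ 36 := by
    rw [hb, norm_div, Complex.norm_real, Real.norm_of_nonneg Real.pi_pos.le,
      div_le_iff₀ Real.pi_pos]
    linarith
  set m : ℂ →ₗ[ℝ] ℝ := Complex.reLm ∘ₗ LinearMap.mulLeft ℝ b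
  have hm : ∀ v, m v = (b * v).re := fun v => rfl
  have hmc : Continuous m := m.continuous_of_finiteDimensional
  have hFc : Continuous fun v => f v + (-(φ + m)) v :=
    hS.continuous.add (LinearMap.continuous_of_finiteDimensional _)
  have hF1 : circleCoef 1 (fun v => f v + (-(φ + m)) v) = 0 := by
    have e : (fun v => f v + (-(φ + m)) v) = fun v => (f v - φ v) + (-b * v).re := by
      ext v; simp [hm]; ring
    rw [e, circleCoef_add hGc (by fun_prop), circleCoef_re_mul, hb]
    simp
    field_simp
    ring
  have hLip : ∀ u v, |(f u + (-(φ + m)) u) - (f v + (-(φ + m)) v)| ≤ 54 * ‖u - v‖ := fun u v => by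
    have h1 := hφ2 u v
    have h2 : |(b * (u - v)).re| ≤ 36 * ‖u - v‖ := by
      refine (Complex.abs_re_le_norm _).trans ?_
      rw [norm_mul]; gcongr
    rw [← hm, map_sub] at h2
    rw [abs_le] at *
    simp only [LinearMap.neg_apply, LinearMap.add_apply]
    constructor <;> linarith
  obtain ⟨a, ha⟩ := exists_const_near_of_circleCoef_le hFc (ε := 600 * s ^ 3) (by norm_num)
    (by positivity) hLip (fun n hn => by
      by_cases h1 : n = 1
      · rw [h1, hF1, norm_zero]; positivity
      by_cases h2 : n = -1
      · rw [h2, circleCoef_neg, hF1, map_zero, norm_zero]; positivity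
      rw [circleCoef_add hS.continuous (LinearMap.continuous_of_finiteDimensional _),
        circleCoef_linear _ h1 h2, add_zero]
      exact hcoef n hn h1 h2)
  obtain ⟨N, hN, hN1, hN2⟩ := exists_nat_balance hs hs1
  have key : ∀ u : ℂ, ‖u‖ = 1 → |f u - ((φ + m) u + a)| ≤ 308 * s := fun u hu => by
    have h1 := ha N hN u hu
    have e : f u - ((φ + m) u + a) = f u + (-(φ + m)) u - a := by
      rw [LinearMap.neg_apply]; ring
    rw [e]
    refine h1.trans ?_
    have : 2 * 54 / √(N : ℝ) = 108 * (1 / √(N : ℝ)) := by ring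
    rw [this]
    nlinarith
  refine ⟨φ + m, a, ?_, key⟩
  obtain ⟨u, hu, h1⟩ := hf.exists_one_le_width
  have h2 := (abs_le.1 (key u hu)).2
  have h3 := (abs_le.1 (key (-u) (by rwa [norm_neg]))).2
  rw [map_neg] at h3
  rw [width] at h1
  linarith

section supportFun

variable {E : Type*} [NormedAddCommGroup E] [InnerProductSpace ℝ E] {K : Set E}

/-- The support function of `K`. -/
noncomputable def supportFun (K : Set E) (u : E) : ℝ := sSup ((fun k => inner ℝ k u) '' K)

lemma bddAbove_inner_image (hK : Bornology.IsBounded K) (u : E) :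
    BddAbove ((fun k => inner ℝ k u) '' K) := by
  obtain ⟨R, hR⟩ := hK.exists_norm_le
  refine ⟨R * ‖u‖, ?_⟩
  rintro _ ⟨k, hk, rfl⟩
  exact (real_inner_le_norm k u).trans (by gcongr; exact hR k hk)

lemma inner_le_supportFun (hK : Bornology.IsBounded K) {k : E} (hk : k ∈ K) (u : E) :
    inner ℝ k u ≤ supportFun K u :=
  le_csSup (bddAbove_inner_image hK u) ⟨k, hk, rfl⟩

lemma supportFun_le (hK : K.Nonempty) {u : E} {c : ℝ} (h : ∀ k ∈ K, inner ℝ k u ≤ c) :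
    supportFun K u ≤ c := by
  refine csSup_le (hK.image _) ?_
  rintro _ ⟨k, hk, rfl⟩
  exact h k hk

lemma exists_supportFun_eq (hK : IsCompact K) (hne : K.Nonempty) (u : E) :
    ∃ k ∈ K, inner ℝ k u = supportFun K u := by
  have hc : Continuous fun k : E => inner ℝ k u := by fun_prop
  have := (hK.image hc).sSup_mem (hne.image _)
  exact this

lemma supportFun_sub_le {K' : Set E} (hK' : K'.Nonempty) (hb : Bornology.IsBounded K)
    {ε : ℝ} (h : ∀ k' ∈ K', ∃ k ∈ K, dist k' k ≤ ε) {R : ℝ} (hR : ∀ k ∈ K, ‖k‖ ≤ R) (u u' : E) :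
    supportFun K' u' ≤ supportFun K u + (ε * ‖u'‖ + R * ‖u' - u‖) := by
  refine supportFun_le hK' fun k' hk' => ?_
  obtain ⟨k, hk, hd⟩ := h k' hk'
  have e : inner ℝ k' u' = inner ℝ k u + (inner ℝ (k' - k) u' + inner ℝ k (u' - u)) := by
    rw [inner_sub_left, inner_sub_right]; ring
  rw [e]
  have h1 := inner_le_supportFun hb hk u
  have h2 : inner ℝ (k' - k) u' ≤ ε * ‖u'‖ := (real_inner_le_norm _ _).trans (by
    gcongr; rwa [← dist_eq_norm])
  have h3 : inner ℝ k (u' - u) ≤ R * ‖u' - u‖ := (real_inner_le_norm _ _).trans (by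
    gcongr; exact hR k hk)
  linarith

lemma continuous_supportFun (hK : IsCompact K) (hne : K.Nonempty) :
    Continuous (supportFun K) := by
  obtain ⟨R, hR⟩ := hK.isBounded.exists_norm_le
  have hR0 : 0 ≤ R := (norm_nonneg _).trans (hR _ hne.some_mem)
  refine (LipschitzWith.of_le_add_mul ⟨R, hR0⟩ fun u u' => ?_).continuous
  have := supportFun_sub_le hne hK.isBounded (ε := 0) (fun k hk => ⟨k, hk, by simp⟩) hR u' u
  rwa [zero_mul, zero_add, ← dist_eq_norm] at this

end supportFun

lemma isSupportLike_supportFun {S : Set ℂ} (hS : IsCompact S) (hi : (interior S).Nonempty) :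
    IsSupportLike (supportFun S) where
  continuous := continuous_supportFun hS (hi.mono interior_subset)
  exists_support u := by
    obtain ⟨k, hk, h⟩ := exists_supportFun_eq hS (hi.mono interior_subset) u
    exact ⟨(innerSL ℝ k).toLinearMap, h, fun v => inner_le_supportFun hS.isBounded hk v⟩
  pos v hv := by
    obtain ⟨k, hk⟩ := hi
    have hc : ∀ w : ℂ, Filter.Tendsto (fun t : ℝ => k + t * w) (nhds 0) (nhds k) := fun w => by
      have : Continuous fun t : ℝ => k + t * w := by fun_prop
      simpa using this.tendsto 0
    have hev := ((hc v).eventually (isOpen_interior.mem_nhds hk)).and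
      ((hc (-v)).eventually (isOpen_interior.mem_nhds hk))
    have hev2 := (hev.filter_mono nhdsWithin_le_nhds).and (self_mem_nhdsWithin (s := Ioi (0 : ℝ)))
    obtain ⟨t, ⟨h1, h2⟩, ht⟩ := hev2.exists
    have h3 := inner_le_supportFun hS.isBounded (interior_subset h1) v
    have h4 := inner_le_supportFun hS.isBounded (interior_subset h2) (-v)
    rw [← Complex.real_smul, inner_add_left, real_inner_smul_left, real_inner_self_eq_norm_sq] at h3
    rw [← Complex.real_smul, smul_neg, inner_neg_right, inner_add_left, inner_neg_left,
      real_inner_smul_left, real_inner_self_eq_norm_sq] at h4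
    have : 0 < t * ‖v‖ ^ 2 := by
      have := norm_pos_iff.2 hv
      have : 0 < t := ht
      positivity
    linarith

lemma inner_conjLin (p q w u : ℂ) :
    inner ℝ (conjLin p q w) u = inner ℝ w (conjLin (conj p) q u) := by
  simp only [Complex.inner, conjLin_apply]
  simp
  ring

lemma exists_inner_form (φ : ℂ →ₗ[ℝ] ℝ) : ∃ b : ℂ, ∀ v, φ v = inner ℝ b v := by
  obtain ⟨b, hb⟩ := exists_re_form φ
  exact ⟨conj b, fun v => by rw [hb, Complex.inner, Complex.conj_conj, mul_comm]⟩

lemma det_ne_zero_of_injective {p q : ℂ} (h : Function.Injective (conjLin p q)) :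
    ‖p‖ ^ 2 - ‖q‖ ^ 2 ≠ 0 := by
  rw [← det_conjLin]
  have := (LinearEquiv.ofInjectiveEndo _ h).isUnit_det'
  exact this.ne_zero

lemma dBMlt.exists_supportFun_le {S S' : Set ℂ} (hS : IsCompact S) (hne : S.Nonempty)
    (hS' : IsCompact S') (hne' : S'.Nonempty) {lam : ℝ} (hlam : 0 ≤ lam) (h : dBMlt S S' lam) :
    ∃ (p q : ℂ) (l l' : ℂ →ₗ[ℝ] ℝ), ‖p‖ ^ 2 - ‖q‖ ^ 2 ≠ 0 ∧
      (∀ u, supportFun S u ≤ supportFun S' (conjLin p q u) + l u) ∧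
      ∀ u, supportFun S' (conjLin p q u) + l u ≤ lam * supportFun S u + l' u := by
  obtain ⟨T, z, h1, h2⟩ := h
  obtain ⟨p, q, hpq⟩ := exists_eq_conjLin (T.linear : ℂ →ₗ[ℝ] ℂ)
  have hT : ∀ w, T w = conjLin p q w + T 0 := fun w => by
    have := T.map_vadd 0 w
    rw [vadd_eq_add, add_zero, vadd_eq_add] at this
    rw [this, ← hpq]; rfl
  have hinj : Function.Injective (conjLin p q) := by
    rw [← hpq]; exact T.linear.injective
  refine ⟨conj p, q, (innerSL ℝ (T 0)).toLinearMap, (innerSL ℝ z).toLinearMap, ?_, fun u => ?_,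
    fun u => ?_⟩
  · rw [Complex.norm_conj]; exact det_ne_zero_of_injective hinj
  · refine supportFun_le hne fun k hk => ?_
    obtain ⟨w, hw, rfl⟩ := h1 hk
    rw [hT, inner_add_left, inner_conjLin]
    exact add_le_add_left (inner_le_supportFun hS'.isBounded hw _) _
  · obtain ⟨w, hw, he⟩ := exists_supportFun_eq hS' hne' (conjLin (conj p) q u)
    obtain ⟨_, ⟨k, hk, rfl⟩, y, hy, he'⟩ := h2 ⟨w, hw, rfl⟩
    rw [mem_singleton_iff] at hy
    subst hy
    rw [← he, ← inner_conjLin]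
    have e : inner ℝ (conjLin p q w) u + (innerSL ℝ (T 0)).toLinearMap u = inner ℝ (T w) u := by
      rw [hT w, inner_add_left]; rfl
    rw [e, ← he']
    simp only
    rw [inner_add_left, real_inner_smul_left]
    exact add_le_add_left (mul_le_mul_of_nonneg_left (inner_le_supportFun hS.isBounded hk u) hlam) _

lemma dBMlt_closedBall_of_coords {S : Set ℂ} (T : ℂ ≃ᵃ[ℝ] ℂ) (c : ℂ) {r R lam : ℝ}
    (hR : 0 < R) (hlam : 0 < lam) (hRr : R ≤ lam * r)
    (h1 : ∀ w, ‖w - c‖ ≤ r → T w ∈ S) (h2 : ∀ w, T w ∈ S → ‖w - c‖ ≤ R) :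
    dBMlt S (closedBall (0 : ℂ) 1) lam := by
  set D : ℂ ≃ᵃ[ℝ] ℂ := (LinearEquiv.smulOfNeZero ℝ ℂ R hR.ne').toAffineEquiv.trans
    (AffineEquiv.constVAdd ℝ ℂ c)
  have hD : ∀ w, D w = c + R • w := fun w => rfl
  have hT : ∀ w, T (c + w) = T.linear w + T c := fun w => by
    have := T.map_vadd c w
    rwa [vadd_eq_add, vadd_eq_add, add_comm w] at this
  refine ⟨D.trans T, (1 - lam) • T c, fun k hk => ?_, ?_⟩
  · refine ⟨R⁻¹ • (T.symm k - c), ?_, ?_⟩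
    · rw [mem_closedBall_zero_iff, norm_smul, norm_inv, Real.norm_of_nonneg hR.le,
        inv_mul_le_one₀ hR]
      exact h2 _ (by simpa using hk)
    · rw [AffineEquiv.trans_apply, hD, smul_inv_smul₀ hR.ne']
      simp
  · rintro _ ⟨w, hw, rfl⟩
    rw [mem_closedBall_zero_iff] at hw
    refine ⟨lam • T (c + (R / lam) • w), smul_mem_smul_set (h1 _ ?_), _, rfl, ?_⟩
    · rw [add_sub_cancel_left, norm_smul, Real.norm_of_nonneg (by positivity)]
      calc R / lam * ‖w‖ ≤ R / lam * 1 := by gcongr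
        _ ≤ r := by rw [mul_one, div_le_iff₀ hlam, mul_comm]; exact hRr
    · simp only [AffineEquiv.trans_apply, hD, hT, map_smul, smul_add, smul_smul, sub_smul, one_smul]
      rw [mul_div_cancel₀ _ hlam.ne']
      abel

/-- `conjLin p q` as a linear equivalence. -/
noncomputable def conjLinEquiv {p q : ℂ} (h : ‖p‖ ^ 2 - ‖q‖ ^ 2 ≠ 0) : ℂ ≃ₗ[ℝ] ℂ :=
  LinearEquiv.ofInjectiveEndo (conjLin p q) (conjLin_injective h)

lemma conjLinEquiv_apply {p q : ℂ} (h : ‖p‖ ^ 2 - ‖q‖ ^ 2 ≠ 0) (v : ℂ) :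
    conjLinEquiv h v = conjLin p q v := rfl

lemma dBMlt_closedBall_of_supportFun_near {S : Set ℂ} (hS : IsCompact S) (hconv : Convex ℝ S)
    (hi : (interior S).Nonempty) {p q : ℂ} (hd : ‖p‖ ^ 2 - ‖q‖ ^ 2 ≠ 0)
    {l : ℂ →ₗ[ℝ] ℝ} {a η lam : ℝ} (hη : 0 < a + η) (hlam : 0 < lam)
    (hle : a + η ≤ lam * (a - η))
    (h : ∀ u : ℂ, ‖u‖ = 1 → |supportFun S (conjLin p q u) - (l u + a)| ≤ η) :
    dBMlt S (closedBall (0 : ℂ) 1) lam := by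
  have hne := hi.mono interior_subset
  have hf := (isSupportLike_supportFun hS hi).comp_conjLin hd
  obtain ⟨c, hc⟩ := exists_inner_form l
  have hd' : ‖conj p‖ ^ 2 - ‖q‖ ^ 2 ≠ 0 := by rwa [Complex.norm_conj]
  set B := conjLinEquiv hd'
  have hB : ∀ x u : ℂ, inner ℝ (B x) u = inner ℝ x (conjLin p q u) := fun x u => by
    rw [conjLinEquiv_apply, inner_conjLin, Complex.conj_conj]
  have hunit : ∀ v : ℂ, v ≠ 0 → ∃ u : ℂ, ‖u‖ = 1 ∧ v = (‖v‖ : ℂ) * u := fun v hv => by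
    have : (‖v‖ : ℂ) ≠ 0 := by simpa using hv
    exact ⟨v / ‖v‖, by simp [hv], by field_simp⟩
  refine dBMlt_closedBall_of_coords B.symm.toAffineEquiv c hη hlam hle (fun w hw => ?_)
    fun w hw => ?_
  · change B.symm w ∈ S
    by_contra hns
    obtain ⟨φ, m, h1, h2⟩ := geometric_hahn_banach_closed_point hconv hS.isClosed hns
    obtain ⟨b, hb⟩ := exists_inner_form φ.toLinearMap
    have hb' : ∀ x, φ x = inner ℝ b x := hb
    obtain ⟨v, hv⟩ := (conjLinEquiv hd).surjective b
    rw [conjLinEquiv_apply] at hv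
    have h3 : supportFun S b ≤ m := supportFun_le hne fun k hk => by
      rw [real_inner_comm, ← hb']; exact (h1 k hk).le
    rw [hb', real_inner_comm, ← hv, ← hB, LinearEquiv.apply_symm_apply] at h2
    by_cases hv0 : v = 0
    · obtain ⟨k, hk⟩ := hne
      have := h1 k hk
      rw [hb', ← hv, hv0, map_zero, inner_zero_left] at this
      rw [hv0, inner_zero_right] at h2
      linarith
    obtain ⟨u, hu, hvu⟩ := hunit v hv0
    have hv0' := norm_pos_iff.2 hv0
    have h4 := hf.map_ofReal_mul (norm_nonneg v) u
    rw [← hvu, hv] at h4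
    have h5 := (abs_le.1 (h u hu)).1
    have h6 : inner ℝ w v = ‖v‖ * (inner ℝ (w - c) u + l u) := by
      nth_rewrite 1 [hvu]
      rw [← Complex.real_smul, real_inner_smul_right, hc, ← inner_add_left, sub_add_cancel]
    have h7 : inner ℝ (w - c) u ≤ a - η := by
      refine (real_inner_le_norm _ _).trans ?_
      rwa [hu, mul_one]
    have h8 : ‖v‖ * (inner ℝ (w - c) u + l u) ≤ ‖v‖ * supportFun S (conjLin p q u) := by
      gcongr; linarith
    linarith
  · change B.symm w ∈ S at hw
    by_cases hv0 : w - c = 0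
    · rw [hv0, norm_zero]; exact hη.le
    obtain ⟨u, hu, hvu⟩ := hunit _ hv0
    have h1 := inner_le_supportFun hS.isBounded hw (conjLin p q u)
    rw [← hB, LinearEquiv.apply_symm_apply] at h1
    have h2 := (abs_le.1 (h u hu)).2
    have h3 : ‖w - c‖ = inner ℝ (w - c) u := by
      nth_rewrite 2 [hvu]
      rw [← Complex.real_smul, real_inner_smul_left, real_inner_self_eq_norm_sq, hu]
      simp
    rw [h3, inner_sub_left, ← hc]
    linarith

/-- The signed area of the parallelogram spanned by `v` and `w`. -/
def crossC (v w : ℂ) : ℝ := v.re * w.im - v.im * w.re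

lemma exists_crossC_max {S : Set ℂ} (hS : IsCompact S) (hi : (interior S).Nonempty) :
    ∃ a ∈ S, ∃ b ∈ S, ∃ c ∈ S, 0 < |crossC (b - a) (c - a)| ∧
      ∀ a' ∈ S, ∀ b' ∈ S, ∀ c' ∈ S,
        |crossC (b' - a') (c' - a')| ≤ |crossC (b - a) (c - a)| := by
  have hc : Continuous fun x : ℂ × ℂ × ℂ => |crossC (x.2.1 - x.1) (x.2.2 - x.1)| := by
    unfold crossC; fun_prop
  have hne := hi.mono interior_subset
  obtain ⟨⟨a, b, c⟩, ⟨ha, hb, hc'⟩, hmax⟩ := (hS.prod (hS.prod hS)).exists_isMaxOn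
    (hne.prod (hne.prod hne)) hc.continuousOn
  have hM : ∀ a' ∈ S, ∀ b' ∈ S, ∀ c' ∈ S,
      |crossC (b' - a') (c' - a')| ≤ |crossC (b - a) (c - a)| := fun a' h1 b' h2 c' h3 =>
    hmax (show (a', b', c') ∈ S ×ˢ S ×ˢ S from ⟨h1, h2, h3⟩)
  refine ⟨a, ha, b, hb, c, hc', ?_, hM⟩
  obtain ⟨x, hx⟩ := hi
  obtain ⟨ε, hε, hball⟩ := Metric.isOpen_iff.1 isOpen_interior x hx
  have hmem : ∀ w : ℂ, ‖w‖ = 1 → x + (ε / 2 : ℝ) * w ∈ S := fun w hw => by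
    refine interior_subset (hball ?_)
    rw [mem_ball, dist_eq_norm, add_sub_cancel_left, norm_mul, hw, mul_one, Complex.norm_real,
      Real.norm_of_nonneg (by positivity)]
    linarith
  refine lt_of_lt_of_le ?_ (hM x (interior_subset hx) _ (hmem 1 (by simp)) _
    (hmem Complex.I (by simp)))
  simp [crossC]
  positivity

lemma dBMlt_closedBall_of_le {S : Set ℂ} (hS : IsCompact S) (hconv : Convex ℝ S)
    (hi : (interior S).Nonempty) {lam : ℝ} (hlam : 8 ≤ lam) :
    dBMlt S (closedBall (0 : ℂ) 1) lam := by
  obtain ⟨a, ha, b, hb, c, hc, hpos, hmax⟩ := exists_crossC_max hS hi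
  have hD : crossC (b - a) (c - a) ≠ 0 := abs_pos.1 hpos
  set L : ℂ →ₗ[ℝ] ℂ :=
    Complex.reLm.smulRight (b - a) + Complex.imLm.smulRight (c - a) with hL
  have hLv : ∀ w : ℂ, L w = w.re • (b - a) + w.im • (c - a) := fun w => rfl
  have hc1 : ∀ w : ℂ, crossC (L w) (c - a) = w.re * crossC (b - a) (c - a) := fun w => by
    rw [hLv]; simp [crossC]; ring
  have hc2 : ∀ w : ℂ, crossC (b - a) (L w) = w.im * crossC (b - a) (c - a) := fun w => by
    rw [hLv]; simp [crossC]; ring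
  have hinj : Function.Injective L := by
    refine (injective_iff_map_eq_zero L).2 fun w hw => ?_
    have h1 := hc1 w
    have h2 := hc2 w
    rw [hw] at h1 h2
    simp only [crossC, Complex.zero_re, Complex.zero_im, zero_mul, mul_zero, sub_zero] at h1 h2
    refine Complex.ext ?_ ?_
    · simpa [hD, crossC] using (mul_eq_zero.1 h1.symm).resolve_right hD
    · simpa [hD, crossC] using (mul_eq_zero.1 h2.symm).resolve_right hD
  set T : ℂ ≃ᵃ[ℝ] ℂ := (LinearEquiv.ofInjectiveEndo L hinj).toAffineEquiv.trans
    (AffineEquiv.constVAdd ℝ ℂ a)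
  have hT : ∀ w, T w = a + L w := fun w => rfl
  refine dBMlt_closedBall_of_coords T ⟨1 / 4, 1 / 4⟩ (r := 1 / 4) (R := 2) (by norm_num)
    (by linarith) (by linarith) (fun w hw => ?_) fun w hw => ?_
  · have hsq : ‖w - ⟨1 / 4, 1 / 4⟩‖ ^ 2 ≤ (1 / 4) ^ 2 := by gcongr
    rw [Complex.sq_norm, Complex.normSq_apply] at hsq
    simp only [Complex.sub_re, Complex.sub_im] at hsq
    have h1 : 0 ≤ w.re := by nlinarith [mul_self_nonneg (w.im - 1 / 4)]
    have h2 : 0 ≤ w.im := by nlinarith [mul_self_nonneg (w.re - 1 / 4)]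
    have h3 : w.re + w.im ≤ 1 := by nlinarith [mul_self_nonneg (w.re - w.im)]
    have e : T w = (1 - w.re - w.im) • a + w.re • b + w.im • c := by
      rw [hT, hLv]; module
    rw [e]
    have := hconv.sum_mem (t := (Finset.univ : Finset (Fin 3)))
      (w := ![1 - w.re - w.im, w.re, w.im]) (z := ![a, b, c])
      (fun i _ => by fin_cases i <;> simp <;> linarith)
      (by simp only [Fin.sum_univ_three, Matrix.cons_val]; ring)
      (fun i _ => by fin_cases i <;> simpa)
    simpa only [Fin.sum_univ_three, Matrix.cons_val] using this
  · have h1 := hmax a ha _ hw c hc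
    have h2 := hmax a ha b hb _ hw
    rw [hT, add_sub_cancel_left] at h1 h2
    rw [hc1, abs_mul] at h1
    rw [hc2, abs_mul] at h2
    have h3 : |w.re| ≤ 1 := le_of_mul_le_mul_right (by linarith) hpos
    have h4 : |w.im| ≤ 1 := le_of_mul_le_mul_right (by linarith) hpos
    rw [abs_le] at h3 h4
    refine le_of_sq_le_sq ?_ (by norm_num)
    rw [Complex.sq_norm, Complex.normSq_apply]
    simp only [Complex.sub_re, Complex.sub_im]
    nlinarith

lemma IsNormalized.dBMlt_closedBall {S : Set ℂ} (hS : IsCompact S) (hconv : Convex ℝ S)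
    (hi : (interior S).Nonempty) {p q : ℂ} (hd : ‖p‖ ^ 2 - ‖q‖ ^ 2 ≠ 0)
    (hf : IsNormalized fun v => supportFun S (conjLin p q v)) {s : ℝ} (hs : 0 < s)
    (hs1 : 2464 * s ≤ 1)
    (hcoef : ∀ n : ℤ, n ≠ 0 → n ≠ 1 → n ≠ -1 →
      ‖circleCoef n fun v => supportFun S (conjLin p q v)‖ ≤ 600 * s ^ 3) :
    dBMlt S (closedBall (0 : ℂ) 1) (1 + 20000 * s) := by
  obtain ⟨l, a, ha, h⟩ := hf.exists_near_const hs (by linarith) hcoef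
  exact dBMlt_closedBall_of_supportFun_near hS hconv hi hd (by linarith) (by positivity)
    (by nlinarith) h

lemma exists_normalized_supportFun {S : Set ℂ} (hS : IsCompact S) (hi : (interior S).Nonempty) :
    ∃ p q : ℂ, ‖p‖ ^ 2 - ‖q‖ ^ 2 ≠ 0 ∧ IsNormalized (fun v => supportFun S (conjLin p q v)) ∧
      ∀ n, circleCoef n (fun v => supportFun S
        (conjLin (normP (supportFun S)) (squareMoment (supportFun S)) v)) = 0 →
        circleCoef n (fun v => supportFun S (conjLin p q v)) = 0 := by
  have hf := isSupportLike_supportFun hS hi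
  obtain ⟨τ, hτ, hN⟩ := hf.exists_normalized
  refine ⟨_, _, ?_, hN, fun n hn => ?_⟩
  · have := hf.normP_det_pos
    rw [norm_mul, norm_mul, Complex.norm_real, mul_pow, mul_pow, ← mul_sub, Real.norm_eq_abs,
      sq_abs]
    positivity
  · have e : ∀ v, supportFun S (conjLin (τ * normP (supportFun S))
        (τ * squareMoment (supportFun S)) v) = τ * supportFun S
        (conjLin (normP (supportFun S)) (squareMoment (supportFun S)) v) := fun v => by
      rw [← hf.map_ofReal_mul hτ.le]
      congr 1
      simp only [conjLin_apply]
      ring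
    simp only [e]
    rw [circleCoef_const_mul, hn, mul_zero]

theorem dBMlt_closedBall_of_family {ι : Type*} {S : ι → Set ℂ} (hS : ∀ i, IsCompact (S i))
    (hconv : ∀ i, Convex ℝ (S i)) (hi : ∀ i, (interior (S i)).Nonempty) {δ : ℝ} (hδ : 0 < δ)
    (hBM : ∀ i j, dBMlt (S i) (S j) (1 + δ))
    (hzero : ∀ n : ℤ, n ≠ 0 → ∃ i, circleCoef n (fun v => supportFun (S i)
      (conjLin (normP (supportFun (S i))) (squareMoment (supportFun (S i))) v)) = 0) (i : ι) :
    dBMlt (S i) (closedBall (0 : ℂ) 1) (1 + 20000 * δ ^ ((1 : ℝ) / 3)) := by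
  set s := δ ^ ((1 : ℝ) / 3) with hs
  have hs0 : 0 < s := by positivity
  have hs3 : s ^ 3 = δ := by
    rw [hs, ← Real.rpow_natCast, ← Real.rpow_mul hδ.le]; norm_num
  rcases le_or_gt (2464 * s) 1 with hs1 | hs1
  · obtain ⟨p, q, hd, hf, -⟩ := exists_normalized_supportFun (hS i) (hi i)
    refine hf.dBMlt_closedBall (hS i) (hconv i) (hi i) hd hs0 hs1 fun n hn0 hn1 hn2 => ?_
    obtain ⟨j, hj⟩ := hzero n hn0
    obtain ⟨p', q', hd', hg, hz⟩ := exists_normalized_supportFun (hS j) (hi j)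
    obtain ⟨P, Q, l, l', hD, h1, h2⟩ := (hBM i j).exists_supportFun_le (hS i)
      ((hi i).mono interior_subset) (hS j) ((hi j).mono interior_subset) (by positivity)
    set B := conjLinEquiv hd'
    obtain ⟨x, y, hxy⟩ := exists_eq_conjLin
      ((B.symm : ℂ →ₗ[ℝ] ℂ) ∘ₗ conjLin P Q ∘ₗ conjLin p q)
    have hxy' : ∀ v, conjLin p' q' (conjLin x y v) = conjLin P Q (conjLin p q v) := fun v => by
      rw [← hxy, ← conjLinEquiv_apply hd']
      simp [B]
    have hinj : Function.Injective (conjLin x y) := by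
      rw [← hxy]
      exact B.symm.injective.comp ((conjLin_injective hD).comp (conjLin_injective hd))
    have := hf.norm_circleCoef_le hg hδ.le (by rw [← hs3]; exact pow_le_one₀ hs0.le (by linarith))
      (det_ne_zero_of_injective hinj) (l := l ∘ₗ conjLin p q) (l' := l' ∘ₗ conjLin p q)
      (fun u => by rw [hxy']; exact h1 _) (fun u => by rw [hxy']; exact h2 _) hn1 hn2
    rwa [hz n hj, norm_zero, zero_add, ← hs3] at this
  · exact dBMlt_closedBall_of_le (hS i) (hconv i) (hi i) (by linarith)

/-- Fourier coefficient, on the unit circle, of `f` put in isotropic position. -/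
noncomputable def normCoef (n : ℤ) (f : ℂ → ℝ) : ℂ :=
  circleCoef n fun v => f (conjLin (normP f) (squareMoment f) v)

lemma normCoef_rotation (n : ℤ) {f : ℂ → ℝ} (hf : IsSupportLike f) (α : ℝ) :
    normCoef n (fun v => f (Complex.exp (α * Complex.I) * v)) =
      Complex.exp (n * α * Complex.I) * normCoef n f := by
  set ω := Complex.exp (α * Complex.I) with hω
  have hω1 : ‖ω‖ = 1 := Complex.norm_exp_ofReal_mul_I α
  have hωω : ω * conj ω = 1 := by rw [Complex.mul_conj', hω1]; simp
  have hd : ‖ω‖ ^ 2 - ‖(0 : ℂ)‖ ^ 2 ≠ 0 := by simp [hω1]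
  have e : ∀ v, conjLin ω 0 v = ω * v := fun v => by simp [conjLin_apply]
  have h1 := hf.radialMoment_comp hd
  have h2 := hf.squareMoment_comp hd
  simp only [e] at h1 h2
  simp [hω1] at h1 h2
  have h3 : normP (fun v => f (ω * v)) = normP f := by
    rw [normP, normP, h1, h2, norm_mul, norm_pow, Complex.norm_conj, hω1, one_pow, one_mul]
  rw [normCoef, h3, h2, normCoef,
    ← circleCoef_rotation n (fun v => f (conjLin (normP f) (squareMoment f) v)) α]
  congr 1
  ext v
  congr 1
  simp only [conjLin_apply, ← hω, map_mul]
  linear_combination conj ω * squareMoment f * conj v * hωω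

section continuity

variable {Y : Type*} [TopologicalSpace Y] {F : Y → ℂ → ℝ}

lemma continuous_width_uncurry (hF : Continuous fun x : Y × ℂ => F x.1 x.2) :
    Continuous fun x : Y × ℂ => width (F x.1) x.2 :=
  hF.add (hF.comp (continuous_fst.prodMk continuous_snd.neg))

lemma exists_eventually_mul_norm_le_width (hF : Continuous fun x : Y × ℂ => F x.1 x.2)
    (hS : ∀ y, IsSupportLike (F y)) (y₀ : Y) :
    ∃ r, 0 < r ∧ ∀ᶠ y in nhds y₀, ∀ v, r * ‖v‖ ≤ width (F y) v := by
  obtain ⟨r, hr, h⟩ := (hS y₀).exists_mul_norm_le_width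
  refine ⟨r / 2, by positivity, ?_⟩
  have hw := continuous_width_uncurry hF
  have : ∀ᶠ y in nhds y₀, ∀ v ∈ sphere (0 : ℂ) 1, r / 2 < width (F y) v := by
    refine (isCompact_sphere (0 : ℂ) 1).eventually_forall_of_forall_eventually fun v hv => ?_
    refine (hw.tendsto (y₀, v)).eventually_const_lt ?_
    have h1 := h v
    rw [mem_sphere_zero_iff_norm] at hv
    rw [hv] at h1
    simp only
    linarith
  filter_upwards [this] with y hy
  exact (hS y).mul_norm_le_width_of_sphere fun v hv => (hy v (by simpa using hv)).le

lemma continuous_integral_exp_neg_width [FirstCountableTopology Y] {E : Type*}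
    [NormedAddCommGroup E] [NormedSpace ℝ E] (hF : Continuous fun x : Y × ℂ => F x.1 x.2)
    (hS : ∀ y, IsSupportLike (F y)) {k : ℂ → E} (hk : Continuous k)
    (hk1 : ∀ v, ‖k v‖ ≤ ‖v‖ ^ 2) :
    Continuous fun y => ∫ v, Real.exp (-width (F y) v) • k v := by
  refine continuous_iff_continuousAt.2 fun y₀ => ?_
  obtain ⟨r, hr, h⟩ := exists_eventually_mul_norm_le_width hF hS y₀
  have hw := continuous_width_uncurry hF
  refine MeasureTheory.continuousAt_of_dominated (Filter.Eventually.of_forall fun y => ?_) ?_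
    (integrable_exp_neg_mul_norm hr) (Filter.Eventually.of_forall fun v => ?_)
  · have := (hS y).continuous_width
    exact Continuous.aestronglyMeasurable (by fun_prop)
  · filter_upwards [h] with y hy
    refine Filter.Eventually.of_forall fun v => ?_
    rw [norm_smul, Real.norm_of_nonneg (by positivity)]
    gcongr
    · exact hy v
    · exact (hk1 v).trans (by linarith)
  · have : Continuous fun y => width (F y) v := hw.comp (continuous_id.prodMk continuous_const)
    exact Continuous.continuousAt (by fun_prop)

lemma continuous_normCoef [FirstCountableTopology Y] (hF : Continuous fun x : Y × ℂ => F x.1 x.2)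
    (hS : ∀ y, IsSupportLike (F y)) (n : ℤ) : Continuous fun y => normCoef n (F y) := by
  have h1 : Continuous fun y => radialMoment (F y) :=
    continuous_integral_exp_neg_width hF hS (k := fun v => ‖v‖ ^ 2) (by fun_prop) fun v => by simp
  have h2 : Continuous fun y => squareMoment (F y) := by
    simp only [squareMoment, ← Complex.real_smul]
    exact continuous_integral_exp_neg_width hF hS (k := fun v => v ^ 2) (by fun_prop)
      fun v => by simp
  have h3 : Continuous fun y => normP (F y) := by
    unfold normP; fun_prop
  unfold normCoef circleCoef
  refine intervalIntegral.continuous_parametric_intervalIntegral_of_continuous' ?_ _ _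
  have h4 : Continuous fun x : Y × ℝ => F x.1 (conjLin (normP (F x.1)) (squareMoment (F x.1))
      (Complex.exp (x.2 * Complex.I))) := by
    refine hF.comp (continuous_fst.prodMk ?_)
    simp only [conjLin_apply]
    have h5 : Continuous fun x : Y × ℝ => Complex.exp (x.2 * Complex.I) := by fun_prop
    exact ((h3.comp continuous_fst).mul h5).add
      ((h2.comp continuous_fst).mul (Complex.continuous_conj.comp h5))
  exact (Complex.continuous_ofReal.comp h4).mul (by fun_prop)

end continuity

lemma exists_dist_le_hausdorffDist {α : Type*} [PseudoMetricSpace α] {s t : Set α}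
    (hs : IsCompact s) (hs' : s.Nonempty) (ht : IsCompact t) (ht' : t.Nonempty) {a : α}
    (ha : a ∈ s) : ∃ b ∈ t, dist a b ≤ hausdorffDist s t := by
  obtain ⟨b, hb, h⟩ := ht.exists_infDist_eq_dist ht' a
  exact ⟨b, hb, h ▸ infDist_le_hausdorffDist_of_mem ha
    (hausdorffEDist_ne_top_of_nonempty_of_bounded hs' ht' hs.isBounded ht.isBounded)⟩

lemma continuous_uncurry_supportFun {X E : Type*} [TopologicalSpace X] [NormedAddCommGroup E]
    [InnerProductSpace ℝ E] {K : X → Set E} (hK : ∀ x, IsCompact (K x))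
    (hne : ∀ x, (K x).Nonempty)
    (h : ∀ x₀, Filter.Tendsto (fun x => hausdorffDist (K x) (K x₀)) (nhds x₀) (nhds 0)) :
    Continuous fun p : X × E => supportFun (K p.1) p.2 := by
  refine continuous_iff_continuousAt.2 fun ⟨x₀, u₀⟩ => ?_
  obtain ⟨R, hR⟩ := (hK x₀).isBounded.exists_norm_le
  rw [ContinuousAt, tendsto_iff_dist_tendsto_zero]
  have hd : Filter.Tendsto (fun p : X × E => hausdorffDist (K p.1) (K x₀)) (nhds (x₀, u₀))
      (nhds 0) := (h x₀).comp (continuous_fst.tendsto' _ _ rfl)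
  have hu : Filter.Tendsto (fun p : X × E => ‖p.2‖) (nhds (x₀, u₀)) (nhds ‖u₀‖) :=
    (continuous_norm.comp continuous_snd).tendsto' _ _ rfl
  have hv : Filter.Tendsto (fun p : X × E => R * ‖p.2 - u₀‖) (nhds (x₀, u₀)) (nhds 0) := by
    have : Continuous fun p : X × E => R * ‖p.2 - u₀‖ := by fun_prop
    exact this.tendsto' _ _ (by simp)
  have hlim := (hd.mul hu).add hv
  rw [zero_mul, zero_add] at hlim
  refine squeeze_zero (fun _ => dist_nonneg) (fun ⟨x, u⟩ => ?_) hlim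
  obtain ⟨R', hR'⟩ := (hK x).isBounded.exists_norm_le
  have h1 := supportFun_sub_le (hne x) (hK x₀).isBounded
    (fun k hk => exists_dist_le_hausdorffDist (hK x) (hne x) (hK x₀) (hne x₀) hk) hR u₀ u
  have h2 := supportFun_sub_le (hne x₀) (hK x₀).isBounded (ε := 0)
    (fun k hk => ⟨k, hk, by simp⟩) hR u u₀
  have h3 := supportFun_sub_le (hne x₀) (hK x).isBounded
    (fun k hk => exists_dist_le_hausdorffDist (hK x₀) (hne x₀) (hK x) (hne x) hk) hR' u u
  rw [hausdorffDist_comm, sub_self, norm_zero] at h3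
  rw [norm_sub_rev] at h2
  simp only
  rw [Real.dist_eq, abs_le]
  constructor <;> linarith

lemma dBMlt.preimage {V W V' W' : Type*} [AddCommGroup V] [Module ℝ V] [AddCommGroup W]
    [Module ℝ W] [AddCommGroup V'] [Module ℝ V'] [AddCommGroup W'] [Module ℝ W'] {K : Set V}
    {L : Set W} {lam : ℝ} (h : dBMlt K L lam) (e : V' ≃ₗ[ℝ] V) (e' : W' ≃ₗ[ℝ] W) :
    dBMlt (e ⁻¹' K) (e' ⁻¹' L) lam := by
  obtain ⟨T, z, h1, h2⟩ := h
  refine ⟨e'.toAffineEquiv.trans (T.trans e.symm.toAffineEquiv), e.symm z, fun k hk => ?_, ?_⟩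
  · obtain ⟨w, hw, hw'⟩ := h1 hk
    refine ⟨e'.symm w, by simpa using hw, ?_⟩
    simp [hw']
  · rintro _ ⟨w, hw, rfl⟩
    obtain ⟨_, ⟨k, hk, rfl⟩, _, rfl, he⟩ := h2 ⟨e' w, hw, rfl⟩
    refine ⟨lam • e.symm k, smul_mem_smul_set (by simpa using hk), _, rfl, ?_⟩
    simp only at he
    simp [← he]

section sphere

open Module

/-- The point of the unit sphere with polar angle `p.1` and azimuth `p.2`. -/
noncomputable def spherePoint (p : ℝ × ℝ) : sphere (0 : EuclideanSpace ℝ (Fin 3)) 1 :=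
  ⟨!₂[Real.sin p.1 * Real.cos p.2, Real.sin p.1 * Real.sin p.2, Real.cos p.1], by
    rw [mem_sphere_zero_iff_norm, EuclideanSpace.norm_eq, Real.sqrt_eq_one, Fin.sum_univ_three]
    simp only [Real.norm_eq_abs, sq_abs]
    simp
    nlinarith [Real.sin_sq_add_cos_sq p.1, Real.sin_sq_add_cos_sq p.2]⟩

/-- The orthonormal tangent frame at `spherePoint p` along the meridian and the parallel. -/
noncomputable def sphereFrame (p : ℝ × ℝ) : ℂ →ₗᵢ[ℝ] EuclideanSpace ℝ (Fin 3) where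
  toFun v := !₂[v.re * (Real.cos p.1 * Real.cos p.2) - v.im * Real.sin p.2,
    v.re * (Real.cos p.1 * Real.sin p.2) + v.im * Real.cos p.2, -(v.re * Real.sin p.1)]
  map_add' v w := by
    ext i
    fin_cases i <;> simp <;> ring
  map_smul' c v := by
    ext i
    fin_cases i <;> simp <;> ring
  norm_map' v := by
    rw [← sq_eq_sq₀ (norm_nonneg _) (norm_nonneg _), EuclideanSpace.norm_sq_eq,
      Fin.sum_univ_three, Complex.sq_norm, Complex.normSq_apply]
    simp only [Real.norm_eq_abs, sq_abs]
    simp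
    have h1 := Real.sin_sq_add_cos_sq p.1
    have h2 := Real.sin_sq_add_cos_sq p.2
    linear_combination (v.re ^ 2 * Real.cos p.1 ^ 2 + v.im ^ 2) * h2 + v.re ^ 2 * h1

lemma sphereFrame_apply (p : ℝ × ℝ) (v : ℂ) : sphereFrame p v =
    !₂[v.re * (Real.cos p.1 * Real.cos p.2) - v.im * Real.sin p.2,
    v.re * (Real.cos p.1 * Real.sin p.2) + v.im * Real.cos p.2, -(v.re * Real.sin p.1)] := rfl

lemma continuous_spherePoint : Continuous spherePoint := by
  refine Continuous.subtype_mk ?_ _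
  fun_prop

lemma continuous_sphereFrame : Continuous fun q : (ℝ × ℝ) × ℂ => sphereFrame q.1 q.2 := by
  simp only [sphereFrame_apply]
  fun_prop

lemma sphereFrame_mem (p : ℝ × ℝ) (v : ℂ) : sphereFrame p v ∈ tangentPlane (spherePoint p) := by
  rw [tangentPlane, Submodule.mem_orthogonal_singleton_iff_inner_left, sphereFrame_apply,
    spherePoint, PiLp.inner_apply, Fin.sum_univ_three]
  simp
  linear_combination v.re * Real.sin p.1 * Real.cos p.1 * Real.sin_sq_add_cos_sq p.2

lemma finrank_tangentPlane (x : sphere (0 : EuclideanSpace ℝ (Fin 3)) 1) :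
    finrank ℝ (tangentPlane x) = 2 := by
  have : Fact (finrank ℝ (EuclideanSpace ℝ (Fin 3)) = 2 + 1) := ⟨by simp⟩
  exact Submodule.finrank_orthogonal_span_singleton (ne_zero_of_mem_unit_sphere x)

/-- The frame `sphereFrame p` as an isometry onto the tangent plane. -/
noncomputable def tangentFrame (p : ℝ × ℝ) : ℂ ≃ₗᵢ[ℝ] tangentPlane (spherePoint p) :=
  LinearIsometry.toLinearIsometryEquiv
    (⟨(sphereFrame p).toLinearMap.codRestrict _ (sphereFrame_mem p), (sphereFrame p).norm_map⟩ :
      ℂ →ₗᵢ[ℝ] tangentPlane (spherePoint p))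
    (by rw [Complex.finrank_real_complex, finrank_tangentPlane])

lemma nonempty_complex_equiv_tangentPlane (x : sphere (0 : EuclideanSpace ℝ (Fin 3)) 1) :
    Nonempty (ℂ ≃ₗᵢ[ℝ] tangentPlane x) :=
  ⟨Complex.orthonormalBasisOneI.repr.trans
    ((stdOrthonormalBasis ℝ (tangentPlane x)).reindex
      (finCongr (finrank_tangentPlane x))).repr.symm⟩

lemma isCompact_preimage_tangentPlane {x : sphere (0 : EuclideanSpace ℝ (Fin 3)) 1}
    {K : Set (EuclideanSpace ℝ (Fin 3))} (hK : IsCompact K) (J : ℂ ≃ₗᵢ[ℝ] tangentPlane x) :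
    IsCompact (J ⁻¹' (Subtype.val ⁻¹' K)) := by
  have hc : IsClosed (tangentPlane x : Set (EuclideanSpace ℝ (Fin 3))) :=
    Submodule.isClosed_orthogonal _
  exact J.toHomeomorph.isCompact_preimage.2 (hc.isClosedEmbedding_subtypeVal.isCompact_preimage hK)

lemma nonempty_interior_preimage {V W : Type*} [NormedAddCommGroup V] [InnerProductSpace ℝ V]
    [NormedAddCommGroup W] [InnerProductSpace ℝ W] {L : Set W} (hL : (interior L).Nonempty)
    (J : V ≃ₗᵢ[ℝ] W) : (interior (J ⁻¹' L)).Nonempty := by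
  have := J.toHomeomorph.preimage_interior L
  rw [LinearIsometryEquiv.coe_toHomeomorph] at this
  rw [← this]
  exact hL.preimage J.surjective

lemma supportFun_preimage {V E : Type*} [NormedAddCommGroup V] [InnerProductSpace ℝ V]
    [NormedAddCommGroup E] [InnerProductSpace ℝ E] {M : Submodule ℝ E} {K : Set E}
    (hK : K ⊆ M) (J : V ≃ₗᵢ[ℝ] M) (v : V) :
    supportFun (J ⁻¹' (Subtype.val ⁻¹' K)) v = supportFun K (J v : E) := by
  unfold supportFun
  congr 1
  ext r
  constructor
  · rintro ⟨w, hw, rfl⟩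
    exact ⟨J w, hw, (Submodule.coe_inner M _ _).symm.trans (J.inner_map_map w v)⟩
  · rintro ⟨k, hk, rfl⟩
    refine ⟨J.symm ⟨k, hK hk⟩, by simpa using hk, ?_⟩
    simp only
    rw [← J.inner_map_map, J.apply_symm_apply, Submodule.coe_inner]

lemma exists_normCoef_tangentPlane_eq_zero
    {K : sphere (0 : EuclideanSpace ℝ (Fin 3)) 1 → Set (EuclideanSpace ℝ (Fin 3))}
    (hsub : ∀ x, K x ⊆ tangentPlane x) (hK : ∀ x, IsCompact (K x))
    (hi : ∀ x, (interior (Subtype.val ⁻¹' (K x) : Set (tangentPlane x))).Nonempty)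
    (hcont : ∀ x₀, Filter.Tendsto (fun x => hausdorffDist (K x) (K x₀)) (nhds x₀) (nhds 0))
    {n : ℤ} (hn : n ≠ 0) :
    ∃ (x : sphere (0 : EuclideanSpace ℝ (Fin 3)) 1) (J : ℂ ≃ₗᵢ[ℝ] tangentPlane x),
      normCoef n (supportFun (J ⁻¹' (Subtype.val ⁻¹' K x))) = 0 := by
  set F : ℝ × ℝ → ℂ → ℝ := fun p v => supportFun (K (spherePoint p)) (sphereFrame p v)
  have hF : ∀ p, supportFun (tangentFrame p ⁻¹' (Subtype.val ⁻¹' K (spherePoint p))) = F p :=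
    fun p => funext fun v => supportFun_preimage (hsub _) _ v
  have hS : ∀ p, IsSupportLike (F p) := fun p => by
    rw [← hF]
    exact isSupportLike_supportFun (isCompact_preimage_tangentPlane (hK _) _)
      (nonempty_interior_preimage (hi _) _)
  have hne : ∀ x, (K x).Nonempty := fun x => by
    obtain ⟨y, hy⟩ := (hi x).mono interior_subset
    exact ⟨y, hy⟩
  have hFc : Continuous fun q : (ℝ × ℝ) × ℂ => F q.1 q.2 :=
    (continuous_uncurry_supportFun hK hne hcont).comp
      ((continuous_spherePoint.comp continuous_fst).prodMk continuous_sphereFrame)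
  have hrot : ∀ s t α : ℝ, spherePoint (s, t) = spherePoint (s, 0) →
      (∀ v, sphereFrame (s, t) v = sphereFrame (s, 0) (Complex.exp (α * Complex.I) * v)) →
      normCoef n (F (s, t)) = Complex.exp (n * α * Complex.I) * normCoef n (F (s, 0)) :=
    fun s t α h h' => by
      rw [← normCoef_rotation n (hS (s, 0)) α]
      simp only [F, h, h']
  suffices hz : ∃ p, normCoef n (F p) = 0 by
    obtain ⟨p, hp⟩ := hz
    exact ⟨_, tangentFrame p, by rw [hF]; exact hp⟩
  refine exists_zero_of_twisted hn (H := fun p => normCoef n (F p))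
    (continuous_normCoef hFc hS n) (fun s => ?_) (fun t => hrot 0 t t ?_ fun v => ?_) (fun t => ?_)
  · simp only [F, spherePoint, sphereFrame_apply, Real.cos_two_pi, Real.sin_two_pi, Real.cos_zero,
      Real.sin_zero]
  · simp [spherePoint]
  · simp [sphereFrame_apply, Complex.exp_ofReal_mul_I_re, Complex.exp_ofReal_mul_I_im]
    constructor <;> ring
  · have := hrot Real.pi t (-t) (by simp [spherePoint]) fun v => by
      simp only [sphereFrame_apply, Complex.mul_re, Complex.mul_im, Complex.exp_ofReal_mul_I_re,
        Complex.exp_ofReal_mul_I_im, Real.cos_neg, Real.sin_neg, Real.cos_pi, Real.sin_pi,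
        Real.cos_zero, Real.sin_zero]
      ext i
      fin_cases i <;> simp <;> ring
    simp only [this]
    congr 2
    push_cast
    ring

end sphere

end

theorem stmt13 :
    ∃ c : ℝ, 0 < c ∧
      ∀ K : Metric.sphere (0 : EuclideanSpace ℝ (Fin 3)) 1 → Set (EuclideanSpace ℝ (Fin 3)),
        (∀ x, K x ⊆ (tangentPlane x : Set (EuclideanSpace ℝ (Fin 3)))) →
        (∀ x, IsCompact (K x)) →
        (∀ x, Convex ℝ (K x)) →
        (∀ x, (interior (Subtype.val ⁻¹' (K x) : Set (tangentPlane x))).Nonempty) →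
        (∀ x₀, Filter.Tendsto (fun x => Metric.hausdorffDist (K x) (K x₀))
          (nhds x₀) (nhds 0)) →
        ∀ δ : ℝ, 0 < δ →
          (∀ x y, dBMlt (Subtype.val ⁻¹' (K x) : Set (tangentPlane x))
            (Subtype.val ⁻¹' (K y) : Set (tangentPlane y)) (1 + δ)) →
          ∀ x, dBMlt (Subtype.val ⁻¹' (K x) : Set (tangentPlane x))
            (closedBall (0 : EuclideanSpace ℝ (Fin 2)) 1) (1 + c * δ ^ ((1 : ℝ) / 3)) := by
  refine ⟨20000, by norm_num, fun K hsub hK hconv hi hcont δ hδ hBM x => ?_⟩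
  let S : (Σ x : sphere (0 : EuclideanSpace ℝ (Fin 3)) 1, ℂ ≃ₗᵢ[ℝ] tangentPlane x) → Set ℂ :=
    fun i => i.2 ⁻¹' (Subtype.val ⁻¹' K i.1)
  obtain ⟨J⟩ := nonempty_complex_equiv_tangentPlane x
  have h := dBMlt_closedBall_of_family (S := S)
    (fun i => isCompact_preimage_tangentPlane (hK _) _)
    (fun i => ((hconv i.1).linear_preimage (tangentPlane i.1).subtype).linear_preimage
      i.2.toLinearEquiv.toLinearMap)
    (fun i => nonempty_interior_preimage (hi _) _) hδ
    (fun i j => (hBM i.1 j.1).preimage i.2.toLinearEquiv j.2.toLinearEquiv)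
    (fun n hn => by
      obtain ⟨x, J, h⟩ := exists_normCoef_tangentPlane_eq_zero hsub hK hi hcont hn
      exact ⟨⟨x, J⟩, h⟩) ⟨x, J⟩
  have h' := h.preimage J.symm.toLinearEquiv Complex.orthonormalBasisOneI.repr.symm.toLinearEquiv
  convert h' using 1
  · ext y
    simp [S]
  · ext y
    simp
end
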